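/- Global Hölder estimates in space, uniform in time, for smooth initial data: let m > 2, λ ≥ 0, f ∈ C(Ω̄), u₀ ∈ C²(Ω̄) and g ∈ C(∂Ω) with u₀ = g on ∂Ω, and let u be the unique continuous viscosity solution of E(Ω,f,g,u₀,λ). Then there exists a constant C* > 0 (depending on u₀, f, g, λ but not on t) such that |u(x,t+h) − u(x,t)| ≤ C*·h for all x ∈ Ω̄ and all t, h ≥ 0, and there exists a constant M > 0, independent of t, such that |u(x,t) − u(y,t)| ≤ M |x−y|^{(m−2)/(m−1)} for all x, y ∈ Ω̄ and all t ≥ 0. -/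

import Mathlib

open Set Filter Topology Metric MeasureTheory

noncomputable section

/-- Euclidean space `ℝ^N`. -/
abbrev Euc (N : ℕ) : Type := EuclideanSpace ℝ (Fin N)

/-- The Laplacian of `φ` at `x`, computed as the trace of the second derivative
in the standard orthonormal basis of `ℝ^N`. -/
noncomputable def lapl {N : ℕ} (φ : Euc N → ℝ) (x : Euc N) : ℝ :=
  ∑ i : Fin N,
    iteratedFDeriv ℝ 2 φ x ![EuclideanSpace.single i 1, EuclideanSpace.single i 1]

/-- `Ω` is a domain with `C²` boundary: it is the sublevel set of a `C²`
defining function whose gradient does not vanish on the boundary. -/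
def HasC2Boundary {N : ℕ} (Ω : Set (Euc N)) : Prop :=
  ∃ ρ : Euc N → ℝ, ContDiff ℝ 2 ρ ∧ Ω = {x | ρ x < 0} ∧
    frontier Ω = {x | ρ x = 0} ∧ ∀ x ∈ frontier Ω, gradient ρ x ≠ 0

/-- The stationary operator `−Δφ(x) + |Dφ(x)|^m + λ r − h(x)` evaluated with the
value `r` of the (sub/super)solution at `x`. -/
noncomputable def statOp {N : ℕ} (h : Euc N → ℝ) (lam m : ℝ)
    (φ : Euc N → ℝ) (r : ℝ) (x : Euc N) : ℝ :=
  -lapl φ x + ‖gradient φ x‖ ^ m + lam * r - h x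

/-- Viscosity subsolution of the generalized Dirichlet problem
`S(Ω,h,k,λ)`: `−Δw + |Dw|^m + λ w = h` in `Ω`, `w = k` on `∂Ω`. -/
def IsStatSub {N : ℕ} (Ω : Set (Euc N)) (h k : Euc N → ℝ) (lam m : ℝ)
    (u : Euc N → ℝ) : Prop :=
  UpperSemicontinuousOn u (closure Ω) ∧
  ∀ φ : Euc N → ℝ, ContDiff ℝ 2 φ → ∀ x₀ ∈ closure Ω,
    IsLocalMaxOn (u - φ) (closure Ω) x₀ →
      (x₀ ∈ Ω → statOp h lam m φ (u x₀) x₀ ≤ 0) ∧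
      (x₀ ∈ frontier Ω → min (statOp h lam m φ (u x₀) x₀) (u x₀ - k x₀) ≤ 0)

/-- Viscosity supersolution of the generalized Dirichlet problem `S(Ω,h,k,λ)`. -/
def IsStatSuper {N : ℕ} (Ω : Set (Euc N)) (h k : Euc N → ℝ) (lam m : ℝ)
    (v : Euc N → ℝ) : Prop :=
  LowerSemicontinuousOn v (closure Ω) ∧
  ∀ φ : Euc N → ℝ, ContDiff ℝ 2 φ → ∀ x₀ ∈ closure Ω,
    IsLocalMinOn (v - φ) (closure Ω) x₀ →
      (x₀ ∈ Ω → 0 ≤ statOp h lam m φ (v x₀) x₀) ∧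
      (x₀ ∈ frontier Ω → 0 ≤ max (statOp h lam m φ (v x₀) x₀) (v x₀ - k x₀))

/-- The parabolic operator
`φ_t(x,t) − Δφ(·,t)(x) + |Dφ(·,t)(x)|^m + λ r − f(x)`. -/
noncomputable def parOp {N : ℕ} (f : Euc N → ℝ) (lam m : ℝ)
    (φ : Euc N × ℝ → ℝ) (r : ℝ) (x : Euc N) (t : ℝ) : ℝ :=
  deriv (fun s => φ (x, s)) t - lapl (fun y => φ (y, t)) x
    + ‖gradient (fun y => φ (y, t)) x‖ ^ m + lam * r - f x

/-- Viscosity subsolution of the generalized initial-boundary value problem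
`E(Ω,f,g,u₀,λ)` on the time interval `[0,T]`:
`u_t − Δu + |Du|^m + λ u = f` in `Ω × (0,T]`, `u = g` on `∂Ω × (0,T]`,
`u(·,0) = u₀` on `closure Ω`. -/
def IsParSub {N : ℕ} (Ω : Set (Euc N)) (f g u₀ : Euc N → ℝ) (lam m T : ℝ)
    (u : Euc N → ℝ → ℝ) : Prop :=
  UpperSemicontinuousOn (fun p : Euc N × ℝ => u p.1 p.2) (closure Ω ×ˢ Ico 0 T) ∧
  (∀ x ∈ closure Ω, u x 0 ≤ u₀ x) ∧
  ∀ φ : Euc N × ℝ → ℝ, ContDiff ℝ 2 φ → ∀ x₀ : Euc N, ∀ t₀ : ℝ,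
    (x₀, t₀) ∈ closure Ω ×ˢ Ioc 0 T →
    IsLocalMaxOn (fun p : Euc N × ℝ => u p.1 p.2 - φ p) (closure Ω ×ˢ Ioc 0 T) (x₀, t₀) →
      (x₀ ∈ Ω → parOp f lam m φ (u x₀ t₀) x₀ t₀ ≤ 0) ∧
      (x₀ ∈ frontier Ω →
        min (parOp f lam m φ (u x₀ t₀) x₀ t₀) (u x₀ t₀ - g x₀) ≤ 0)

/-- Viscosity supersolution of `E(Ω,f,g,u₀,λ)` on the time interval `[0,T]`. -/
def IsParSuper {N : ℕ} (Ω : Set (Euc N)) (f g u₀ : Euc N → ℝ) (lam m T : ℝ)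
    (v : Euc N → ℝ → ℝ) : Prop :=
  LowerSemicontinuousOn (fun p : Euc N × ℝ => v p.1 p.2) (closure Ω ×ˢ Icc 0 T) ∧
  (∀ x ∈ closure Ω, u₀ x ≤ v x 0) ∧
  ∀ φ : Euc N × ℝ → ℝ, ContDiff ℝ 2 φ → ∀ x₀ : Euc N, ∀ t₀ : ℝ,
    (x₀, t₀) ∈ closure Ω ×ˢ Ioc 0 T →
    IsLocalMinOn (fun p : Euc N × ℝ => v p.1 p.2 - φ p) (closure Ω ×ˢ Ioc 0 T) (x₀, t₀) →
      (x₀ ∈ Ω → 0 ≤ parOp f lam m φ (v x₀ t₀) x₀ t₀) ∧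
      (x₀ ∈ frontier Ω →
        0 ≤ max (parOp f lam m φ (v x₀ t₀) x₀ t₀) (v x₀ t₀ - g x₀))

/-- A continuous viscosity solution, global in time, of `E(Ω,f,g,u₀,λ)`. -/
def IsGlobalParSol {N : ℕ} (Ω : Set (Euc N)) (f g u₀ : Euc N → ℝ) (lam m : ℝ)
    (u : Euc N → ℝ → ℝ) : Prop :=
  ContinuousOn (fun p : Euc N × ℝ => u p.1 p.2) (closure Ω ×ˢ Ici 0) ∧
  ∀ T > (0 : ℝ), IsParSub Ω f g u₀ lam m T u ∧ IsParSuper Ω f g u₀ lam m T u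

open scoped Classical in
/-- Redefinition of a parabolic subsolution on the lateral boundary by its
`limsup` from inside `Ω × (0,T]`. -/
noncomputable def uscExtPar {N : ℕ} (Ω : Set (Euc N)) (T : ℝ)
    (u : Euc N → ℝ → ℝ) : Euc N → ℝ → ℝ :=
  fun z t => if z ∈ Ω then u z t
    else limsup (fun p : Euc N × ℝ => u p.1 p.2) (𝓝[Ω ×ˢ Ioc 0 T] (z, t))

open scoped Classical in
/-- Redefinition of a stationary subsolution on the boundary by its `limsup`
from inside `Ω`. -/
noncomputable def uscExtStat {N : ℕ} (Ω : Set (Euc N))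
    (u : Euc N → ℝ) : Euc N → ℝ :=
  fun z => if z ∈ Ω then u z else limsup u (𝓝[Ω] z)

/-- Continuous viscosity solution of the state constraint problem
`−Δw + |Dw|^m + λ w = h` in `Ω`, `−Δw + |Dw|^m + λ w ≥ h` on `∂Ω`. -/
def IsSCSolution {N : ℕ} (Ω : Set (Euc N)) (h : Euc N → ℝ) (lam m : ℝ)
    (w : Euc N → ℝ) : Prop :=
  ContinuousOn w (closure Ω) ∧
  (∀ φ : Euc N → ℝ, ContDiff ℝ 2 φ → ∀ x₀ ∈ Ω, IsLocalMaxOn (w - φ) Ω x₀ →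
      statOp h lam m φ (w x₀) x₀ ≤ 0) ∧
  (∀ φ : Euc N → ℝ, ContDiff ℝ 2 φ → ∀ x₀ ∈ closure Ω,
      IsLocalMinOn (w - φ) (closure Ω) x₀ → 0 ≤ statOp h lam m φ (w x₀) x₀)

/-- Continuous viscosity subsolution of `−Δu + |Du|^m ≤ h` in `Ω`
(no boundary condition). -/
def IsIntSub {N : ℕ} (Ω : Set (Euc N)) (h : Euc N → ℝ) (m : ℝ)
    (u : Euc N → ℝ) : Prop :=
  ∀ φ : Euc N → ℝ, ContDiff ℝ 2 φ → ∀ x₀ ∈ Ω, IsLocalMaxOn (u - φ) Ω x₀ →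
    statOp h 0 m φ (u x₀) x₀ ≤ 0

/-- Hölder continuity with exponent `α` on a set. -/
def HolderOnCl {N : ℕ} (α : ℝ) (s : Set (Euc N)) (w : Euc N → ℝ) : Prop :=
  ∃ C > (0 : ℝ), ∀ x ∈ s, ∀ y ∈ s, |w x - w y| ≤ C * ‖x - y‖ ^ α

/-- Local Lipschitz continuity inside `Ω`. -/
def LocLipIn {N : ℕ} (Ω : Set (Euc N)) (w : Euc N → ℝ) : Prop :=
  ∀ x ∈ Ω, ∃ ε > (0 : ℝ), ∃ K : ℝ, 0 ≤ K ∧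
    ∀ y ∈ ball x ε ∩ Ω, ∀ z ∈ ball x ε ∩ Ω, |w y - w z| ≤ K * ‖y - z‖

/-- A piecewise `C¹` path parametrized on `[0,1]`. -/
def IsPWC1Path {N : ℕ} (γ : ℝ → Euc N) : Prop :=
  ContinuousOn γ (Icc 0 1) ∧
  ∃ n : ℕ, ∃ τ : Fin (n + 1) → ℝ, StrictMono τ ∧ τ 0 = 0 ∧ τ (Fin.last n) = 1 ∧
    ∀ i : Fin n, ContDiffOn ℝ 1 γ (Icc (τ i.castSucc) (τ i.succ))

/-- The length of a path on `[0,1]`. -/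
noncomputable def pathLen {N : ℕ} (γ : ℝ → Euc N) : ℝ :=
  ∫ t in (0 : ℝ)..1, ‖derivWithin γ (Icc (0 : ℝ) 1) t‖

/-- The geodesic-type distance inside `closure S` via piecewise `C¹` paths. -/
noncomputable def dTilde {N : ℕ} (S : Set (Euc N)) (x y : Euc N) : ℝ :=
  sInf {L : ℝ | ∃ γ : ℝ → Euc N, IsPWC1Path γ ∧ γ 0 = x ∧ γ 1 = y ∧
    MapsTo γ (Icc 0 1) (closure S) ∧ L = pathLen γ}

/-- The inner parallel set `Ω_δ = {x ∈ Ω : dist(x,∂Ω) > δ}`. -/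
def innerSet {N : ℕ} (Ω : Set (Euc N)) (δ : ℝ) : Set (Euc N) :=
  {x ∈ Ω | δ < infDist x (frontier Ω)}

end

/-! ### First and second order jets -/

/-- `φ` is `C²` at `x` with gradient `p` and Laplacian `L` there. -/
structure Jet {N : ℕ} (φ : Euc N → ℝ) (x p : Euc N) (L : ℝ) : Prop where
  contDiffAt : ContDiffAt ℝ 2 φ x
  grad : gradient φ x = p
  lap : lapl φ x = L

section Jets

variable {N : ℕ} {φ ψ : Euc N → ℝ} {x p q : Euc N} {L M : ℝ}

theorem lapl_eq_sum_fderiv (φ : Euc N → ℝ) (x : Euc N) :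
    lapl φ x = ∑ i : Fin N, fderiv ℝ (fderiv ℝ φ) x (EuclideanSpace.single i 1)
      (EuclideanSpace.single i 1) := by
  simp [lapl, iteratedFDeriv_two_apply]

theorem fderiv_apply_eq_inner_gradient (φ : Euc N → ℝ) (x e : Euc N) :
    fderiv ℝ φ x e = inner ℝ (gradient φ x) e := by
  simp [gradient]

theorem fderiv_single_eq_gradient (φ : Euc N → ℝ) (x : Euc N) (i : Fin N) :
    fderiv ℝ φ x (EuclideanSpace.single i 1) = gradient φ x i := by
  rw [fderiv_apply_eq_inner_gradient, EuclideanSpace.inner_single_right]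
  simp

theorem ContDiffAt.jet (h : ContDiffAt ℝ 2 φ x) : Jet φ x (gradient φ x) (lapl φ x) :=
  ⟨h, rfl, rfl⟩

theorem Jet.differentiableAt (h : Jet φ x p L) : DifferentiableAt ℝ φ x :=
  h.contDiffAt.differentiableAt (by norm_num)

theorem ContDiffAt.differentiableAt_fderiv_two (h : ContDiffAt ℝ 2 φ x) :
    DifferentiableAt ℝ (fderiv ℝ φ) x :=
  (h.fderiv_right (m := 1) (by norm_num)).differentiableAt (by norm_num)

theorem ContDiffAt.eventually_differentiableAt_two (h : ContDiffAt ℝ 2 φ x) :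
    ∀ᶠ y in 𝓝 x, DifferentiableAt ℝ φ y := by
  filter_upwards [h.eventually (by norm_num)] with y hy
  exact hy.differentiableAt (by norm_num)

theorem Jet.congr (h : Jet φ x p L) (he : ψ =ᶠ[𝓝 x] φ) : Jet ψ x p L := by
  refine ⟨h.contDiffAt.congr_of_eventuallyEq he, ?_, ?_⟩
  · rw [← h.grad]; simp [gradient, he.fderiv_eq]
  · rw [← h.lap, lapl_eq_sum_fderiv, lapl_eq_sum_fderiv, he.fderiv.fderiv_eq]

theorem Jet.of_hasFDerivAt {A : Euc N → Euc N →L[ℝ] ℝ} {B : Euc N →L[ℝ] Euc N →L[ℝ] ℝ}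
    (hc : ContDiffAt ℝ 2 φ x) (h1 : ∀ᶠ y in 𝓝 x, HasFDerivAt φ (A y) y) (h2 : HasFDerivAt A B x)
    (hp : ∀ e, A x e = inner ℝ p e)
    (hL : ∑ i : Fin N, B (EuclideanSpace.single i 1) (EuclideanSpace.single i 1) = L) :
    Jet φ x p L := by
  have hA : fderiv ℝ φ =ᶠ[𝓝 x] A := by
    filter_upwards [h1] with y hy using hy.fderiv
  refine ⟨hc, ?_, ?_⟩
  · refine ext_inner_right ℝ fun e => ?_
    rw [← fderiv_apply_eq_inner_gradient, hA.self_of_nhds, hp]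
  · rw [lapl_eq_sum_fderiv, hA.fderiv_eq, h2.fderiv, hL]

theorem Jet.add (h : Jet φ x p L) (k : Jet ψ x q M) :
    Jet (fun y => φ y + ψ y) x (p + q) (L + M) := by
  refine Jet.of_hasFDerivAt (h.contDiffAt.add k.contDiffAt)
    (A := fun y => fderiv ℝ φ y + fderiv ℝ ψ y)
    (B := fderiv ℝ (fderiv ℝ φ) x + fderiv ℝ (fderiv ℝ ψ) x) ?_ ?_ ?_ ?_
  · filter_upwards [h.contDiffAt.eventually_differentiableAt_two,
      k.contDiffAt.eventually_differentiableAt_two] with y h1 h2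
    exact h1.hasFDerivAt.add h2.hasFDerivAt
  · exact h.contDiffAt.differentiableAt_fderiv_two.hasFDerivAt.add
      k.contDiffAt.differentiableAt_fderiv_two.hasFDerivAt
  · intro e
    simp [fderiv_apply_eq_inner_gradient, h.grad, k.grad, inner_add_left]
  · rw [← h.lap, ← k.lap, lapl_eq_sum_fderiv, lapl_eq_sum_fderiv, ← Finset.sum_add_distrib]
    rfl

/-- The chain rule for the Laplacian. -/
theorem Jet.comp {θ θ' : ℝ → ℝ} {a b : ℝ} (h : Jet φ x p L) (hθ : ContDiffAt ℝ 2 θ (φ x))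
    (h1 : ∀ᶠ s in 𝓝 (φ x), HasDerivAt θ (θ' s) s) (ha : θ' (φ x) = a)
    (h2 : HasDerivAt θ' b (φ x)) :
    Jet (fun y => θ (φ y)) x (a • p) (a * L + b * ‖p‖ ^ 2) := by
  refine Jet.of_hasFDerivAt (hθ.comp x h.contDiffAt)
    (A := fun y => θ' (φ y) • fderiv ℝ φ y)
    (B := θ' (φ x) • fderiv ℝ (fderiv ℝ φ) x + (b • fderiv ℝ φ x).smulRight (fderiv ℝ φ x))
    ?_ ?_ ?_ ?_
  · filter_upwards [h.contDiffAt.eventually_differentiableAt_two,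
      h.contDiffAt.continuousAt.eventually h1] with y hy h1
    exact h1.comp_hasFDerivAt y hy.hasFDerivAt
  · exact (h2.comp_hasFDerivAt x h.differentiableAt.hasFDerivAt).smul
      h.contDiffAt.differentiableAt_fderiv_two.hasFDerivAt
  · intro e
    simp [fderiv_apply_eq_inner_gradient, h.grad, ha, inner_smul_left]
  · rw [← h.lap, lapl_eq_sum_fderiv, Finset.mul_sum, EuclideanSpace.norm_sq_eq, Finset.mul_sum,
      ← Finset.sum_add_distrib]
    refine Finset.sum_congr rfl fun i _ => ?_
    simp [fderiv_single_eq_gradient, h.grad, ha]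
    ring

theorem Jet.const (c : ℝ) (x : Euc N) : Jet (fun _ => c) x 0 0 :=
  Jet.of_hasFDerivAt contDiffAt_const (A := fun _ => 0) (B := 0)
    (Eventually.of_forall fun y => hasFDerivAt_const c y) (hasFDerivAt_const _ _) (by simp)
    (by simp)

theorem Jet.const_mul (c : ℝ) (h : Jet φ x p L) : Jet (fun y => c * φ y) x (c • p) (c * L) := by
  have := h.comp (θ := fun s => c * s) (θ' := fun _ => c) (a := c) (b := 0)
    (contDiffAt_const.mul contDiffAt_id)
    (Eventually.of_forall fun s => by simpa using (hasDerivAt_id s).const_mul c) rfl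
    (hasDerivAt_const _ _)
  simpa using this

theorem Jet.neg (h : Jet φ x p L) : Jet (fun y => -φ y) x (-p) (-L) := by
  simpa using h.const_mul (-1)

theorem Jet.sub (h : Jet φ x p L) (k : Jet ψ x q M) :
    Jet (fun y => φ y - ψ y) x (p - q) (L - M) := by
  simpa [sub_eq_add_neg] using h.add k.neg

theorem Jet.sum {ι : Type*} (s : Finset ι) {φ : ι → Euc N → ℝ} {p : ι → Euc N} {L : ι → ℝ}
    (h : ∀ i ∈ s, Jet (φ i) x (p i) (L i)) :
    Jet (fun y => ∑ i ∈ s, φ i y) x (∑ i ∈ s, p i) (∑ i ∈ s, L i) := by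
  classical
  induction s using Finset.induction_on with
  | empty => simpa using Jet.const 0 x
  | insert a s ha ih =>
    simp only [Finset.sum_insert ha]
    exact (h a (by simp)).add (ih fun i hi => h i (by simp [hi]))

theorem Jet.inner (ξ y x : Euc N) : Jet (fun z => inner ℝ ξ (z - y)) x ξ 0 := by
  refine Jet.of_hasFDerivAt (A := fun _ => innerSL ℝ ξ) (B := 0) ?_ ?_
    (hasFDerivAt_const _ _) (by simp)
    (by simp)
  · exact ((innerSL ℝ ξ).contDiff.comp (contDiff_id.sub contDiff_const)).contDiffAt
  · refine Eventually.of_forall fun z => ?_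
    exact (innerSL ℝ ξ).hasFDerivAt.comp z ((hasFDerivAt_id z).sub_const y)

theorem Jet.norm_sub_sq (y x : Euc N) :
    Jet (fun z => ‖z - y‖ ^ 2) x ((2 : ℝ) • (x - y)) (2 * N) := by
  refine Jet.of_hasFDerivAt (A := fun z => (2 : ℝ) • innerSL ℝ (z - y))
    (B := (2 : ℝ) • innerSL ℝ) ?_ ?_ ?_ ?_ ?_
  · exact ((contDiff_norm_sq ℝ).comp (contDiff_id.sub contDiff_const)).contDiffAt
  · refine Eventually.of_forall fun z => ?_
    have := (hasStrictFDerivAt_norm_sq (z - y)).hasFDerivAt.comp z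
      ((hasFDerivAt_id z).sub_const y)
    refine HasFDerivAt.congr_fderiv this ?_
    ext e
    simp [two_smul]
  · have := ((innerSL ℝ (E := Euc N)).hasFDerivAt.comp x
      ((hasFDerivAt_id x).sub_const y)).const_smul (2 : ℝ)
    exact this
  · intro e
    simp [inner_smul_left, inner_sub_left]
  · have h1 : ∀ i : Fin N, ((2 : ℝ) • innerSL ℝ (E := Euc N)) (EuclideanSpace.single i 1)
        (EuclideanSpace.single i 1) = 2 := by
      intro i
      change (2 : ℝ) * Inner.inner ℝ (EuclideanSpace.single i (1 : ℝ) : Euc N)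
        (EuclideanSpace.single i 1) = 2
      simp
    simp only [h1]
    simp [mul_comm]

theorem second_deriv_nonpos_of_isLocalMax {g : ℝ → ℝ} {a : ℝ} (h : IsLocalMax g a)
    (hc : ContinuousAt g a) : deriv (deriv g) a ≤ 0 := by
  by_contra! hpos
  have hmin := isLocalMin_of_deriv_deriv_pos hpos h.deriv_eq_zero hc
  have hconst : g =ᶠ[𝓝 a] fun _ => g a := by
    filter_upwards [h, hmin] with s h1 h2 using le_antisymm h1 h2
  have h0 : deriv (deriv g) a = 0 := by
    rw [hconst.deriv.deriv_eq]; simp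
  exact hpos.ne' h0

theorem ContDiffAt.deriv_deriv_line (h : ContDiffAt ℝ 2 φ x) (e : Euc N) :
    deriv (deriv fun s : ℝ => φ (x + s • e)) 0 = fderiv ℝ (fderiv ℝ φ) x e e := by
  have hl : ∀ s : ℝ, HasDerivAt (fun s : ℝ => x + s • e) e s := fun s => by
    simpa using ((hasDerivAt_id s).smul_const e).const_add x
  have ht : Tendsto (fun s : ℝ => x + s • e) (𝓝 0) (𝓝 x) := by
    have : Continuous fun s : ℝ => x + s • e := by fun_prop
    simpa using this.tendsto 0
  have h1 : (deriv fun s : ℝ => φ (x + s • e)) =ᶠ[𝓝 0] fun s => fderiv ℝ φ (x + s • e) e := by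
    filter_upwards [ht.eventually h.eventually_differentiableAt_two] with s hs
    exact (hs.hasFDerivAt.comp_hasDerivAt s (hl s)).deriv
  rw [h1.deriv_eq]
  have h2 : HasFDerivAt (fderiv ℝ φ) (fderiv ℝ (fderiv ℝ φ) x) (x + (0 : ℝ) • e) := by
    simpa using h.differentiableAt_fderiv_two.hasFDerivAt
  have h3 := (ContinuousLinearMap.apply ℝ ℝ e).hasFDerivAt.comp_hasDerivAt (0 : ℝ)
    (h2.comp_hasDerivAt (0 : ℝ) (hl 0))
  exact h3.deriv

/-- The first and second order conditions at an interior maximum. -/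
theorem Jet.eq_and_le_of_isLocalMax (h : Jet φ x p L) (k : Jet ψ x q M)
    (hmax : IsLocalMax (fun y => φ y - ψ y) x) : p = q ∧ L ≤ M := by
  have hd := h.sub k
  constructor
  · have h0 : gradient (fun y => φ y - ψ y) x = 0 := by
      simp [gradient, hmax.fderiv_eq_zero]
    rw [hd.grad] at h0
    exact sub_eq_zero.1 h0
  · have : lapl (fun y => φ y - ψ y) x ≤ 0 := by
      rw [lapl_eq_sum_fderiv]
      refine Finset.sum_nonpos fun i _ => ?_
      rw [← hd.contDiffAt.deriv_deriv_line]
      have hcont : Continuous fun s : ℝ => x + s • (EuclideanSpace.single i (1 : ℝ) : Euc N) := by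
        fun_prop
      have ht : Tendsto (fun s : ℝ => x + s • (EuclideanSpace.single i (1 : ℝ) : Euc N))
          (𝓝 0) (𝓝 x) := by simpa using hcont.tendsto 0
      refine second_deriv_nonpos_of_isLocalMax ?_ ?_
      · filter_upwards [ht.eventually hmax] with s hs
        simpa using hs
      · refine ContinuousAt.comp (f := fun s : ℝ => x + s • (EuclideanSpace.single i (1 : ℝ) : Euc N))
          (g := fun y => φ y - ψ y) ?_ hcont.continuousAt
        simpa using hd.contDiffAt.continuousAt
    rw [hd.lap] at this
    linarith

end Jets

/-- A function that is `C²` at a point agrees near it with a globally `C²` function. -/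
theorem ContDiffAt.exists_contDiff_eventuallyEq {E : Type*} [NormedAddCommGroup E]
    [NormedSpace ℝ E] [FiniteDimensional ℝ E] {ψ : E → ℝ} {x : E} (h : ContDiffAt ℝ 2 ψ x) :
    ∃ φ : E → ℝ, ContDiff ℝ 2 φ ∧ φ =ᶠ[𝓝 x] ψ := by
  obtain ⟨r, hr, hball⟩ := Metric.eventually_nhds_iff_ball.1 (h.eventually (by norm_num))
  let η : ContDiffBump x := ⟨r / 4, r / 2, by positivity, by linarith⟩
  refine ⟨fun y => η y * ψ y, ?_, ?_⟩
  · rw [contDiff_iff_contDiffAt]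
    intro y
    by_cases hy : y ∈ ball x r
    · exact η.contDiffAt.mul (hball y hy)
    · have hz : (fun y => η y * ψ y) =ᶠ[𝓝 y] fun _ => 0 := by
        have hy' : y ∈ (closedBall x (r / 2))ᶜ := by
          simp only [mem_ball, not_lt, mem_compl_iff, mem_closedBall, not_le] at hy ⊢
          linarith
        filter_upwards [isClosed_closedBall.isOpen_compl.mem_nhds hy'] with z hz
        have : η z = 0 := η.zero_of_le_dist (by
          simp only [mem_compl_iff, mem_closedBall, not_le] at hz; exact hz.le)
        simp [this]
      exact contDiffAt_const.congr_of_eventuallyEq hz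
  · filter_upwards [η.eventuallyEq_one] with y hy
    simp only [Pi.one_apply] at hy
    simp [hy]

theorem parOp_eq {N : ℕ} {f : Euc N → ℝ} {lam m r : ℝ} {φ : Euc N × ℝ → ℝ} {x p : Euc N}
    {t τ L : ℝ} (ht : HasDerivAt (fun s => φ (x, s)) τ t) (hx : Jet (fun y => φ (y, t)) x p L) :
    parOp f lam m φ r x t = τ - L + ‖p‖ ^ m + lam * r - f x := by
  rw [parOp, ht.deriv, hx.grad, hx.lap]

/-! ### Trigonometric sums and their heat flow -/

section Trig

open ProbabilityTheory

variable {N : ℕ} {ι : Type*}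

/-- A real trigonometric sum on `ℝ^N`. -/
noncomputable def trigSum (s : Finset ι) (a θ : ι → ℝ) (ξ : ι → Euc N) (x : Euc N) : ℝ :=
  ∑ i ∈ s, a i * Real.cos (inner ℝ (ξ i) x + θ i)

/-- The solution of `w_t - Δw + b·Dw = 0` starting at a trigonometric sum. -/
noncomputable def trigFlow (b : Euc N) (s : Finset ι) (a θ : ι → ℝ) (ξ : ι → Euc N)
    (q : Euc N × ℝ) : ℝ :=
  ∑ i ∈ s, a i * (Real.exp (-(‖ξ i‖ ^ 2) * q.2) *
    Real.cos (inner ℝ (ξ i) (q.1 - q.2 • b) + θ i))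

theorem trigFlow_zero (b : Euc N) (s : Finset ι) (a θ : ι → ℝ) (ξ : ι → Euc N) (x : Euc N) :
    trigFlow b s a θ ξ (x, 0) = trigSum s a θ ξ x := by
  simp [trigFlow, trigSum]

theorem contDiff_trigFlow (b : Euc N) (s : Finset ι) (a θ : ι → ℝ) (ξ : ι → Euc N) :
    ContDiff ℝ 2 (trigFlow b s a θ ξ) := by
  unfold trigFlow
  refine ContDiff.sum fun i _ => contDiff_const.mul (ContDiff.mul ?_ ?_)
  · exact (contDiff_const.mul contDiff_snd).exp
  · refine (ContDiff.add ?_ contDiff_const).cos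
    exact (innerSL ℝ (ξ i)).contDiff.comp
      (contDiff_fst.sub (contDiff_snd.smul contDiff_const))

/-- The flow of a trigonometric sum solves the drifted heat equation. -/
theorem exists_jet_trigFlow (b : Euc N) (s : Finset ι) (a θ : ι → ℝ) (ξ : ι → Euc N)
    (x : Euc N) (t : ℝ) : ∃ (τ L : ℝ) (p : Euc N),
      HasDerivAt (fun r => trigFlow b s a θ ξ (x, r)) τ t ∧
      Jet (fun y => trigFlow b s a θ ξ (y, t)) x p L ∧ τ - L + inner ℝ b p = 0 := by
  let E : ι → ℝ := fun i => Real.exp (-(‖ξ i‖ ^ 2) * t)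
  let A : ι → ℝ := fun i => inner ℝ (ξ i) (x - t • b) + θ i
  refine ⟨∑ i ∈ s, a i * (-(‖ξ i‖ ^ 2) * E i * Real.cos (A i) +
    E i * (Real.sin (A i) * inner ℝ (ξ i) b)),
    ∑ i ∈ s, a i * (E i * (-Real.cos (A i) * ‖ξ i‖ ^ 2)),
    ∑ i ∈ s, a i • (E i • (-Real.sin (A i)) • ξ i), ?_, ?_, ?_⟩
  · refine HasDerivAt.fun_sum fun i _ => HasDerivAt.const_mul _ ?_
    have h1 : HasDerivAt (fun r : ℝ => Real.exp (-(‖ξ i‖ ^ 2) * r)) (-(‖ξ i‖ ^ 2) * E i) t := by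
      have := ((hasDerivAt_id t).const_mul (-(‖ξ i‖ ^ 2))).exp
      simpa [E, mul_comm] using this
    have h2 : HasDerivAt (fun r : ℝ => inner ℝ (ξ i) (x - r • b) + θ i) (-inner ℝ (ξ i) b) t := by
      have h3 : HasDerivAt (fun r : ℝ => x - r • b) (-b) t := by
        simpa using ((hasDerivAt_id t).smul_const b).const_sub x
      have := ((innerSL ℝ (ξ i)).hasFDerivAt.comp_hasDerivAt t h3).add_const (θ i)
      simpa using this
    have := h1.mul h2.cos
    refine this.congr_deriv ?_
    simp only [A]; ring
  · refine Jet.sum s fun i _ => Jet.const_mul _ ?_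
    change Jet (fun y => E i * Real.cos (inner ℝ (ξ i) (y - t • b) + θ i)) _ _ _
    refine Jet.const_mul _ ?_
    have h1 := (Jet.inner (ξ i) (t • b) x).comp (θ := fun r => Real.cos (r + θ i))
      (θ' := fun r => -Real.sin (r + θ i)) (a := -Real.sin (A i)) (b := -Real.cos (A i))
      (by fun_prop)
      (Eventually.of_forall fun r => by
        simpa using ((hasDerivAt_id r).add_const (θ i)).cos) rfl
      (by simpa [A] using (((hasDerivAt_id _).add_const (θ i)).sin).fun_neg)
    simpa using h1
  · rw [inner_sum, ← Finset.sum_sub_distrib, ← Finset.sum_add_distrib]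
    refine Finset.sum_eq_zero fun i _ => ?_
    simp only [inner_smul_right, real_inner_comm b (ξ i)]
    ring

theorem integral_cos_stdGaussian (ξ : Euc N) (c : ℝ) :
    ∫ z, Real.cos (c + inner ℝ ξ z) ∂(stdGaussian (Euc N)) =
      Real.exp (-‖ξ‖ ^ 2 / 2) * Real.cos c := by
  have hintegral : Integrable (fun z : Euc N => Complex.exp ((inner ℝ z ξ : ℝ) * Complex.I))
      (stdGaussian (Euc N)) := by
    refine Integrable.of_bound (C := 1) (by fun_prop) (Eventually.of_forall fun z => ?_)
    rw [Complex.norm_exp_ofReal_mul_I]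
  have h := charFun_stdGaussian (E := Euc N) ξ
  rw [charFun_apply] at h
  have h1 : ∀ z : Euc N, Real.cos (c + inner ℝ ξ z) =
      RCLike.re (Complex.exp (c * Complex.I) * Complex.exp ((inner ℝ z ξ : ℝ) * Complex.I)) := by
    intro z
    rw [← Complex.exp_add, ← add_mul, ← Complex.ofReal_add, real_inner_comm]
    exact (Complex.exp_ofReal_mul_I_re _).symm
  simp_rw [h1]
  rw [integral_re (hintegral.const_mul _), integral_const_mul, h]
  have : Complex.exp (-(‖ξ‖ : ℂ) ^ 2 / 2) = ((Real.exp (-‖ξ‖ ^ 2 / 2) : ℝ) : ℂ) := by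
    push_cast; rfl
  rw [this, mul_comm]
  exact (Complex.re_ofReal_mul _ _).trans (by rw [Complex.exp_ofReal_mul_I_re])

/-- The flow of a trigonometric sum is a Gaussian average. -/
theorem trigFlow_eq_integral (b : Euc N) (s : Finset ι) (a θ : ι → ℝ) (ξ : ι → Euc N)
    (x : Euc N) {t : ℝ} (ht : 0 ≤ t) :
    trigFlow b s a θ ξ (x, t) =
      ∫ z, trigSum s a θ ξ (x + (Real.sqrt (2 * t) • z - t • b)) ∂(stdGaussian (Euc N)) := by
  unfold trigFlow trigSum
  rw [integral_finsetSum]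
  · refine Finset.sum_congr rfl fun i _ => ?_
    rw [integral_const_mul]
    congr 1
    have := integral_cos_stdGaussian (Real.sqrt (2 * t) • ξ i)
      (inner ℝ (ξ i) (x - t • b) + θ i)
    have h2 : -‖Real.sqrt (2 * t) • ξ i‖ ^ 2 / 2 = -(‖ξ i‖ ^ 2) * t := by
      rw [norm_smul, mul_pow, Real.norm_eq_abs, sq_abs, Real.sq_sqrt (by positivity)]
      ring
    rw [h2] at this
    rw [← this]
    refine integral_congr_ae (Eventually.of_forall fun z => ?_)
    simp only [inner_smul_left, inner_add_right, inner_sub_right, inner_smul_right]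
    congr 1
    simp
    ring
  · intro i _
    refine Integrable.of_bound (C := |a i|) ?_ (Eventually.of_forall fun z => ?_)
    · have : Continuous fun z : Euc N =>
        a i * Real.cos (inner ℝ (ξ i) (x + (Real.sqrt (2 * t) • z - t • b)) + θ i) := by fun_prop
      exact this.aestronglyMeasurable
    · rw [norm_mul, Real.norm_eq_abs, Real.norm_eq_abs]
      exact mul_le_of_le_one_right (abs_nonneg _) (Real.abs_cos_le_one _)

theorem continuous_trigSum (s : Finset ι) (a θ : ι → ℝ) (ξ : ι → Euc N) :
    Continuous (trigSum s a θ ξ) := by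
  unfold trigSum; fun_prop

/-- Uniform approximation on a ball by globally bounded trigonometric sums. -/
theorem exists_trigSum_approx {y : Euc N} {R M ε : ℝ} (hR : 0 < R) (hM : 0 ≤ M) (hε : 0 < ε)
    {φ : Euc N → ℝ} (hφ : ContinuousOn φ (closedBall y R))
    (hb : ∀ x ∈ closedBall y R, |φ x| ≤ M) :
    ∃ (s : Finset (Fin N → ℤ)) (a θ : (Fin N → ℤ) → ℝ) (ξ : (Fin N → ℤ) → Euc N),
      (∀ x ∈ closedBall y R, |trigSum s a θ ξ x - φ x| ≤ ε) ∧
      ∀ x, |trigSum s a θ ξ x| ≤ M + ε := by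
  classical
  let e : Euc N → UnitAddTorus (Fin N) := fun x i => (((x i - y i) / (4 * R) : ℝ) : UnitAddCircle)
  have he : Continuous e := by
    refine continuous_pi fun i => (AddCircle.continuous_mk' (1 : ℝ)).comp ?_
    fun_prop
  have hemb : IsClosedEmbedding fun x : closedBall y R => e x := by
    have : CompactSpace (closedBall y R) := isCompact_iff_compactSpace.1 (isCompact_closedBall y R)
    refine (he.comp continuous_subtype_val).isClosedEmbedding ?_
    rintro ⟨x, hx⟩ ⟨x', hx'⟩ hxx
    have key : ∀ z ∈ closedBall y R, ∀ i, (z i - y i) / (4 * R) ∈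
        Ico (-(1 / 2) : ℝ) (-(1 / 2) + 1) := by
      intro z hz i
      have h1 : |z i - y i| ≤ R := by
        have := (EuclideanSpace.norm_eq (z - y)) ▸ (mem_closedBall_iff_norm.1 hz)
        have h2 := PiLp.norm_apply_le (z - y) i
        rw [mem_closedBall_iff_norm] at hz
        simpa using h2.trans hz
      obtain ⟨h2, h3⟩ := abs_le.1 h1
      constructor
      · rw [le_div_iff₀ (by positivity)]; linarith
      · rw [div_lt_iff₀ (by positivity)]; linarith
    have : x = x' := by
      ext i
      have h0 : (((x i - y i) / (4 * R) : ℝ) : UnitAddCircle) =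
        (((x' i - y i) / (4 * R) : ℝ) : UnitAddCircle) := congrFun hxx i
      have := (AddCircle.coe_eq_coe_iff_of_mem_Ico (key x hx i) (key x' hx' i)).1 h0
      rw [div_left_inj' (by positivity)] at this
      linarith
    exact Subtype.ext this
  let φ' : BoundedContinuousFunction (closedBall y R) ℝ :=
    BoundedContinuousFunction.ofNormedAddCommGroup (fun x => φ x)
      (continuousOn_iff_continuous_domRestrict.1 hφ) M fun x => hb x x.2
  obtain ⟨G, hG, hGe⟩ := BoundedContinuousFunction.exists_extension_forall_mem_Icc_of_isClosedEmbedding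
    φ' (a := -M) (b := M) (fun x => abs_le.1 (hb x x.2)) (by linarith) hemb
  let Gc : C(UnitAddTorus (Fin N), ℂ) := ⟨fun z => (G z : ℂ), by fun_prop⟩
  have hGc : Gc ∈ (Submodule.span ℂ (range
      (UnitAddTorus.mFourier (d := Fin N)))).topologicalClosure := by
    rw [UnitAddTorus.span_mFourier_closure_eq_top]; trivial
  obtain ⟨P, hP, hdist⟩ := Metric.mem_closure_iff.1 hGc ε hε
  obtain ⟨c, rfl⟩ := (Finsupp.mem_span_range_iff_exists_finsupp).1 hP
  let ξ : (Fin N → ℤ) → Euc N := fun n => WithLp.toLp 2 fun i => 2 * Real.pi / (4 * R) * n i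
  have hval : ∀ x : Euc N, trigSum c.support (fun n => ‖c n‖)
      (fun n => (c n).arg - inner ℝ (ξ n) y) ξ x =
      (c.sum (fun n w => w • UnitAddTorus.mFourier n) (e x)).re := by
    intro x
    have h1 : c.sum (fun n w => w • UnitAddTorus.mFourier n) (e x) =
        ∑ n ∈ c.support, c n * UnitAddTorus.mFourier n (e x) := by
      simp [Finsupp.sum]
    rw [h1, Complex.re_sum]
    refine Finset.sum_congr rfl fun n _ => ?_
    have h2 : UnitAddTorus.mFourier n (e x) =
        Complex.exp (((inner ℝ (ξ n) (x - y) : ℝ) : ℂ) * Complex.I) := by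
      simp only [UnitAddTorus.mFourier, ContinuousMap.coe_mk, e, fourier_coe_apply]
      rw [← Complex.exp_sum]
      congr 1
      simp only [ξ, PiLp.inner_apply, Complex.ofReal_sum, Finset.sum_mul]
      refine Finset.sum_congr rfl fun i _ => ?_
      simp
      field_simp
    rw [h2]
    conv_rhs => rw [← Complex.norm_mul_exp_arg_mul_I (c n), mul_assoc, ← Complex.exp_add,
      ← add_mul, ← Complex.ofReal_add, Complex.re_ofReal_mul, Complex.exp_ofReal_mul_I_re]
    congr 2
    rw [inner_sub_right]; ring
  have hclose : ∀ x : Euc N, |trigSum c.support (fun n => ‖c n‖)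
      (fun n => (c n).arg - inner ℝ (ξ n) y) ξ x - G (e x)| ≤ ε := by
    intro x
    rw [hval]
    have h1 := (ContinuousMap.dist_apply_le_dist (f := Gc)
      (g := c.sum (fun n w => w • UnitAddTorus.mFourier n)) (e x)).trans hdist.le
    rw [dist_comm, dist_eq_norm] at h1
    have h2 := (Complex.abs_re_le_norm _).trans h1
    simpa [Gc] using h2
  refine ⟨c.support, fun n => ‖c n‖, fun n => (c n).arg - inner ℝ (ξ n) y, ξ, ?_, ?_⟩
  · intro x hx
    have h1 : G (e x) = φ x := congrFun hGe ⟨x, hx⟩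
    rw [← h1]
    exact hclose x
  · intro x
    have h1 := hclose x
    have h2 : |G (e x)| ≤ M := abs_le.2 (hG (e x))
    have h3 := abs_sub_abs_le_abs_sub (trigSum c.support (fun n => ‖c n‖)
      (fun n => (c n).arg - inner ℝ (ξ n) y) ξ x) (G (e x))
    linarith

end Trig

/-! ### One step of the linearized flow -/

section Step

open ProbabilityTheory

variable {N : ℕ}

/-- The interior part of the notion of viscosity subsolution, tested at the final time only. -/
def IsBackSub (Ω : Set (Euc N)) (f : Euc N → ℝ) (lam m : ℝ) (u : Euc N → ℝ → ℝ) : Prop :=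
  ∀ φ : Euc N × ℝ → ℝ, ContDiff ℝ 2 φ → ∀ x₀ ∈ Ω, ∀ t₀ : ℝ, 0 < t₀ →
    IsLocalMaxOn (fun p : Euc N × ℝ => u p.1 p.2 - φ p) (closure Ω ×ˢ Ioc 0 t₀) (x₀, t₀) →
      parOp f lam m φ (u x₀ t₀) x₀ t₀ ≤ 0

variable {Ω : Set (Euc N)} {f : Euc N → ℝ} {lam m : ℝ} {u : Euc N → ℝ → ℝ}

/-- Comparison with a strict smooth supersolution in a cylinder. -/
theorem IsBackSub.le_of_parOp_pos (hu : IsBackSub Ω f lam m u)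
    (hc : ContinuousOn (fun p : Euc N × ℝ => u p.1 p.2) (closure Ω ×ˢ Ici 0))
    {y : Euc N} {R t h : ℝ} (hR : 0 ≤ R) (hball : closedBall y R ⊆ Ω) (ht : 0 < t) (hh : 0 ≤ h)
    {w : Euc N × ℝ → ℝ} (hw : ContDiff ℝ 2 w)
    (hop : ∀ x ∈ closedBall y R, ∀ s ∈ Ioc t (t + h), 0 < parOp f lam m w (u x s) x s)
    (hini : ∀ x ∈ closedBall y R, u x t ≤ w (x, t))
    (hlat : ∀ x ∈ sphere y R, ∀ s ∈ Icc t (t + h), u x s ≤ w (x, s)) :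
    u y (t + h) ≤ w (y, t + h) := by
  have hQ : IsCompact (closedBall y R ×ˢ Icc t (t + h)) :=
    (isCompact_closedBall y R).prod isCompact_Icc
  have hsub : closedBall y R ×ˢ Icc t (t + h) ⊆ closure Ω ×ˢ Ici 0 :=
    prod_mono (hball.trans subset_closure) fun s hs => ht.le.trans hs.1
  have hmem : (y, t + h) ∈ closedBall y R ×ˢ Icc t (t + h) :=
    ⟨mem_closedBall_self hR, by linarith, le_rfl⟩
  obtain ⟨⟨x₁, t₁⟩, ⟨hx₁, ht₁⟩, hmax⟩ := hQ.exists_isMaxOn ⟨_, hmem⟩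
    ((hc.mono hsub).sub hw.continuous.continuousOn)
  by_contra! hlt
  have hpos : 0 < u x₁ t₁ - w (x₁, t₁) := lt_of_lt_of_le (by simpa using hlt) (hmax hmem)
  dsimp only at hx₁ ht₁
  have ht₁' : t < t₁ := by
    refine lt_of_le_of_ne ht₁.1 fun he => ?_
    subst he
    linarith [hini x₁ hx₁]
  have hx₁' : x₁ ∈ ball y R := by
    refine lt_of_le_of_ne (mem_closedBall.1 hx₁) fun he => ?_
    linarith [hlat x₁ he t₁ ht₁]
  refine absurd (hu w hw x₁ (hball hx₁) t₁ (ht.trans ht₁') ?_)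
    (not_le.2 (hop x₁ hx₁ t₁ ⟨ht₁', ht₁.2⟩))
  have hn : ball y R ×ˢ Ioi t ∈ 𝓝 (x₁, t₁) :=
    prod_mem_nhds (isOpen_ball.mem_nhds hx₁') (Ioi_mem_nhds ht₁')
  filter_upwards [mem_nhdsWithin_of_mem_nhds hn, self_mem_nhdsWithin] with q hq hq'
  exact hmax ⟨ball_subset_closedBall hq.1, hq.2.le, hq'.2.2.trans ht₁.2⟩

/-- The barrier `(|x - y|² + k s)²` used to localize the heat flow. -/
theorem exists_jet_barrier (y b x : Euc N) {R s k : ℝ} (hx : ‖x - y‖ ≤ R) (hs : 0 ≤ s)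
    (hk : k = 2 * N + 4 + 2 * ‖b‖ * R) :
    ∃ (τ L : ℝ) (p : Euc N),
      HasDerivAt (fun r => (‖x - y‖ ^ 2 + k * r) ^ 2) τ s ∧
      Jet (fun z => (‖z - y‖ ^ 2 + k * s) ^ 2) x p L ∧ 0 ≤ τ - L + inner ℝ b p := by
  have hR : 0 ≤ R := (norm_nonneg _).trans hx
  have hk0 : 0 ≤ k := by rw [hk]; positivity
  set P := ‖x - y‖ ^ 2 + k * s with hP
  have hP0 : 0 ≤ P := by positivity
  refine ⟨2 * P * k, _, _, ?_, (Jet.norm_sub_sq y x).comp (θ := fun r => (r + k * s) ^ 2)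
    (θ' := fun r => 2 * (r + k * s)) (a := 2 * P) (b := 2) (by fun_prop)
    (Eventually.of_forall fun r => ?_) rfl ?_, ?_⟩
  · have := (((hasDerivAt_id s).const_mul k).const_add (‖x - y‖ ^ 2)).fun_pow 2
    simpa [hP] using this
  · simpa using ((hasDerivAt_id r).add_const (k * s)).fun_pow 2
  · simpa using ((hasDerivAt_id (‖x - y‖ ^ 2)).add_const (k * s)).const_mul 2
  · have h1 : -(‖b‖ * R) ≤ inner ℝ b (x - y) :=
      (neg_le_neg (mul_le_mul_of_nonneg_left hx (norm_nonneg b))).trans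
        (neg_le_of_abs_le (abs_real_inner_le_norm b (x - y)))
    have h2 : ‖x - y‖ ^ 2 ≤ P := by rw [hP]; nlinarith [mul_nonneg hk0 hs]
    rw [norm_smul, inner_smul_right, inner_smul_right]
    have h3 := mul_le_mul_of_nonneg_left h1 hP0
    simp only [Real.norm_eq_abs]
    rw [abs_of_pos two_pos]
    subst hk
    nlinarith

theorem abs_trigFlow_le {ι : Type*} (b : Euc N) (s : Finset ι) (a θ : ι → ℝ) (ξ : ι → Euc N)
    {M : ℝ} (hM : ∀ x, |trigSum s a θ ξ x| ≤ M) (x : Euc N) {t : ℝ} (ht : 0 ≤ t) :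
    |trigFlow b s a θ ξ (x, t)| ≤ M := by
  rw [trigFlow_eq_integral b s a θ ξ x ht]
  simpa using norm_integral_le_of_norm_le_const (μ := stdGaussian (Euc N)) (C := M)
    (f := fun z => trigSum s a θ ξ (x + (Real.sqrt (2 * t) • z - t • b)))
    (Eventually.of_forall fun z => hM (x + (Real.sqrt (2 * t) • z - t • b)))

theorem integrable_norm_pow_stdGaussian (n : ℕ) :
    Integrable (fun z : Euc N => ‖z‖ ^ n) (stdGaussian (Euc N)) := by
  rcases Nat.eq_zero_or_pos n with rfl | hn
  · simp
  · exact (IsGaussian.memLp_id (stdGaussian (Euc N)) n (by simp)).integrable_norm_pow hn.ne'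

theorem norm_step_pow_four_le (b z : Euc N) {h : ℝ} (h0 : 0 ≤ h) (h1 : h ≤ 1) :
    ‖Real.sqrt (2 * h) • z - h • b‖ ^ 4 ≤ h ^ 2 * (32 * ‖z‖ ^ 4 + 8 * ‖b‖ ^ 4) := by
  have e1 : ‖Real.sqrt (2 * h) • z‖ ^ 2 = 2 * h * ‖z‖ ^ 2 := by
    rw [norm_smul, mul_pow, Real.norm_eq_abs, sq_abs, Real.sq_sqrt (by positivity)]
  have e2 : ‖h • b‖ ^ 2 = h ^ 2 * ‖b‖ ^ 2 := by
    rw [norm_smul, mul_pow, Real.norm_eq_abs, sq_abs]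
  have h3 := norm_sub_le (Real.sqrt (2 * h) • z) (h • b)
  set A := ‖Real.sqrt (2 * h) • z‖
  set B := ‖h • b‖
  have hA : 0 ≤ A := norm_nonneg _
  have hB : 0 ≤ B := norm_nonneg _
  calc ‖Real.sqrt (2 * h) • z - h • b‖ ^ 4 ≤ (A + B) ^ 4 := by gcongr
    _ ≤ 8 * ((A ^ 2) ^ 2 + (B ^ 2) ^ 2) := by
        nlinarith [sq_nonneg (A - B), sq_nonneg (A ^ 2 - B ^ 2), mul_nonneg hA hB,
          sq_nonneg (A + B), mul_nonneg (sq_nonneg (A - B)) (sq_nonneg (A + B)),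
          sq_nonneg ((A - B) ^ 2)]
    _ = h ^ 2 * (32 * ‖z‖ ^ 4 + h ^ 2 * (8 * ‖b‖ ^ 4)) := by rw [e1, e2]; ring
    _ ≤ h ^ 2 * (32 * ‖z‖ ^ 4 + 1 * (8 * ‖b‖ ^ 4)) := by
        gcongr; exact pow_le_one₀ h0 h1
    _ = _ := by ring

/-- A viscosity subsolution is, up to an error of order `h²`, below one step of the flow of the
linearized equation. -/
theorem IsBackSub.exists_step (hu : IsBackSub Ω f lam m u)
    (hc : ContinuousOn (fun p : Euc N × ℝ => u p.1 p.2) (closure Ω ×ˢ Ici 0))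
    {M R Λ : ℝ} (hM : 0 ≤ M) (hR : 0 < R) {b : Euc N} {c : ℝ}
    (hb : ∀ q : Euc N, inner ℝ b q - c ≤ ‖q‖ ^ m) :
    ∃ C, ∀ (y : Euc N) (t h F : ℝ) (U : Euc N → ℝ), closedBall y R ⊆ Ω → 0 < t → 0 ≤ h → h ≤ 1 →
      |F| ≤ Λ → (∀ x ∈ closedBall y R, ∀ s ∈ Icc t (t + h), |u x s| ≤ M) →
      (∀ x ∈ closedBall y R, ∀ s ∈ Icc t (t + h), f x - lam * u x s + c ≤ F) →
      Measurable U → (∀ x, |U x| ≤ M) → (∀ x ∈ closedBall y R, U x = u x t) →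
      u y (t + h) ≤ ∫ z, U (y + (Real.sqrt (2 * h) • z - h • b)) ∂(stdGaussian (Euc N))
        + h * F + C * h ^ 2 := by
  set k : ℝ := 2 * N + 4 + 2 * ‖b‖ * R with hk
  have hk0 : 0 ≤ k := by rw [hk]; positivity
  set B : ℝ := (2 * M + Λ + 1) / R ^ 4 with hB
  set G : ℝ := ∫ z, (32 * ‖z‖ ^ 4 + 8 * ‖b‖ ^ 4) ∂(stdGaussian (Euc N)) with hG
  refine ⟨B * k ^ 2 + 2 * M / R ^ 4 * G, ?_⟩
  intro y t h F U hball ht h0 h1 hF huM hFf hUm hUM hU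
  have hΛ : 0 ≤ Λ := (abs_nonneg F).trans hF
  have hB0 : 0 ≤ B := by positivity
  refine le_of_forall_pos_le_add fun δ hδ => ?_
  obtain ⟨ε, hε, hε1, hεδ⟩ : ∃ ε : ℝ, 0 < ε ∧ ε ≤ 1 ∧ 3 * ε ≤ δ :=
    ⟨min 1 (δ / 3), by positivity, min_le_left _ _, by linarith [min_le_right 1 (δ / 3)]⟩
  have hyR : y ∈ closedBall y R := mem_closedBall_self hR.le
  have hcy : ContinuousOn (fun x => u x t) (closedBall y R) :=
    hc.comp (f := fun x => (x, t)) (by fun_prop)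
      fun x hx => ⟨subset_closure (hball hx), ht.le⟩
  obtain ⟨S, a, θ, ξ, happ, hbd⟩ := exists_trigSum_approx hR hM hε hcy
    fun x hx => huM x hx t ⟨le_rfl, by linarith⟩
  set w : Euc N × ℝ → ℝ := fun q => trigFlow b S a θ ξ (q.1, q.2 - t) + (ε + (F + ε) * (q.2 - t))
    + B * (‖q.1 - y‖ ^ 2 + k * (q.2 - t)) ^ 2 with hw
  have hwc : ContDiff ℝ 2 w := by
    refine ((ContDiff.comp (contDiff_trigFlow b S a θ ξ) ?_).add ?_).add
      (contDiff_const.mul (ContDiff.pow (ContDiff.add ?_ ?_) 2))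
    · fun_prop
    · fun_prop
    · exact (contDiff_norm_sq ℝ).comp (contDiff_fst.sub contDiff_const)
    · fun_prop
  have hcmp : u y (t + h) ≤ w (y, t + h) := by
    refine hu.le_of_parOp_pos hc hR.le hball ht h0 hwc ?_ ?_ ?_
    · intro x hx s hs
      have hs0 : 0 ≤ s - t := by linarith [hs.1]
      obtain ⟨τ, L, p, hτ, hJ, he⟩ := exists_jet_trigFlow b S a θ ξ x (s - t)
      obtain ⟨τ', L', p', hτ', hJ', he'⟩ := exists_jet_barrier y b x
        (mem_closedBall_iff_norm.1 hx) hs0 hk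
      have hd : HasDerivAt (fun r => w (x, r)) (τ + (F + ε) + B * τ') s := by
        have hid : HasDerivAt (fun r : ℝ => r - t) 1 s := by
          simpa using (hasDerivAt_id s).sub_const t
        have e1 := hτ.comp s hid
        have e2 := hτ'.comp s hid
        have e3 := (hid.const_mul (F + ε)).const_add ε
        simpa [hw, Function.comp_def] using (e1.fun_add e3).fun_add (e2.const_mul B)
      have hj := (hJ.add (Jet.const (ε + (F + ε) * (s - t)) x)).add (hJ'.const_mul B)
      rw [parOp_eq hd hj]
      have hq := hb (p + 0 + B • p')
      rw [inner_add_right, inner_add_right, inner_zero_right, inner_smul_right] at hq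
      have := hFf x hx s ⟨hs.1.le, hs.2⟩
      have hBe := mul_nonneg hB0 he'
      linarith
    · intro x hx
      have e1 := abs_le.1 (happ x hx)
      have e2 : 0 ≤ B * (‖x - y‖ ^ 2 + k * 0) ^ 2 := by positivity
      simp only [hw, sub_self, trigFlow_zero]
      linarith [e1.1]
    · intro x hx s hs
      have hs0 : 0 ≤ s - t := by linarith [hs.1]
      have hs1 : s - t ≤ 1 := by linarith [hs.2]
      have e1 := (abs_le.1 (abs_trigFlow_le b S a θ ξ hbd x hs0)).1
      have e2 := (abs_le.1 (huM x (sphere_subset_closedBall hx) s hs)).2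
      have e3 : 2 * M + Λ + 1 ≤ B * (‖x - y‖ ^ 2 + k * (s - t)) ^ 2 := by
        have : 2 * M + Λ + 1 = B * (R ^ 2) ^ 2 := by rw [hB]; field_simp
        rw [this, mem_sphere_iff_norm.1 hx]
        gcongr
        nlinarith [mul_nonneg hk0 hs0]
      have e4 : -Λ ≤ F * (s - t) := by
        nlinarith [(abs_le.1 hF).1, (abs_le.1 hF).2]
      have e5 : 0 ≤ ε * (s - t) := by positivity
      simp only [hw]
      linarith
  have hstep : ∀ z : Euc N, trigSum S a θ ξ (y + (Real.sqrt (2 * h) • z - h • b)) ≤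
      U (y + (Real.sqrt (2 * h) • z - h • b)) + ε +
        2 * M / R ^ 4 * (h ^ 2 * (32 * ‖z‖ ^ 4 + 8 * ‖b‖ ^ 4)) := by
    intro z
    have e1 := norm_step_pow_four_le b z h0 h1
    set d := Real.sqrt (2 * h) • z - h • b
    have e2 : 2 * M / R ^ 4 * ‖d‖ ^ 4 ≤
        2 * M / R ^ 4 * (h ^ 2 * (32 * ‖z‖ ^ 4 + 8 * ‖b‖ ^ 4)) := by gcongr
    rcases le_or_gt ‖d‖ R with hd | hd
    · have hm : y + d ∈ closedBall y R := by simpa [mem_closedBall_iff_norm] using hd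
      have e3 := (abs_le.1 (happ _ hm)).2
      rw [hU _ hm]
      have : 0 ≤ 2 * M / R ^ 4 * ‖d‖ ^ 4 := by positivity
      linarith
    · have e3 := (abs_le.1 (hbd (y + d))).2
      have e4 := (abs_le.1 (hUM (y + d))).1
      have : 2 * M ≤ 2 * M / R ^ 4 * ‖d‖ ^ 4 := by
        rw [div_mul_eq_mul_div, le_div_iff₀ (by positivity)]
        gcongr
      linarith
  have hmeas : Measurable fun z : Euc N => y + (Real.sqrt (2 * h) • z - h • b) := by
    have : Continuous fun z : Euc N => y + (Real.sqrt (2 * h) • z - h • b) := by fun_prop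
    exact this.measurable
  have hUi : Integrable (fun z => U (y + (Real.sqrt (2 * h) • z - h • b)))
      (stdGaussian (Euc N)) :=
    Integrable.of_bound (hUm.comp hmeas).aestronglyMeasurable M
      (Eventually.of_forall fun z => hUM _)
  have hTi : Integrable (fun z => trigSum S a θ ξ (y + (Real.sqrt (2 * h) • z - h • b)))
      (stdGaussian (Euc N)) :=
    Integrable.of_bound (((continuous_trigSum S a θ ξ).measurable.comp hmeas).aestronglyMeasurable)
      (M + ε) (Eventually.of_forall fun z => hbd _)
  have hGi : Integrable (fun z : Euc N => 32 * ‖z‖ ^ 4 + 8 * ‖b‖ ^ 4) (stdGaussian (Euc N)) :=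
    ((integrable_norm_pow_stdGaussian 4).const_mul 32).add (integrable_const _)
  have hUε : Integrable (fun z => U (y + (Real.sqrt (2 * h) • z - h • b)) + ε)
      (stdGaussian (Euc N)) := hUi.add (integrable_const ε)
  have hintegral := integral_mono hTi (hUε.add
    ((hGi.const_mul (h ^ 2)).const_mul (2 * M / R ^ 4))) hstep
  rw [← trigFlow_eq_integral b S a θ ξ y h0] at hintegral
  simp only [Pi.add_apply] at hintegral
  rw [integral_add hUε ((hGi.const_mul _).const_mul _),
    integral_add hUi (integrable_const ε), integral_const_mul, integral_const_mul, ← hG] at hintegral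
  simp only [integral_const, probReal_univ, smul_eq_mul, one_mul] at hintegral
  have hwy : w (y, t + h) = trigFlow b S a θ ξ (y, h) + (ε + (F + ε) * h) + B * (k * h) ^ 2 := by
    simp [hw]
  rw [hwy] at hcmp
  have : ε * h ≤ ε := by nlinarith
  nlinarith

end Step

/-! ### Short-time expansion of the Gaussian average -/

section Gauss

open ProbabilityTheory

variable {N : ℕ}

theorem integral_inner_mul_inner_stdGaussian (x y : Euc N) :
    ∫ z, inner ℝ x z * inner ℝ y z ∂(stdGaussian (Euc N)) = inner ℝ x y := by
  have h := covarianceBilin_apply (IsGaussian.memLp_two_id (μ := stdGaussian (Euc N))) x y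
  rw [covarianceBilin_stdGaussian] at h
  simp only [id_eq, integral_id_stdGaussian, sub_zero] at h
  rw [← h]; rfl

theorem integrable_apply_apply_stdGaussian (B : Euc N →L[ℝ] Euc N →L[ℝ] ℝ) :
    Integrable (fun z => B z z) (stdGaussian (Euc N)) := by
  refine ((integrable_norm_pow_stdGaussian (N := N) 2).const_mul ‖B‖).mono' ?_
    (Eventually.of_forall fun z => ?_)
  · have : Continuous fun z => B z z := by fun_prop
    exact this.aestronglyMeasurable
  · exact (B.le_opNorm₂ z z).trans (by rw [mul_assoc, sq])

theorem integral_apply_apply_stdGaussian (B : Euc N →L[ℝ] Euc N →L[ℝ] ℝ) :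
    ∫ z, B z z ∂(stdGaussian (Euc N)) =
      ∑ i : Fin N, B (EuclideanSpace.single i 1) (EuclideanSpace.single i 1) := by
  let e := EuclideanSpace.basisFun (Fin N) ℝ
  have h1 : ∀ z, B z z = ∑ i, ∑ j, B (e i) (e j) * (inner ℝ (e i) z * inner ℝ (e j) z) := by
    intro z
    conv_lhs => rw [← e.sum_repr' z]
    simp only [map_sum, map_smul, sum_apply, smul_apply,
      smul_eq_mul, Finset.mul_sum]
    rw [Finset.sum_comm]
    refine Finset.sum_congr rfl fun i _ => Finset.sum_congr rfl fun j _ => ?_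
    ring
  have hintegral : ∀ i j, Integrable (fun z => B (e i) (e j) * (inner ℝ (e i) z * inner ℝ (e j) z))
      (stdGaussian (Euc N)) := by
    intro i j
    refine Integrable.const_mul ?_ _
    exact integrable_apply_apply_stdGaussian ((innerSL ℝ (e i)).smulRight (innerSL ℝ (e j)))
  rw [integral_congr_ae (Eventually.of_forall h1)]
  rw [integral_finsetSum _ fun i _ => integrable_finsetSum _ fun j _ => hintegral i j]
  refine Finset.sum_congr rfl fun i _ => ?_
  rw [integral_finsetSum _ fun j _ => hintegral i j]
  simp_rw [integral_const_mul, integral_inner_mul_inner_stdGaussian]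
  simp only [e.inner_eq_ite, mul_ite, mul_one, mul_zero, Finset.sum_ite_eq, Finset.mem_univ,
    if_true]
  simp [e]

theorem norm_fderiv_sub_sub_le {w : Euc N → ℝ} (hw : ContDiff ℝ 3 w) {C : NNReal}
    (hC : LipschitzWith C (fderiv ℝ (fderiv ℝ w))) (x z : Euc N) {r : ℝ} (hr : 0 ≤ r)
    (hz : z ∈ closedBall x r) :
    ‖fderiv ℝ w z - fderiv ℝ w x - fderiv ℝ (fderiv ℝ w) x (z - x)‖ ≤ C * r ^ 2 := by
  have hD : Differentiable ℝ (fderiv ℝ w) :=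
    (hw.fderiv_right (m := 2) (by norm_num)).differentiable (by norm_num)
  have hseg : ∀ z ∈ closedBall x r, ‖z - x‖ ≤ r := fun z hz => mem_closedBall_iff_norm.1 hz
  have hx : x ∈ closedBall x r := mem_closedBall_self hr
  have hd : ∀ y ∈ closedBall x r, HasFDerivWithinAt
      (fun y => fderiv ℝ w y - fderiv ℝ (fderiv ℝ w) x y)
      (fderiv ℝ (fderiv ℝ w) y - fderiv ℝ (fderiv ℝ w) x) (closedBall x r) y := fun y _ =>
    ((hD y).hasFDerivAt.sub (fderiv ℝ (fderiv ℝ w) x).hasFDerivAt).hasFDerivWithinAt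
  have h1 := (convex_closedBall x r).norm_image_sub_le_of_norm_hasFDerivWithin_le hd
    (C := C * r) (fun y hy => ?_) hx hz
  · have e : fderiv ℝ w z - fderiv ℝ w x - fderiv ℝ (fderiv ℝ w) x (z - x) =
        fderiv ℝ w z - fderiv ℝ (fderiv ℝ w) x z -
          (fderiv ℝ w x - fderiv ℝ (fderiv ℝ w) x x) := by rw [map_sub]; abel
    rw [e]
    refine h1.trans ?_
    rw [pow_two, ← mul_assoc]
    exact mul_le_mul_of_nonneg_left (hseg z hz) (by positivity)
  · have := hC.dist_le_mul y x
    rw [dist_eq_norm, dist_eq_norm] at this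
    exact this.trans (mul_le_mul_of_nonneg_left (hseg y hy) C.2)

theorem hasFDerivAt_sub_quadratic {w : Euc N → ℝ} {x y : Euc N} {D : Euc N →L[ℝ] ℝ}
    {H : Euc N →L[ℝ] Euc N →L[ℝ] ℝ} (hw : DifferentiableAt ℝ w y) (hH : ∀ a b, H a b = H b a) :
    HasFDerivAt (fun y => w y - D (y - x) - 1 / 2 * H (y - x) (y - x))
      (fderiv ℝ w y - D - H (y - x)) y := by
  have e0 : HasFDerivAt (fun y : Euc N => y - x) (ContinuousLinearMap.id ℝ (Euc N)) y :=
    (hasFDerivAt_id (𝕜 := ℝ) y).sub_const x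
  have e2 : HasFDerivAt (fun y => D (y - x)) D y := by
    exact (D.hasFDerivAt.comp y e0).congr_fderiv (by ext; simp)
  have e3 : HasFDerivAt (fun y => H (y - x) (y - x)) ((2 : ℝ) • H (y - x)) y := by
    have e4 : HasFDerivAt (fun y => H (y - x)) H y := by
      exact (H.hasFDerivAt.comp y e0).congr_fderiv (by ext; simp)
    refine (e4.clm_apply e0).congr_fderiv ?_
    ext v
    simp [hH v y, hH v x]
    ring
  refine ((hw.hasFDerivAt.fun_sub e2).fun_sub (e3.const_mul (1 / 2))).congr_fderiv ?_
  rw [smul_smul]; norm_num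

theorem ContDiff.fderiv_fderiv_comm {w : Euc N → ℝ} (hw : ContDiff ℝ 3 w) (x a b : Euc N) :
    fderiv ℝ (fderiv ℝ w) x a b = fderiv ℝ (fderiv ℝ w) x b a :=
  (hw.contDiffAt.isSymmSndFDerivAt (by simp; norm_num)).eq a b

theorem le_taylor_of_lipschitzWith {w : Euc N → ℝ} (hw : ContDiff ℝ 3 w) {C : NNReal}
    (hC : LipschitzWith C (fderiv ℝ (fderiv ℝ w))) (x k : Euc N) :
    w (x + k) ≤ w x + fderiv ℝ w x k + 1 / 2 * fderiv ℝ (fderiv ℝ w) x k k + C * ‖k‖ ^ 3 := by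
  have hk : x + k ∈ closedBall x ‖k‖ := by simp
  have hx : x ∈ closedBall x ‖k‖ := mem_closedBall_self (norm_nonneg _)
  have h2 := (convex_closedBall x ‖k‖).norm_image_sub_le_of_norm_hasFDerivWithin_le
    (fun y _ => (hasFDerivAt_sub_quadratic (x := x) (D := fderiv ℝ w x)
      (hw.differentiable (by norm_num) y) (hw.fderiv_fderiv_comm x)).hasFDerivWithinAt)
    (fun y hy => norm_fderiv_sub_sub_le hw hC x y (norm_nonneg k) hy) hx hk
  generalize fderiv ℝ (fderiv ℝ w) x = H at h2 ⊢
  generalize fderiv ℝ w x = D at h2 ⊢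
  have e1 : x + k - x = k := by abel
  have e2 : D (x - x) = 0 := by simp
  have e3 : H (x - x) (x - x) = 0 := by simp
  simp only [e1, e2, e3] at h2
  have h3 := (le_abs_self _).trans h2
  have e : (C : ℝ) * ‖k‖ ^ 2 * ‖k‖ = C * ‖k‖ ^ 3 := by ring
  rw [e] at h3
  linarith

theorem exists_lipschitzWith_fderiv_fderiv {w : Euc N → ℝ} (hw : ContDiff ℝ 3 w)
    (hs : HasCompactSupport w) : ∃ C : NNReal, LipschitzWith C (fderiv ℝ (fderiv ℝ w)) := by
  have hD : ContDiff ℝ 2 (fderiv ℝ w) := hw.fderiv_right (by norm_num)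
  have hDD : ContDiff ℝ 1 (fderiv ℝ (fderiv ℝ w)) := hD.fderiv_right (by norm_num)
  exact hDD.lipschitzWith_of_hasCompactSupport ((hs.fderiv ℝ).fderiv ℝ) one_ne_zero

/-- Second order Taylor bound with a uniform cubic remainder. -/
theorem exists_taylor_le {w : Euc N → ℝ} (hw : ContDiff ℝ 3 w) (hs : HasCompactSupport w) :
    ∃ C : ℝ, 0 ≤ C ∧ ∀ x k : Euc N, w (x + k) ≤ w x + fderiv ℝ w x k
      + 1 / 2 * fderiv ℝ (fderiv ℝ w) x k k + C * ‖k‖ ^ 3 := by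
  obtain ⟨C, hC⟩ := exists_lipschitzWith_fderiv_fderiv hw hs
  exact ⟨C, C.coe_nonneg, le_taylor_of_lipschitzWith hw hC⟩

theorem norm_step_le (b z : Euc N) {h : ℝ} (h0 : 0 ≤ h) (h1 : h ≤ 1) :
    ‖Real.sqrt (2 * h) • z - h • b‖ ≤ Real.sqrt h * (2 * ‖z‖ + ‖b‖) := by
  have e1 : Real.sqrt 2 ≤ 2 := by
    rw [Real.sqrt_le_left] <;> norm_num
  have e2 : h ≤ Real.sqrt h := by
    rw [Real.le_sqrt h0 h0]; nlinarith
  refine (norm_sub_le _ _).trans ?_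
  rw [norm_smul, norm_smul, Real.norm_of_nonneg (Real.sqrt_nonneg _), Real.norm_of_nonneg h0,
    Real.sqrt_mul two_pos.le, mul_add]
  have : Real.sqrt 2 * Real.sqrt h * ‖z‖ ≤ Real.sqrt h * (2 * ‖z‖) := by
    nlinarith [mul_le_mul_of_nonneg_right e1 (mul_nonneg (Real.sqrt_nonneg h) (norm_nonneg z))]
  gcongr

theorem exists_integral_step_le {w : Euc N → ℝ} (hw : ContDiff ℝ 3 w) (hs : HasCompactSupport w)
    (b x : Euc N) : ∃ C : ℝ, ∀ h : ℝ, 0 ≤ h → h ≤ 1 →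
      ∫ z, w (x + (Real.sqrt (2 * h) • z - h • b)) ∂(stdGaussian (Euc N)) ≤
        w x + h * (lapl w x - inner ℝ b (gradient w x)) + C * (h * Real.sqrt h) := by
  obtain ⟨C, hC0, hC⟩ := exists_taylor_le hw hs
  set D := fderiv ℝ w x with hD
  set H := fderiv ℝ (fderiv ℝ w) x with hH
  set G := ∫ z, (2 * ‖z‖ + ‖b‖) ^ 3 ∂(stdGaussian (Euc N)) with hG
  refine ⟨|1 / 2 * H b b| + C * G, fun h h0 h1 => ?_⟩
  have hq : Integrable (fun z : Euc N => (2 * ‖z‖ + ‖b‖) ^ 3) (stdGaussian (Euc N)) := by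
    have : (fun z : Euc N => (2 * ‖z‖ + ‖b‖) ^ 3) = fun z : Euc N => 8 * ‖z‖ ^ 3 +
        12 * ‖b‖ * ‖z‖ ^ 2 + 6 * ‖b‖ ^ 2 * ‖z‖ ^ 1 + ‖b‖ ^ 3 := by ext z; ring
    rw [this]
    have I := integrable_norm_pow_stdGaussian (N := N)
    exact (((I 3).const_mul _).add ((I 2).const_mul _)).add ((I 1).const_mul _) |>.add
      (integrable_const _)
  set σ := Real.sqrt (2 * h) with hσ
  have hσ2 : σ ^ 2 = 2 * h := Real.sq_sqrt (by positivity)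
  set ℓ : Euc N →L[ℝ] ℝ := σ • D - (1 / 2 * σ * h) • (H.flip b + H b) with hℓ
  have hpt : ∀ z : Euc N, w (x + (σ • z - h • b)) ≤
      (w x - h * D b + 1 / 2 * h ^ 2 * H b b) + ℓ z + h * H z z +
        C * (h * Real.sqrt h) * (2 * ‖z‖ + ‖b‖) ^ 3 := by
    intro z
    have e1 := hC x (σ • z - h • b)
    have e2 : D (σ • z - h • b) = σ * D z - h * D b := by simp
    have e3 : H (σ • z - h • b) (σ • z - h • b) =
        σ ^ 2 * H z z - σ * h * (H z b + H b z) + h ^ 2 * H b b := by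
      simp; ring
    have e4 : ℓ z = σ * D z - (1 / 2 * σ * h) * (H z b + H b z) := by
      simp [hℓ]
      ring
    have e5 : ‖σ • z - h • b‖ ^ 3 ≤ (h * Real.sqrt h) * (2 * ‖z‖ + ‖b‖) ^ 3 := by
      calc _ ≤ (Real.sqrt h * (2 * ‖z‖ + ‖b‖)) ^ 3 := by
            gcongr; exact norm_step_le b z h0 h1
        _ = (Real.sqrt h ^ 2 * Real.sqrt h) * (2 * ‖z‖ + ‖b‖) ^ 3 := by ring
        _ = _ := by rw [Real.sq_sqrt h0]
    have e6 := mul_le_mul_of_nonneg_left e5 hC0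
    rw [← hD, ← hH, e2, e3, hσ2] at e1
    rw [e4]
    linarith
  have hwi : Integrable (fun z => w (x + (σ • z - h • b))) (stdGaussian (Euc N)) := by
    obtain ⟨B, hB⟩ := hs.exists_bound_of_continuous hw.continuous
    refine Integrable.of_bound ?_ B (Eventually.of_forall fun z => hB _)
    have : Continuous fun z => w (x + (σ • z - h • b)) := hw.continuous.comp (by fun_prop)
    exact this.aestronglyMeasurable
  have i0 : Integrable (fun _ : Euc N => w x - h * D b + 1 / 2 * h ^ 2 * H b b)
    (stdGaussian (Euc N)) := integrable_const _
  have i1 : Integrable (fun z : Euc N => ℓ z) (stdGaussian (Euc N)) :=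
    ℓ.integrable_comp IsGaussian.integrable_id
  have i2 := (integrable_apply_apply_stdGaussian H).const_mul h
  have i3 := hq.const_mul (C * (h * Real.sqrt h))
  have i01 : Integrable (fun z : Euc N => (w x - h * D b + 1 / 2 * h ^ 2 * H b b) + ℓ z)
    (stdGaussian (Euc N)) := i0.add i1
  have i012 : Integrable (fun z : Euc N => (w x - h * D b + 1 / 2 * h ^ 2 * H b b) + ℓ z +
    h * H z z) (stdGaussian (Euc N)) := i01.add i2
  have hintegral := integral_mono hwi (i012.add i3) hpt
  simp only [Pi.add_apply] at hintegral
  rw [integral_add i012 i3, integral_add i01 i2, integral_add i0 i1, integral_const_mul,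
    integral_const_mul, integral_apply_apply_stdGaussian, integral_strongDual_stdGaussian,
    ← hG, hH, ← lapl_eq_sum_fderiv, ← hH] at hintegral
  simp only [integral_const, probReal_univ, smul_eq_mul, one_mul, add_zero] at hintegral
  have e1 : D b = inner ℝ b (gradient w x) := by
    rw [hD, fderiv_apply_eq_inner_gradient, real_inner_comm]
  have e2 : h ≤ Real.sqrt h := by
    rw [Real.le_sqrt h0 h0]; nlinarith
  have e3 : 1 / 2 * h ^ 2 * H b b ≤ |1 / 2 * H b b| * (h * Real.sqrt h) := by
    calc 1 / 2 * h ^ 2 * H b b = (1 / 2 * H b b) * (h * h) := by ring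
      _ ≤ |1 / 2 * H b b| * (h * Real.sqrt h) := by
        refine mul_le_mul (le_abs_self _) (by gcongr) (by positivity) (abs_nonneg _)
  rw [e1] at hintegral
  linarith

/-- An infinitesimal consequence of the one-step inequality. -/
theorem deriv_sub_le_of_step {v : Euc N × ℝ → ℝ} (hv : ContDiff ℝ 3 v) (hs : HasCompactSupport v)
    (b x : Euc N) {t C F h₀ : ℝ} (hh₀ : 0 < h₀)
    (hstep : ∀ h, 0 < h → h ≤ h₀ → v (x, t + h) ≤
      ∫ z, v (x + (Real.sqrt (2 * h) • z - h • b), t) ∂(stdGaussian (Euc N)) + h * F + C * h ^ 2) :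
    deriv (fun s => v (x, s)) t - lapl (fun y => v (y, t)) x
      + inner ℝ b (gradient (fun y => v (y, t)) x) ≤ F := by
  have hw : ContDiff ℝ 3 fun y => v (y, t) := hv.comp (contDiff_id.prodMk contDiff_const)
  have hws : HasCompactSupport fun y => v (y, t) := by
    refine HasCompactSupport.comp_isClosedEmbedding (g := fun y : Euc N => (y, t)) hs ?_
    exact Topology.IsClosedEmbedding.of_continuous_injective_isClosedMap (by fun_prop)
      (fun a b h => by simpa using h) (isClosedMap_prodMk_right t)
  obtain ⟨C', hC'⟩ := exists_integral_step_le hw hws b x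
  set A := lapl (fun y => v (y, t)) x - inner ℝ b (gradient (fun y => v (y, t)) x) with hA
  have hd : HasDerivAt (fun s => v (x, s)) (deriv (fun s => v (x, s)) t) t := by
    refine DifferentiableAt.hasDerivAt ?_
    exact ((hv.differentiable (by norm_num)).comp (by fun_prop : Differentiable ℝ
      fun s : ℝ => (x, s))) t
  have hlim := (hd.tendsto_slope_zero_right)
  have hlim2 : Tendsto (fun h : ℝ => A + F + C' * Real.sqrt h + C * h) (𝓝[>] 0) (𝓝 (A + F)) := by
    have : Continuous fun h : ℝ => A + F + C' * Real.sqrt h + C * h := by fun_prop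
    simpa using this.continuousWithinAt (s := Ioi 0) (x := 0) |>.tendsto
  have hle := le_of_tendsto_of_tendsto hlim hlim2 ?_
  · linarith
  · filter_upwards [Ioo_mem_nhdsGT (show (0 : ℝ) < min h₀ 1 by positivity)] with h hh
    have e1 := hstep h hh.1 (hh.2.le.trans (min_le_left _ _))
    have e2 := hC' h hh.1.le (hh.2.le.trans (min_le_right _ _))
    rw [smul_eq_mul, inv_mul_le_iff₀ hh.1]
    nlinarith

end Gauss

/-! ### Uniform interior cones -/

section Cone

variable {N : ℕ} {Ω : Set (Euc N)}

/-- Near `x₁`, moving from points of `closure Ω` in the direction `ν` enters `Ω` linearly. -/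
def IsInnerDirection (Ω : Set (Euc N)) (x₁ ν : Euc N) (r c : ℝ) : Prop :=
  0 < r ∧ 0 < c ∧ ∀ x ∈ closure Ω, dist x x₁ < r → ∀ s, 0 < s → s ≤ r →
    ball (x + s • ν) (c * s) ⊆ Ω

theorem mem_or_frontier_of_mem_closure {x : Euc N} (hx : x ∈ closure Ω) :
    x ∈ Ω ∨ x ∈ frontier Ω := by
  rw [closure_eq_self_union_frontier] at hx
  exact hx

theorem HasC2Boundary.exists_isInnerDirection (hΩo : IsOpen Ω) (h : HasC2Boundary Ω)
    {x₁ : Euc N} (hx : x₁ ∈ closure Ω) : ∃ ν r c, IsInnerDirection Ω x₁ ν r c := by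
  rcases mem_or_frontier_of_mem_closure hx with hx | hx
  · obtain ⟨r, hr, hb⟩ := Metric.isOpen_iff.1 hΩo x₁ hx
    refine ⟨0, r / 2, 1, by positivity, one_pos, fun x _ hxr s hs hsr y hy => hb ?_⟩
    simp only [smul_zero, add_zero, one_mul, mem_ball] at hy ⊢
    linarith [dist_triangle y x x₁]
  · obtain ⟨ρ, hρ, hlt, hfr, hgrad⟩ := h
    have hp := norm_pos_iff.2 (hgrad x₁ hx)
    set p := gradient ρ x₁ with hpdef
    have hs := (hρ.contDiffAt (x := x₁)).hasStrictFDerivAt (by norm_num)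
    have hs' := hs.isLittleO.def (show 0 < ‖p‖ / 4 by positivity)
    obtain ⟨r₁, hr₁, hb⟩ := Metric.eventually_nhds_iff_ball.1 hs'
    refine ⟨-p, r₁ / (2 + 2 * ‖p‖), ‖p‖ / 4, by positivity, by positivity, ?_⟩
    intro x hxK hxr s hs0 hsr y hy
    have hrr : r₁ / (2 + 2 * ‖p‖) * (2 + 2 * ‖p‖) = r₁ := by field_simp
    rw [mem_ball, dist_eq_norm] at hy
    have hρx : ρ x ≤ 0 := by
      rcases mem_or_frontier_of_mem_closure hxK with h | h
      · rw [hlt] at h; exact le_of_lt h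
      · rw [hfr] at h; exact le_of_eq h
    have hyx : y - x = (y - (x + s • -p)) - s • p := by rw [smul_neg]; abel
    have hn : ‖y - x‖ ≤ ‖p‖ / 4 * s + s * ‖p‖ := by
      rw [hyx]
      refine (norm_sub_le _ _).trans ?_
      rw [norm_smul, Real.norm_of_nonneg hs0.le]
      linarith
    have hsp : s * ‖p‖ ≤ r₁ / (2 + 2 * ‖p‖) * ‖p‖ := by gcongr
    have hyb : dist y x₁ < r₁ := by
      have := dist_triangle y x x₁
      rw [dist_eq_norm y x] at this
      nlinarith [mul_pos (show 0 < r₁ / (2 + 2 * ‖p‖) by positivity) hp]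
    have hxb : dist x x₁ < r₁ := by
      nlinarith [mul_pos (show 0 < r₁ / (2 + 2 * ‖p‖) by positivity) hp]
    have key := hb (y, x) (by rw [mem_ball, Prod.dist_eq]; exact max_lt hyb hxb)
    simp only [] at key
    rw [fderiv_apply_eq_inner_gradient, ← hpdef, hyx, inner_sub_right, inner_smul_right,
      real_inner_self_eq_norm_sq, ← hyx, Real.norm_eq_abs] at key
    have h1 := (abs_le.1 key).2
    have h2 : inner ℝ p (y - (x + s • -p)) ≤ ‖p‖ * (‖p‖ / 4 * s) :=
      (real_inner_le_norm _ _).trans (by gcongr)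
    have h3 : ‖p‖ / 4 * ‖y - x‖ ≤ ‖p‖ / 4 * (‖p‖ / 4 * s + s * ‖p‖) := by gcongr
    rw [hlt]
    change ρ y < 0
    nlinarith [mul_pos hs0 (mul_pos hp hp)]

end Cone

/-! ### Mollification of subsolutions -/

section Mollify

variable {N : ℕ}

instance isAddHaarMeasure_volume_prod :
    (volume : Measure (Euc N × ℝ)).IsAddHaarMeasure :=
  inferInstanceAs ((volume : Measure (Euc N)).prod (volume : Measure ℝ)).IsAddHaarMeasure

/-- The mollification of `V` by a normalized bump function. -/
noncomputable def mollify (η : ContDiffBump (0 : Euc N × ℝ)) (V : Euc N × ℝ → ℝ) :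
    Euc N × ℝ → ℝ :=
  convolution (η.normed volume) V (ContinuousLinearMap.lsmul ℝ ℝ) volume

theorem mollify_apply (η : ContDiffBump (0 : Euc N × ℝ)) (V : Euc N × ℝ → ℝ) (p : Euc N × ℝ) :
    mollify η V p = ∫ q, η.normed volume q * V (p - q) := by
  simp [mollify, convolution_def]

theorem mollify_le_integral_mollify (η : ContDiffBump (0 : Euc N × ℝ)) {V : Euc N × ℝ → ℝ}
    (hV : Measurable V) {M : ℝ} (hM : ∀ q, |V q| ≤ M) {Z : Type*} [MeasurableSpace Z]
    {γ : Measure Z} [IsProbabilityMeasure γ] {k : Z → Euc N × ℝ} (hk : Measurable k)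
    {p : Euc N × ℝ} {E : ℝ}
    (h : ∀ q ∈ ball (0 : Euc N × ℝ) η.rOut, V (p - q) ≤ ∫ z, V (k z - q) ∂γ + E) :
    mollify η V p ≤ ∫ z, mollify η V (k z) ∂γ + E := by
  have hη : Integrable (η.normed volume) (volume : Measure (Euc N × ℝ)) := η.integrable_normed
  have hηm : Measurable (η.normed volume : Euc N × ℝ → ℝ) :=
    (η.contDiff_normed (n := 0)).continuous.measurable
  have hi : Integrable (fun w : (Euc N × ℝ) × Z => η.normed volume w.1 * V (k w.2 - w.1))
      ((volume : Measure (Euc N × ℝ)).prod γ) := by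
    refine (hη.mul_prod (integrable_const M : Integrable (fun _ : Z => M) γ)).mono' ?_ ?_
    · exact ((hηm.comp measurable_fst).mul
        (hV.comp ((hk.comp measurable_snd).sub measurable_fst))).aestronglyMeasurable
    · refine Eventually.of_forall fun w => ?_
      rw [norm_mul, Real.norm_of_nonneg (η.nonneg_normed _), Real.norm_eq_abs]
      exact mul_le_mul_of_nonneg_left (hM _) (η.nonneg_normed _)
  have h2 : ∫ z, mollify η V (k z) ∂γ
      = ∫ q, η.normed volume q * ∫ z, V (k z - q) ∂γ := by
    simp only [mollify_apply, ← integral_const_mul]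
    exact (integral_integral_swap hi).symm
  have hE : E = ∫ q : Euc N × ℝ, η.normed volume q * E := by
    rw [integral_mul_const, η.integral_normed, one_mul]
  have hi2 : Integrable fun q : Euc N × ℝ => η.normed volume q * ∫ z, V (k z - q) ∂γ := by
    simpa only [integral_const_mul] using hi.integral_prod_left
  rw [h2, hE, ← integral_add hi2 (hη.mul_const E), mollify_apply]
  refine integral_mono ?_ (hi2.add (hη.mul_const E)) fun q => ?_
  · refine hη.mul_bdd (c := M) ?_ ?_
    · exact (hV.comp (measurable_const.sub measurable_id)).aestronglyMeasurable
    · exact Eventually.of_forall fun q => hM _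
  · by_cases hq : q ∈ ball (0 : Euc N × ℝ) η.rOut
    · simp only []
      rw [← mul_add]
      exact mul_le_mul_of_nonneg_left (h q hq) (η.nonneg_normed _)
    · rw [← η.support_normed_eq (μ := volume), Function.notMem_support] at hq
      simp [hq]

theorem contDiff_mollify (η : ContDiffBump (0 : Euc N × ℝ)) {V : Euc N × ℝ → ℝ}
    (hV : Measurable V) {M : ℝ} (hM : ∀ q, |V q| ≤ M) (n : ℕ) :
    ContDiff ℝ n (mollify η V) := by
  have hl : LocallyIntegrable V (volume : Measure (Euc N × ℝ)) :=
    (locallyIntegrable_const M).mono hV.aestronglyMeasurable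
      (Eventually.of_forall fun q => (hM q).trans (le_abs_self M))
  exact HasCompactSupport.contDiff_convolution_left (n := n) (ContinuousLinearMap.lsmul ℝ ℝ)
    (η.hasCompactSupport_normed (μ := volume)) (η.contDiff_normed (n := n)) hl

theorem hasCompactSupport_mollify (η : ContDiffBump (0 : Euc N × ℝ)) {V : Euc N × ℝ → ℝ}
    (hV : HasCompactSupport V) : HasCompactSupport (mollify η V) :=
  η.hasCompactSupport_normed.convolution _ hV

theorem inner_sub_le_norm_rpow {m : ℝ} (hm : 1 < m) (p q : Euc N) :
    inner ℝ ((m * ‖p‖ ^ (m - 2)) • p) q - (m - 1) * ‖p‖ ^ m ≤ ‖q‖ ^ m := by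
  rcases eq_or_ne p 0 with rfl | hp
  · simp only [smul_zero, inner_zero_left, norm_zero, Real.zero_rpow (by linarith : m ≠ 0)]
    simpa using Real.rpow_nonneg (norm_nonneg q) m
  have hp' := norm_pos_iff.2 hp
  have hy := Real.young_inequality_of_nonneg (norm_nonneg q)
    (Real.rpow_nonneg (norm_nonneg p) (m - 1)) (Real.HolderConjugate.conjExponent hm)
  have h1 : (‖p‖ ^ (m - 1)) ^ (m.conjExponent) = ‖p‖ ^ m := by
    rw [← Real.rpow_mul hp'.le, Real.conjExponent]
    congr 1
    field_simp [show m - 1 ≠ 0 by linarith]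
  rw [h1, Real.conjExponent] at hy
  have h2 : ‖p‖ ^ (m - 2) * ‖p‖ = ‖p‖ ^ (m - 1) := by
    rw [← Real.rpow_add_one hp'.ne']; ring_nf
  have h3 : inner ℝ ((m * ‖p‖ ^ (m - 2)) • p) q ≤ m * (‖q‖ * ‖p‖ ^ (m - 1)) := by
    rw [inner_smul_left, ← h2]
    have := real_inner_le_norm p q
    have h4 : 0 ≤ m * ‖p‖ ^ (m - 2) := by positivity
    calc (starRingEnd ℝ) (m * ‖p‖ ^ (m - 2)) * inner ℝ p q
        ≤ (m * ‖p‖ ^ (m - 2)) * (‖p‖ * ‖q‖) := mul_le_mul_of_nonneg_left this h4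
      _ = _ := by ring
  have h5 : m * (‖q‖ * ‖p‖ ^ (m - 1)) ≤ m * (‖q‖ ^ m / m + ‖p‖ ^ m / (m / (m - 1))) :=
    mul_le_mul_of_nonneg_left hy (by linarith)
  have h6 : m * (‖q‖ ^ m / m + ‖p‖ ^ m / (m / (m - 1))) = ‖q‖ ^ m + (m - 1) * ‖p‖ ^ m := by
    field_simp [show m - 1 ≠ 0 by linarith]
  linarith

theorem inner_tangent_eq {m : ℝ} (hm : 1 < m) (p : Euc N) :
    inner ℝ ((m * ‖p‖ ^ (m - 2)) • p) p - (m - 1) * ‖p‖ ^ m = ‖p‖ ^ m := by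
  rcases eq_or_ne p 0 with rfl | hp
  · simp [Real.zero_rpow (by linarith : m ≠ 0)]
  have hp' := norm_pos_iff.2 hp
  have h2 : ‖p‖ ^ (m - 2) * ‖p‖ ^ 2 = ‖p‖ ^ m := by
    rw [← Real.rpow_natCast ‖p‖ 2, ← Real.rpow_add hp']; norm_num
  rw [inner_smul_left, real_inner_self_eq_norm_sq]
  change m * ‖p‖ ^ (m - 2) * ‖p‖ ^ 2 - _ = _
  rw [mul_assoc, h2]; ring

end Mollify

section Approx

variable {N : ℕ} {Ω : Set (Euc N)} {f : Euc N → ℝ} {lam m : ℝ} {u : Euc N → ℝ → ℝ}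

/-- The restriction of `u` to `closure Ω × [0,T]`, extended by zero and translated. -/
noncomputable def shiftExt (Ω : Set (Euc N)) (u : Euc N → ℝ → ℝ) (T : ℝ) (a : Euc N × ℝ) :
    Euc N × ℝ → ℝ :=
  fun q => (closure Ω ×ˢ Icc 0 T).indicator (fun p => u p.1 p.2) (q + a)

theorem shiftExt_of_mem {T : ℝ} {a q : Euc N × ℝ} (h1 : q.1 + a.1 ∈ closure Ω)
    (h2 : q.2 + a.2 ∈ Icc 0 T) : shiftExt Ω u T a q = u (q.1 + a.1) (q.2 + a.2) := by
  rw [shiftExt, indicator_of_mem]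
  · rfl
  · exact ⟨h1, h2⟩

theorem measurable_shiftExt
    (hc : ContinuousOn (fun p : Euc N × ℝ => u p.1 p.2) (closure Ω ×ˢ Ici 0)) (T : ℝ)
    (a : Euc N × ℝ) : Measurable (shiftExt Ω u T a) := by
  classical
  have h1 : Measurable ((closure Ω ×ˢ Icc 0 T).indicator (fun p : Euc N × ℝ => u p.1 p.2)) := by
    rw [← piecewise_eq_indicator]
    exact ContinuousOn.measurable_piecewise
      (hc.mono (prod_mono_right Icc_subset_Ici_self)) continuousOn_const
      (isClosed_closure.prod isClosed_Icc).measurableSet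
  exact h1.comp (measurable_id.add_const a)

theorem hasCompactSupport_shiftExt (hΩb : Bornology.IsBounded Ω) (u : Euc N → ℝ → ℝ) (T : ℝ)
    (a : Euc N × ℝ) : HasCompactSupport (shiftExt Ω u T a) := by
  have h1 : HasCompactSupport
      ((closure Ω ×ˢ Icc 0 T).indicator (fun p : Euc N × ℝ => u p.1 p.2)) :=
    HasCompactSupport.intro (hΩb.isCompact_closure.prod isCompact_Icc)
      fun _ hx => indicator_of_notMem hx _
  exact h1.comp_homeomorph (Homeomorph.addRight a)

theorem exists_abs_le_of_continuousOn (hΩb : Bornology.IsBounded Ω)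
    (hc : ContinuousOn (fun p : Euc N × ℝ => u p.1 p.2) (closure Ω ×ˢ Ici 0)) (T : ℝ) :
    ∃ M, 0 ≤ M ∧ ∀ x ∈ closure Ω, ∀ t ∈ Icc 0 T, |u x t| ≤ M := by
  obtain ⟨M, hM⟩ := (hΩb.isCompact_closure.prod
    (isCompact_Icc (a := (0 : ℝ)) (b := T))).exists_bound_of_continuousOn
    (hc.mono (prod_mono_right Icc_subset_Ici_self))
  exact ⟨max M 0, le_max_right _ _, fun x hx t ht => (hM (x, t) ⟨hx, ht⟩).trans (le_max_left _ _)⟩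

theorem abs_shiftExt_le {T M : ℝ} (hM0 : 0 ≤ M)
    (hM : ∀ x ∈ closure Ω, ∀ t ∈ Icc 0 T, |u x t| ≤ M) (a q : Euc N × ℝ) :
    |shiftExt Ω u T a q| ≤ M := by
  by_cases h : q + a ∈ closure Ω ×ˢ Icc 0 T
  · rw [shiftExt, indicator_of_mem h]; exact hM _ h.1 _ h.2
  · rw [shiftExt, indicator_of_notMem h]; simpa

theorem IsBackSub.deriv_mollify_le (hu : IsBackSub Ω f lam m u) (hΩb : Bornology.IsBounded Ω)
    (hc : ContinuousOn (fun p : Euc N × ℝ => u p.1 p.2) (closure Ω ×ˢ Ici 0)) (hm : 1 < m)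
    (η : ContDiffBump (0 : Euc N × ℝ)) {T s c ε t : ℝ} {x ν : Euc N} (hs : 0 < s) (hs1 : s ≤ 1)
    (hcpos : 0 < c) (hball : ball (x + s • ν) (c * s) ⊆ Ω) (hη1 : η.rOut ≤ c * s / 2)
    (hη2 : η.rOut ≤ s) (ht : 3 * s ≤ t) (htT : t + 1 ≤ T)
    (hosc : ∀ x' ∈ closure Ω, ∀ t' ∈ Icc 0 T, dist x' x < (c + ‖ν‖ + 1) * s → |t' - t| < 4 * s →
      f x' - lam * u x' t' ≤ f x - lam * u x t + ε) :
    deriv (fun τ => mollify η (shiftExt Ω u T (s • ν, -s)) (x, τ)) t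
      - lapl (fun y => mollify η (shiftExt Ω u T (s • ν, -s)) (y, t)) x
      + ‖gradient (fun y => mollify η (shiftExt Ω u T (s • ν, -s)) (y, t)) x‖ ^ m
      ≤ f x - lam * u x t + ε := by
  obtain ⟨M, hM0, hM⟩ := exists_abs_le_of_continuousOn hΩb hc T
  set V := shiftExt Ω u T (s • ν, -s) with hVdef
  have hVm : Measurable V := measurable_shiftExt hc T _
  have hVb : ∀ q, |V q| ≤ M := abs_shiftExt_le hM0 hM _
  set p := gradient (fun y => mollify η V (y, t)) x with hp
  set b : Euc N := (m * ‖p‖ ^ (m - 2)) • p with hb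
  set F := f x - lam * u x t + ε + (m - 1) * ‖p‖ ^ m with hF
  obtain ⟨C, hC⟩ := hu.exists_step hc hM0 (show 0 < c * s / 2 by positivity) (Λ := |F|)
    (inner_sub_le_norm_rpow hm p)
  have hsub : Ω ⊆ closure Ω := subset_closure
  have key := deriv_sub_le_of_step (v := mollify η V) (contDiff_mollify η hVm hVb 3)
    (hasCompactSupport_mollify η (hasCompactSupport_shiftExt hΩb u T _)) b x (t := t) (C := C)
    (F := F) hs ?_
  · have := inner_tangent_eq hm p
    rw [← hb] at this
    rw [← hp] at key
    linarith
  intro h hh0 hhs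
  rw [add_assoc]
  refine mollify_le_integral_mollify η hVm hVb (k := fun z => (x + (√(2*h) • z - h • b), t))
    (by fun_prop) fun q hq => ?_
  rw [mem_ball_zero_iff, Prod.norm_def, max_lt_iff, Real.norm_eq_abs, abs_lt] at hq
  obtain ⟨hq1, hq2, hq3⟩ := hq
  set y := x - q.1 + s • ν with hy
  set t' := t - q.2 - s with ht'
  have hyR : closedBall y (c * s / 2) ⊆ Ω := by
    refine Subset.trans ?_ hball
    refine closedBall_subset_ball' ?_
    have : dist y (x + s • ν) = ‖q.1‖ := by
      rw [dist_eq_norm, hy, show x - q.1 + s • ν - (x + s • ν) = -q.1 by abel, norm_neg]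
    rw [this]; linarith
  have hyΩ : y ∈ closure Ω := hsub (hyR (mem_closedBall_self (by positivity)))
  have htime : ∀ τ ∈ Icc t' (t' + h), τ ∈ Icc 0 T ∧ |τ - t| < 4 * s := by
    intro τ hτ
    obtain ⟨h1, h2⟩ := hτ
    refine ⟨⟨by linarith, by linarith⟩, ?_⟩
    rw [abs_lt]; constructor <;> linarith
  have hstep := hC y t' h F (fun x' => V (x' - s • ν, t' + s)) hyR (by linarith) hh0.le
    (by linarith) le_rfl
    (fun x' hx' τ hτ => hM x' (hsub (hyR hx')) τ (htime τ hτ).1) ?_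
    (hVm.comp (by fun_prop)) (fun x' => hVb _) ?_
  · have e1 : V ((x, t + h) - q) = u y (t' + h) := by
      have e : (t + h - q.2) + -s = t' + h := by rw [ht']; ring
      rw [hVdef, shiftExt_of_mem]
      · simp only [Prod.fst_sub, Prod.snd_sub, ← hy, e]
      · exact hyΩ
      · simp only [Prod.snd_sub, e]
        exact (htime _ ⟨by linarith, le_rfl⟩).1
    rw [e1]
    refine hstep.trans (le_of_eq ?_)
    rw [add_assoc]
    congr 1
    refine integral_congr_ae (Eventually.of_forall fun z => ?_)
    simp only []
    congr 1
    ext1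
    · simp only [hy, Prod.fst_sub]; abel
    · simp only [ht', Prod.snd_sub]; ring
  · intro x' hx' τ hτ
    have h1 : dist x' x < (c + ‖ν‖ + 1) * s := by
      rw [mem_closedBall] at hx'
      have h2 : dist y x ≤ ‖q.1‖ + s * ‖ν‖ := by
        rw [dist_eq_norm, hy, show x - q.1 + s • ν - x = s • ν - q.1 by abel]
        refine (norm_sub_le _ _).trans ?_
        rw [norm_smul, Real.norm_of_nonneg hs.le, add_comm]
      nlinarith [dist_triangle x' y x]
    have := hosc x' (hsub (hyR hx')) τ (htime τ hτ).1 h1 (htime τ hτ).2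
    linarith
  · intro x' hx'
    rw [hVdef, shiftExt_of_mem]
    · simp
    · simpa using hsub (hyR hx')
    · simpa using (htime _ ⟨le_rfl, by linarith⟩).1

theorem IsBackSub.exists_smooth_approx (hu : IsBackSub Ω f lam m u)
    (hΩb : Bornology.IsBounded Ω)
    (hc : ContinuousOn (fun p : Euc N × ℝ => u p.1 p.2) (closure Ω ×ˢ Ici 0))
    (hf : ContinuousOn f (closure Ω)) (hm : 1 < m) {x₁ ν : Euc N} {r c : ℝ}
    (hν : IsInnerDirection Ω x₁ ν r c) {t₁ : ℝ} (ht₁ : 0 < t₁) {ε : ℝ} (hε : 0 < ε) :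
    ∃ v : Euc N × ℝ → ℝ, ContDiff ℝ 2 v ∧ ∀ x ∈ closure Ω, dist x x₁ < r →
      ∀ t ∈ Icc (t₁ / 2) t₁, |v (x, t) - u x t| ≤ ε ∧
        deriv (fun τ => v (x, τ)) t - lapl (fun y => v (y, t)) x
          + ‖gradient (fun y => v (y, t)) x‖ ^ m ≤ f x - lam * u x t + ε := by
  obtain ⟨hr, hcpos, hcone⟩ := hν
  set T := t₁ + 1 with hT
  have hcomp : IsCompact (closure Ω ×ˢ Icc 0 T) := hΩb.isCompact_closure.prod isCompact_Icc
  have hc' : ContinuousOn (fun p : Euc N × ℝ => u p.1 p.2) (closure Ω ×ˢ Icc 0 T) :=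
    hc.mono (prod_mono_right Icc_subset_Ici_self)
  have hG : ContinuousOn (fun p : Euc N × ℝ => f p.1 - lam * u p.1 p.2)
      (closure Ω ×ˢ Icc 0 T) :=
    (hf.comp continuousOn_fst fun p hp => hp.1).sub (continuousOn_const.mul hc')
  obtain ⟨δ₁, hδ₁, h₁⟩ := Metric.uniformContinuousOn_iff.1
    (hcomp.uniformContinuousOn_of_continuous hc') (ε / 3) (by positivity)
  obtain ⟨δ₂, hδ₂, h₂⟩ := Metric.uniformContinuousOn_iff.1
    (hcomp.uniformContinuousOn_of_continuous hG) ε hε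
  obtain ⟨s, hs, hsr, hs1, hst, hsδ₁, hsδ₂⟩ : ∃ s > 0, s ≤ r ∧ s ≤ 1 ∧ 6 * s ≤ t₁ ∧
      (c + ‖ν‖ + 5) * s ≤ δ₁ ∧ (c + ‖ν‖ + 5) * s ≤ δ₂ := by
    have hk : 0 < c + ‖ν‖ + 5 := by positivity
    refine ⟨min (min r 1) (min (t₁ / 6) (min (δ₁ / (c + ‖ν‖ + 5)) (δ₂ / (c + ‖ν‖ + 5)))),
      by positivity, ?_, ?_, ?_, ?_, ?_⟩
    · exact (min_le_left _ _).trans (min_le_left _ _)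
    · exact (min_le_left _ _).trans (min_le_right _ _)
    · have : min (min r 1) (min (t₁ / 6) (min (δ₁ / (c + ‖ν‖ + 5)) (δ₂ / (c + ‖ν‖ + 5))))
        ≤ t₁ / 6 := (min_le_right _ _).trans (min_le_left _ _)
      linarith
    · rw [mul_comm, ← le_div_iff₀ hk]
      exact (min_le_right _ _).trans ((min_le_right _ _).trans (min_le_left _ _))
    · rw [mul_comm, ← le_div_iff₀ hk]
      exact (min_le_right _ _).trans ((min_le_right _ _).trans (min_le_right _ _))
  have hη0 : 0 < min (c * s / 2) s := by positivity
  let η : ContDiffBump (0 : Euc N × ℝ) := ⟨min (c * s / 2) s / 2, min (c * s / 2) s,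
    by positivity, by linarith⟩
  have hη1 : η.rOut ≤ c * s / 2 := min_le_left _ _
  have hη2 : η.rOut ≤ s := min_le_right _ _
  obtain ⟨M, hM0, hM⟩ := exists_abs_le_of_continuousOn hΩb hc T
  set V := shiftExt Ω u T (s • ν, -s) with hVdef
  have hVm : Measurable V := measurable_shiftExt hc T _
  refine ⟨mollify η V, contDiff_mollify η hVm (abs_shiftExt_le hM0 hM _) 2, ?_⟩
  intro x hx hxr t ht
  have hxt : (x, t) ∈ closure Ω ×ˢ Icc 0 T :=
    ⟨hx, by linarith [ht.1], by linarith [ht.2]⟩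
  refine ⟨?_, hu.deriv_mollify_le hΩb hc hm η hs hs1 hcpos (hcone x hx hxr s hs hsr) hη1 hη2
    (by linarith [ht.1]) (by linarith [ht.2]) ?_⟩
  · have hV : ∀ q ∈ ball (x, t) η.rOut, |V q - u x t| < ε / 3 := by
      intro q hq
      rw [mem_ball, Prod.dist_eq, max_lt_iff] at hq
      obtain ⟨hq1, hq2⟩ := hq
      have hq3 := abs_lt.1 hq2
      have hmem : q.1 + s • ν ∈ closure Ω := by
        refine subset_closure (hcone x hx hxr s hs hsr ?_)
        rw [mem_ball, dist_add_right]
        nlinarith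
      have htm : q.2 + -s ∈ Icc 0 T :=
        ⟨by linarith [ht.1], by linarith [ht.2]⟩
      rw [hVdef, shiftExt_of_mem hmem htm]
      refine h₁ (q.1 + s • ν, q.2 + -s) ⟨hmem, htm⟩ (x, t) hxt ?_
      refine lt_of_lt_of_le ?_ hsδ₁
      rw [Prod.dist_eq, max_lt_iff]
      have hpos : 0 ≤ ‖ν‖ * s := by positivity
      have hpos2 : 0 < c * s := by positivity
      constructor
      · have : dist (q.1 + s • ν) x ≤ dist q.1 x + s * ‖ν‖ := by
          rw [dist_eq_norm, dist_eq_norm, add_sub_right_comm]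
          refine (norm_add_le _ _).trans ?_
          rw [norm_smul, Real.norm_of_nonneg hs.le]
        dsimp only at this ⊢
        nlinarith
      · rw [Real.dist_eq, abs_lt]
        constructor <;> nlinarith
    have h3 := hV (x, t) (mem_ball_self η.rOut_pos)
    have h4 : dist (mollify η V (x, t)) (V (x, t)) ≤ ε / 3 + ε / 3 := by
      refine η.dist_normed_convolution_le hVm.aestronglyMeasurable fun q hq => ?_
      have h5 := abs_lt.1 (hV q hq)
      have h6 := abs_lt.1 h3
      rw [Real.dist_eq, abs_le]
      constructor <;> linarith
    have h7 := abs_le.1 (Real.dist_eq _ _ ▸ h4)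
    have h8 := abs_lt.1 h3
    rw [abs_le]
    constructor <;> linarith
  · intro x' hx' t' ht' hd ht'd
    have := h₂ (x', t') ⟨hx', ht'⟩ (x, t) hxt ?_
    · have := abs_lt.1 (Real.dist_eq _ _ ▸ this)
      dsimp only at this
      linarith
    · refine lt_of_lt_of_le ?_ hsδ₂
      rw [Prod.dist_eq, max_lt_iff, Real.dist_eq]
      have hpos : 0 ≤ ‖ν‖ * s := by positivity
      have hpos2 : 0 < c * s := by positivity
      dsimp only
      constructor <;> nlinarith

end Approx

/-! ### Comparison principle -/

section Comparison

variable {N : ℕ} {Ω : Set (Euc N)} {f g : Euc N → ℝ} {lam m : ℝ} {u w : Euc N → ℝ → ℝ}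

/-- Viscosity supersolutions of the generalized Dirichlet problem, tested backward in time. -/
def IsBackSuper (Ω : Set (Euc N)) (f g : Euc N → ℝ) (lam m : ℝ) (w : Euc N → ℝ → ℝ) : Prop :=
  ∀ φ : Euc N × ℝ → ℝ, ContDiff ℝ 2 φ → ∀ x₀ ∈ closure Ω, ∀ t₀, 0 < t₀ →
    IsLocalMinOn (fun p : Euc N × ℝ => w p.1 p.2 - φ p) (closure Ω ×ˢ Ioc 0 t₀) (x₀, t₀) →
      0 ≤ parOp f lam m φ (w x₀ t₀) x₀ t₀ ∨ (x₀ ∈ frontier Ω ∧ g x₀ ≤ w x₀ t₀)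

theorem norm_convexCombo_rpow_le {m : ℝ} (hm : 1 ≤ m) {μ : ℝ} (h0 : 0 ≤ μ) (h1 : μ ≤ 1)
    (p q : Euc N) :
    ‖μ • p + (1 - μ) • q‖ ^ m ≤ μ * ‖p‖ ^ m + (1 - μ) * ‖q‖ ^ m := by
  have h2 : 0 ≤ 1 - μ := by linarith
  have h3 : ‖μ • p + (1 - μ) • q‖ ≤ μ * ‖p‖ + (1 - μ) * ‖q‖ := by
    refine (norm_add_le _ _).trans (le_of_eq ?_)
    rw [norm_smul, norm_smul, Real.norm_of_nonneg h0, Real.norm_of_nonneg h2]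
  refine (Real.rpow_le_rpow (norm_nonneg _) h3 (by linarith)).trans ?_
  exact (convexOn_rpow hm).2 (norm_nonneg p) (norm_nonneg q) h0 h2 (by ring)

/-- The strict subsolution used to penalize the comparison argument. -/
noncomputable def penalty (A C κ : ℝ) (x₁ : Euc N) (t₁ : ℝ) (p : Euc N × ℝ) : ℝ :=
  -A - C * p.2 - κ * (‖p.1 - x₁‖ ^ 2 + (t₁ - p.2))

theorem contDiff_penalty (A C κ : ℝ) (x₁ : Euc N) (t₁ : ℝ) :
    ContDiff ℝ 2 (penalty A C κ x₁ t₁) := by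
  unfold penalty
  have h : ContDiff ℝ 2 fun p : Euc N × ℝ => ‖p.1 - x₁‖ ^ 2 :=
    (contDiff_norm_sq ℝ).comp (contDiff_fst.sub contDiff_const)
  fun_prop

theorem hasDerivAt_penalty (A C κ : ℝ) (x₁ x : Euc N) (t₁ t : ℝ) :
    HasDerivAt (fun s => penalty A C κ x₁ t₁ (x, s)) (-C + κ) t := by
  unfold penalty
  have h := ((hasDerivAt_const t (-A)).fun_sub ((hasDerivAt_id t).const_mul C)).fun_sub
    ((((hasDerivAt_const t t₁).fun_sub (hasDerivAt_id t)).const_add (‖x - x₁‖ ^ 2)).const_mul κ)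
  refine (h.congr_deriv (by ring))

theorem jet_penalty (A C κ : ℝ) (x₁ x : Euc N) (t₁ t : ℝ) :
    Jet (fun y => penalty A C κ x₁ t₁ (y, t)) x (-(κ • (2 : ℝ) • (x - x₁))) (-(κ * (2 * N))) := by
  unfold penalty
  have h := (Jet.const (-A - C * t) x).sub
    (((Jet.norm_sub_sq x₁ x).add (Jet.const (t₁ - t) x)).const_mul κ)
  simpa using h

theorem penalty_slope_le (hm : 1 < m) {κ : ℝ} (hκ0 : 0 ≤ κ) (hκ : κ * (2 * N + 3) ≤ 1)
    {x₁ x : Euc N} (hx : dist x x₁ ≤ 1) :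
    κ + κ * (2 * N) + ‖-(κ • (2 : ℝ) • (x - x₁))‖ ^ m ≤ 1 := by
  have hN : (0 : ℝ) ≤ N := Nat.cast_nonneg N
  have h1 : ‖-(κ • (2 : ℝ) • (x - x₁))‖ ≤ 2 * κ := by
    rw [norm_neg, norm_smul, norm_smul, Real.norm_of_nonneg hκ0, ← dist_eq_norm]
    norm_num
    nlinarith
  have h2 : 2 * κ ≤ 1 := by nlinarith [mul_nonneg hκ0 hN]
  have h3 : ‖-(κ • (2 : ℝ) • (x - x₁))‖ ^ m ≤ 2 * κ := by
    refine (Real.rpow_le_rpow_of_exponent_ge' (norm_nonneg _) (h1.trans h2) zero_le_one hm.le).trans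
      ?_
    rwa [Real.rpow_one]
  linarith

theorem parOp_convexCombo_penalty_neg (hm : 1 < m) (hlam : 0 ≤ lam) {v : Euc N × ℝ → ℝ}
    (hv : ContDiff ℝ 2 v) {μ κ A B ε t₁ t r s : ℝ} {x₁ x : Euc N} (hμ0 : 0 ≤ μ) (hμ1 : μ ≤ 1)
    (hκ0 : 0 ≤ κ) (hκ : κ * (2 * N + 3) ≤ 1) (hx : dist x x₁ ≤ 1) (hfB : -B ≤ f x)
    (hε0 : 0 ≤ ε) (hε1 : ε < 1 - μ)
    (hvsub : deriv (fun τ => v (x, τ)) t - lapl (fun y => v (y, t)) x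
      + ‖gradient (fun y => v (y, t)) x‖ ^ m ≤ f x - lam * s + ε) (hr : r ≤ μ * s) :
    parOp f lam m (fun p => μ * v p + (1 - μ) * penalty A (B + 2) κ x₁ t₁ p) r x t < 0 := by
  have hvt : HasDerivAt (fun s => v (x, s)) (deriv (fun s => v (x, s)) t) t :=
    ((hv.comp (contDiff_const.prodMk contDiff_id)).differentiable (by norm_num) t).hasDerivAt
  have hvj : Jet (fun y => v (y, t)) x _ _ :=
    ContDiffAt.jet (hv.comp (contDiff_id.prodMk contDiff_const)).contDiffAt
  rw [parOp_eq ((hvt.const_mul μ).fun_add ((hasDerivAt_penalty A (B + 2) κ x₁ x t₁ t).const_mul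
    (1 - μ))) ((hvj.const_mul μ).add ((jet_penalty A (B + 2) κ x₁ x t₁ t).const_mul (1 - μ)))]
  have hconv := norm_convexCombo_rpow_le hm.le hμ0 hμ1
    (gradient (fun y => v (y, t)) x) (-(κ • (2 : ℝ) • (x - x₁)))
  have h1μ : 0 ≤ 1 - μ := by linarith
  have h1 := mul_le_mul_of_nonneg_left hvsub hμ0
  have h2 := mul_le_mul_of_nonneg_left (penalty_slope_le hm hκ0 hκ hx) h1μ
  have h3 := mul_le_mul_of_nonneg_left hr hlam
  have h4 : (1 - μ) * (-B) ≤ (1 - μ) * f x := mul_le_mul_of_nonneg_left hfB h1μ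
  have h5 : μ * ε ≤ ε := mul_le_of_le_one_left hε0 hμ1
  linarith

set_option maxHeartbeats 1000000 in
theorem IsBackSub.le_of_isBackSuper (hu : IsBackSub Ω f lam m u) (hw : IsBackSuper Ω f g lam m w)
    (hΩo : IsOpen Ω) (hΩb : Bornology.IsBounded Ω) (hΩ2 : HasC2Boundary Ω) (hm : 1 < m)
    (hlam : 0 ≤ lam) (hf : ContinuousOn f (closure Ω))
    (huc : ContinuousOn (fun p : Euc N × ℝ => u p.1 p.2) (closure Ω ×ˢ Ici 0))
    (hwc : ContinuousOn (fun p : Euc N × ℝ => w p.1 p.2) (closure Ω ×ˢ Ici 0))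
    (hbd : ∀ x ∈ frontier Ω, ∀ t, 0 < t → u x t ≤ g x)
    (hinit : ∀ x ∈ closure Ω, u x 0 ≤ w x 0) :
    ∀ x ∈ closure Ω, ∀ t, 0 ≤ t → u x t ≤ w x t := by
  intro x₀ hx₀ T hT
  by_contra! hlt
  have hcomp : IsCompact (closure Ω ×ˢ Icc 0 T) := hΩb.isCompact_closure.prod isCompact_Icc
  have hsub : closure Ω ×ˢ Icc 0 T ⊆ closure Ω ×ˢ Ici 0 := prod_mono_right Icc_subset_Ici_self
  obtain ⟨A, hA0, hA⟩ := exists_abs_le_of_continuousOn hΩb huc T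
  obtain ⟨B, hB⟩ := hΩb.isCompact_closure.exists_bound_of_continuousOn hf
  have hB0 : 0 ≤ B := (norm_nonneg _).trans (hB x₀ hx₀)
  set C := B + 2 with hC
  obtain ⟨μ, hμ0, hμ1, hμ⟩ : ∃ μ : ℝ, 0 < μ ∧ μ < 1 ∧
      0 < μ * u x₀ T + (1 - μ) * (-A - C * T) - w x₀ T := by
    have hcont : Continuous fun μ : ℝ => μ * u x₀ T + (1 - μ) * (-A - C * T) - w x₀ T := by
      fun_prop
    have h1 : ∀ᶠ μ in 𝓝[<] (1 : ℝ), 0 < μ * u x₀ T + (1 - μ) * (-A - C * T) - w x₀ T :=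
      (hcont.tendsto 1).eventually (lt_mem_nhds (by simpa using hlt))
        |>.filter_mono nhdsWithin_le_nhds
    have h2 : ∀ᶠ μ in 𝓝[<] (1 : ℝ), μ ∈ Ioo (0 : ℝ) 1 := Ioo_mem_nhdsLT one_pos
    obtain ⟨μ, h3, h4⟩ := (h1.and h2).exists
    exact ⟨μ, h4.1, h4.2, h3⟩
  obtain ⟨⟨x₁, t₁⟩, ⟨hx₁, ht₁⟩, hmax⟩ := hcomp.exists_isMaxOn ⟨(x₀, T), hx₀, hT, le_rfl⟩
    (f := fun p : Euc N × ℝ => μ * u p.1 p.2 + (1 - μ) * (-A - C * p.2) - w p.1 p.2)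
    (((continuousOn_const.mul (huc.mono hsub)).add (by fun_prop)).sub (hwc.mono hsub))
  dsimp only at hx₁ ht₁
  set σ := μ * u x₁ t₁ + (1 - μ) * (-A - C * t₁) - w x₁ t₁ with hσ
  have hmax' : ∀ x ∈ closure Ω, ∀ t ∈ Icc 0 T,
      μ * u x t + (1 - μ) * (-A - C * t) - w x t ≤ σ := fun x hx t ht =>
    hmax (show (x, t) ∈ _ from ⟨hx, ht⟩)
  have hσ0 : 0 < σ := hμ.trans_le (hmax' x₀ hx₀ T ⟨hT, le_rfl⟩)
  have hψ0 : ∀ t, 0 ≤ t → -A - C * t ≤ -A := fun t ht => by nlinarith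
  have ht₁0 : 0 < t₁ := by
    rcases ht₁.1.lt_or_eq with h | h
    · exact h
    · exfalso
      have h1 := hinit x₁ hx₁
      have h2 := (abs_le.1 (hA x₁ hx₁ 0 ⟨le_rfl, hT⟩)).1
      rw [← h] at hσ
      nlinarith
  have hlt1 : w x₁ t₁ < u x₁ t₁ := by
    have h2 := (abs_le.1 (hA x₁ hx₁ t₁ ht₁)).1
    nlinarith [hψ0 t₁ ht₁0.le]
  have hlt2 : w x₁ t₁ < μ * u x₁ t₁ := by
    nlinarith [hψ0 t₁ ht₁0.le]
  have hmem₁ : (x₁, t₁) ∈ closure Ω ×ˢ Ici (0 : ℝ) := ⟨hx₁, ht₁0.le⟩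
  have hnear : ∀ᶠ p in 𝓝[closure Ω ×ˢ Ici (0 : ℝ)] (x₁, t₁),
      w p.1 p.2 < u p.1 p.2 ∧ w p.1 p.2 < μ * u p.1 p.2 :=
    ((hwc _ hmem₁).eventually_lt (huc _ hmem₁) hlt1).and
      ((hwc _ hmem₁).eventually_lt (continuousWithinAt_const.mul (huc _ hmem₁)) hlt2)
  obtain ⟨δ, hδ, hnear⟩ := Metric.mem_nhdsWithin_iff.1 hnear
  obtain ⟨ν, r, c, hν⟩ := hΩ2.exists_isInnerDirection hΩo hx₁
  obtain ⟨ρ, hρ0, hρ1, hρt, hρδ, hρr⟩ : ∃ ρ > 0, ρ ≤ 1 ∧ ρ ≤ t₁ / 2 ∧ ρ < δ ∧ ρ < r := by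
    refine ⟨min (min 1 (t₁ / 2)) (min (δ / 2) (r / 2)), ?_, ?_, ?_, ?_, ?_⟩
    · have := hν.1
      positivity
    · exact (min_le_left _ _).trans (min_le_left _ _)
    · exact (min_le_left _ _).trans (min_le_right _ _)
    · exact ((min_le_right _ _).trans (min_le_left _ _)).trans_lt (by linarith)
    · exact ((min_le_right _ _).trans (min_le_right _ _)).trans_lt (by linarith [hν.1])
  set κ : ℝ := 1 / (2 * N + 3) with hκ
  have hN : (0 : ℝ) ≤ N := Nat.cast_nonneg N
  have hκ0 : 0 < κ := by positivity
  have hκ1 : κ * (2 * N + 3) ≤ 1 := by rw [hκ]; field_simp; rfl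
  have hκ2 : κ ≤ 1 := by nlinarith [mul_nonneg hκ0.le hN]
  have h1μ : 0 < 1 - μ := by linarith
  set ε := (1 - μ) * (κ * ρ ^ 2) / 4 with hε
  have hρ2 : ρ ^ 2 ≤ ρ := by nlinarith
  have hκρ : κ * ρ ^ 2 ≤ 1 := by nlinarith
  have hε0 : 0 < ε := by positivity
  have hε1 : ε < 1 - μ := by nlinarith
  obtain ⟨v, hv, hvapp⟩ := hu.exists_smooth_approx hΩb huc hf hm hν ht₁0 hε0
  set Ψ : Euc N × ℝ → ℝ := fun p => μ * v p + (1 - μ) * penalty A C κ x₁ t₁ p with hΨ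
  have hΨc : ContDiff ℝ 2 Ψ :=
    (contDiff_const.mul hv).add (contDiff_const.mul (contDiff_penalty A C κ x₁ t₁))
  set Q := (closure Ω ∩ closedBall x₁ ρ) ×ˢ Icc (t₁ - ρ) t₁ with hQ
  have hQc : IsCompact Q :=
    (hΩb.isCompact_closure.inter_right isClosed_closedBall).prod isCompact_Icc
  have hQsub : ∀ p ∈ Q, p.1 ∈ closure Ω ∧ p.2 ∈ Icc 0 T ∧ dist p.1 x₁ < r ∧
      p.2 ∈ Icc (t₁ / 2) t₁ := by
    rintro p ⟨⟨h1, h2⟩, h3, h4⟩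
    exact ⟨h1, ⟨by linarith, h4.trans ht₁.2⟩, lt_of_le_of_lt h2 hρr, by linarith, h4⟩
  have hQmem : (x₁, t₁) ∈ Q := ⟨⟨hx₁, mem_closedBall_self hρ0.le⟩, by linarith, le_rfl⟩
  obtain ⟨⟨x₂, t₂⟩, hmem₂, hmin⟩ := hQc.exists_isMinOn ⟨(x₁, t₁), hQmem⟩
    (f := fun p : Euc N × ℝ => w p.1 p.2 - Ψ p)
    ((hwc.mono fun p hp => ⟨(hQsub p hp).1, (hQsub p hp).2.1.1⟩).sub hΨc.continuous.continuousOn)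
  obtain ⟨hx₂, ht₂, hd₂, ht₂'⟩ := hQsub _ hmem₂
  dsimp only at hx₂ ht₂ hd₂ ht₂'
  obtain ⟨happ, hvsub⟩ := hvapp x₂ hx₂ hd₂ t₂ ht₂'
  have hloc : κ * (‖x₂ - x₁‖ ^ 2 + (t₁ - t₂)) < κ * ρ ^ 2 := by
    have h1 : w x₂ t₂ - Ψ (x₂, t₂) ≤ w x₁ t₁ - Ψ (x₁, t₁) := hmin hQmem
    obtain ⟨-, -, hd, htt⟩ := hQsub _ hQmem
    have h2 := (abs_le.1 (hvapp x₁ hx₁ hd t₁ htt).1).1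
    have h3 := (abs_le.1 happ).2
    have h4 := hmax' x₂ hx₂ t₂ ht₂
    simp only [hΨ, penalty, sub_self, norm_zero] at h1
    have h5 : (1 - μ) * (κ * (‖x₂ - x₁‖ ^ 2 + (t₁ - t₂))) ≤ 2 * (μ * ε) := by nlinarith
    have h6 : 2 * (μ * ε) < 4 * ε := by nlinarith
    have h7 : 4 * ε = (1 - μ) * (κ * ρ ^ 2) := by rw [hε]; ring
    exact lt_of_mul_lt_mul_left (h5.trans_lt (h6.trans_eq h7)) h1μ.le
  have hloc' := lt_of_mul_lt_mul_left hloc hκ0.le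
  have hxρ : dist x₂ x₁ < ρ := by
    rw [dist_eq_norm]
    have : ‖x₂ - x₁‖ ^ 2 < ρ ^ 2 := by linarith [ht₂'.2]
    exact lt_of_pow_lt_pow_left₀ 2 hρ0.le this
  have htρ : t₁ - ρ < t₂ := by nlinarith [sq_nonneg ‖x₂ - x₁‖]
  have ht₂0 : 0 < t₂ := by linarith
  have hlmin : IsLocalMinOn (fun p : Euc N × ℝ => w p.1 p.2 - Ψ p) (closure Ω ×ˢ Ioc 0 t₂)
      (x₂, t₂) := by
    have hop : ball x₁ ρ ×ˢ Ioi (t₁ - ρ) ∈ 𝓝 (x₂, t₂) :=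
      (isOpen_ball.prod isOpen_Ioi).mem_nhds ⟨hxρ, htρ⟩
    filter_upwards [mem_nhdsWithin_of_mem_nhds hop, self_mem_nhdsWithin] with p hp1 hp2
    exact hmin ⟨⟨hp2.1, ball_subset_closedBall hp1.1⟩, le_of_lt hp1.2, hp2.2.2.trans ht₂'.2⟩
  have hball : (x₂, t₂) ∈ ball (x₁, t₁) δ := by
    rw [mem_ball, Prod.dist_eq, max_lt_iff, Real.dist_eq, abs_lt]
    dsimp only
    exact ⟨by linarith, by linarith, by linarith [ht₂'.2]⟩
  have hmemK : (x₂, t₂) ∈ closure Ω ×ˢ Ici (0 : ℝ) := ⟨hx₂, ht₂0.le⟩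
  obtain ⟨hn1, hn2⟩ := hnear ⟨hball, hmemK⟩
  dsimp only at hn1 hn2
  rcases hw Ψ hΨc x₂ hx₂ t₂ ht₂0 hlmin with hpar | ⟨hfr, hgw⟩
  · exact absurd hpar (not_le.2 (parOp_convexCombo_penalty_neg hm hlam hv hμ0.le hμ1.le hκ0.le hκ1
      (hxρ.le.trans hρ1) (abs_le.1 (hB x₂ hx₂)).1 hε0.le hε1 hvsub hn2.le))
  · exact absurd (hbd x₂ hfr t₂ ht₂0) (by linarith)

end Comparison

/-! ### The boundary condition for subsolutions -/

section Boundary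

variable {N : ℕ} {Ω : Set (Euc N)} {f g u₀ : Euc N → ℝ} {lam m : ℝ} {u : Euc N → ℝ → ℝ}

theorem IsGlobalParSol.isBackSub (hu : IsGlobalParSol Ω f g u₀ lam m u) :
    IsBackSub Ω f lam m u := fun φ hφ x₀ hx₀ t₀ ht₀ hmax =>
  ((hu.2 t₀ ht₀).1.2.2 φ hφ x₀ t₀ ⟨subset_closure hx₀, ht₀, le_rfl⟩ hmax).1 hx₀

theorem IsGlobalParSol.isBackSuper (hu : IsGlobalParSol Ω f g u₀ lam m u) :
    IsBackSuper Ω f g lam m u := by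
  intro φ hφ x₀ hx₀ t₀ ht₀ hmin
  have h := (hu.2 t₀ ht₀).2.2.2 φ hφ x₀ t₀ ⟨hx₀, ht₀, le_rfl⟩ hmin
  rcases mem_or_frontier_of_mem_closure hx₀ with h1 | h1
  · exact Or.inl (h.1 h1)
  · rcases le_max_iff.1 (h.2 h1) with h2 | h2
    · exact Or.inl h2
    · exact Or.inr ⟨h1, by linarith⟩

theorem IsGlobalParSol.initial (hu : IsGlobalParSol Ω f g u₀ lam m u) {x : Euc N}
    (hx : x ∈ closure Ω) : u x 0 = u₀ x :=
  le_antisymm ((hu.2 1 one_pos).1.2.1 x hx) ((hu.2 1 one_pos).2.2.1 x hx)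

theorem continuous_lapl {φ : Euc N → ℝ} (h : ContDiff ℝ 2 φ) : Continuous (lapl φ) := by
  unfold lapl
  have := h.continuous_iteratedFDeriv (m := 2) le_rfl
  fun_prop

theorem continuous_gradient {φ : Euc N → ℝ} (h : ContDiff ℝ 2 φ) : Continuous (gradient φ) :=
  (InnerProductSpace.toDual ℝ (Euc N)).symm.continuous.comp (h.continuous_fderiv (by norm_num))

theorem exists_gradient_dominates {m : ℝ} (hm : 2 < m) {c : ℝ} (hc : 0 < c) (D P Q : ℝ) :
    ∃ B : ℝ, 0 ≤ B ∧ 0 ≤ B * c - D ∧ P + Q * B < (B * c - D) ^ m := by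
  obtain ⟨y, hy1, hyD, hy⟩ : ∃ y : ℝ, 1 ≤ y ∧ 0 ≤ y + D ∧ P + Q * ((y + D) / c) < y ^ 2 := by
    refine ⟨1 + |D| + |P + Q * (D / c)| + |Q / c|, ?_, ?_, ?_⟩
    · linarith [abs_nonneg D, abs_nonneg (P + Q * (D / c)), abs_nonneg (Q / c)]
    · linarith [neg_abs_le D, abs_nonneg (P + Q * (D / c)), abs_nonneg (Q / c)]
    · set y := 1 + |D| + |P + Q * (D / c)| + |Q / c| with hy
      have e : P + Q * ((y + D) / c) = (P + Q * (D / c)) + Q / c * y := by ring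
      have h1 := le_abs_self (P + Q * (D / c))
      have h2 := le_abs_self (Q / c)
      have hD := abs_nonneg D
      have h3 := abs_nonneg (P + Q * (D / c))
      have h4 := abs_nonneg (Q / c)
      rw [e]
      nlinarith [mul_le_mul_of_nonneg_right h2 (show 0 ≤ y by linarith)]
  have e : (y + D) / c * c - D = y := by field_simp; ring
  refine ⟨(y + D) / c, by positivity, by rw [e]; linarith, ?_⟩
  rw [e]
  refine hy.trans_le ?_
  rw [← Real.rpow_natCast]
  exact Real.rpow_le_rpow_of_exponent_le hy1 (by exact_mod_cast hm.le)

/-- The test function used to rule out boundary layers. -/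
theorem parOp_boundaryTest {ρ : Euc N → ℝ} (hρ : ContDiff ℝ 2 ρ) (A B : ℝ) (x₁ x : Euc N)
    (t₁ t r : ℝ) :
    parOp f lam m (fun p => A * (‖p.1 - x₁‖ ^ 2 + (t₁ - p.2)) - B * ρ p.1) r x t
      = -A - (A * (2 * N) - B * lapl ρ x)
        + ‖A • (2 : ℝ) • (x - x₁) - B • gradient ρ x‖ ^ m + lam * r - f x := by
  have h1 : HasDerivAt (fun s : ℝ => A * (‖x - x₁‖ ^ 2 + (t₁ - s)) - B * ρ x) (-A) t := by
    have := ((((hasDerivAt_const t t₁).fun_sub (hasDerivAt_id t)).const_add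
      (‖x - x₁‖ ^ 2)).const_mul A).sub_const (B * ρ x)
    exact this.congr_deriv (by ring)
  have h2 := (((Jet.norm_sub_sq x₁ x).add (Jet.const (t₁ - t) x)).const_mul A).sub
    ((hρ.contDiffAt (x := x)).jet.const_mul B)
  rw [parOp_eq h1 h2]
  simp

set_option maxHeartbeats 400000 in
theorem IsGlobalParSol.le_boundary (hu : IsGlobalParSol Ω f g u₀ lam m u)
    (hΩb : Bornology.IsBounded Ω) (hΩ2 : HasC2Boundary Ω) (hm : 2 < m)
    (hf : ContinuousOn f (closure Ω)) (hg : ContinuousOn g (frontier Ω)) :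
    ∀ x ∈ frontier Ω, ∀ t, 0 < t → u x t ≤ g x := by
  intro x₁ hx₁ t₁ ht₁
  by_contra! hlt
  obtain ⟨ρ, hρ, hρΩ, hρfr, hρgrad⟩ := hΩ2
  have hx₁K : x₁ ∈ closure Ω := frontier_subset_closure hx₁
  have hgr := norm_pos_iff.2 (hρgrad x₁ hx₁)
  have hρK : ∀ x ∈ closure Ω, ρ x ≤ 0 := by
    intro x hx
    rcases mem_or_frontier_of_mem_closure hx with h | h
    · rw [hρΩ] at h; exact le_of_lt h
    · rw [hρfr] at h; exact le_of_eq h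
  have hρ₁ : ρ x₁ = 0 := by rw [hρfr] at hx₁; exact hx₁
  obtain ⟨δ₁, hδ₁, hgrad⟩ := Metric.eventually_nhds_iff_ball.1
    ((continuous_gradient hρ).norm.tendsto x₁ |>.eventually (lt_mem_nhds (half_lt_self hgr)))
  have hcont : ContinuousOn (fun p : Euc N × ℝ => u p.1 p.2 - g p.1)
      (frontier Ω ×ˢ Ici 0) :=
    (hu.1.mono (prod_mono_left frontier_subset_closure)).sub
      (hg.comp continuousOn_fst fun p hp => hp.1)
  have hev := (hcont (x₁, t₁) ⟨hx₁, ht₁.le⟩).eventually (lt_mem_nhds (sub_pos.2 hlt))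
  obtain ⟨δ₂, hδ₂, hug⟩ := Metric.mem_nhdsWithin_iff.1 hev
  obtain ⟨r, hr0, hr1, hrt, hrδ₁, hrδ₂⟩ : ∃ r > 0, r ≤ 1 ∧ r ≤ t₁ / 2 ∧ r ≤ δ₁ ∧ r ≤ δ₂ :=
    ⟨min (min 1 (t₁ / 2)) (min δ₁ δ₂), by positivity,
      (min_le_left _ _).trans (min_le_left _ _), (min_le_left _ _).trans (min_le_right _ _),
      (min_le_right _ _).trans (min_le_left _ _), (min_le_right _ _).trans (min_le_right _ _)⟩
  obtain ⟨M, hM0, hM⟩ := exists_abs_le_of_continuousOn hΩb hu.1 t₁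
  obtain ⟨Bf, hBf⟩ := hΩb.isCompact_closure.exists_bound_of_continuousOn hf
  obtain ⟨Cρ, hCρ⟩ := hΩb.isCompact_closure.exists_bound_of_continuousOn
    (continuous_lapl hρ).continuousOn
  have hr2 : r ^ 2 ≤ r := by nlinarith
  set A := (2 * M + 1) / r ^ 2 with hA
  have hA0 : 0 ≤ A := by positivity
  have hAr : A * r ^ 2 = 2 * M + 1 := by rw [hA]; field_simp
  obtain ⟨B, hB0, hBc, hB⟩ := exists_gradient_dominates hm (half_pos hgr) (2 * A)
    (A + A * (2 * N) + |lam| * M + Bf) Cρ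
  set φ : Euc N × ℝ → ℝ := fun p => A * (‖p.1 - x₁‖ ^ 2 + (t₁ - p.2)) - B * ρ p.1 with hφ
  have hφc : ContDiff ℝ 2 φ := by
    have h : ContDiff ℝ 2 fun p : Euc N × ℝ => ‖p.1 - x₁‖ ^ 2 :=
      (contDiff_norm_sq ℝ).comp (contDiff_fst.sub contDiff_const)
    have h' : ContDiff ℝ 2 fun p : Euc N × ℝ => ρ p.1 := hρ.comp contDiff_fst
    fun_prop
  set Q := (closure Ω ∩ closedBall x₁ r) ×ˢ Icc (t₁ - r) t₁ with hQ
  have hQc : IsCompact Q :=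
    (hΩb.isCompact_closure.inter_right isClosed_closedBall).prod isCompact_Icc
  have hQmem : (x₁, t₁) ∈ Q := ⟨⟨hx₁K, mem_closedBall_self hr0.le⟩, by linarith, le_rfl⟩
  have hQsub : Q ⊆ closure Ω ×ˢ Ici 0 := by
    rintro p ⟨h1, h2, -⟩
    exact ⟨h1.1, show 0 ≤ p.2 by linarith⟩
  obtain ⟨⟨x₂, t₂⟩, hmem₂, hmax⟩ := hQc.exists_isMaxOn ⟨(x₁, t₁), hQmem⟩
    (f := fun p : Euc N × ℝ => u p.1 p.2 - φ p)
    ((hu.1.mono hQsub).sub hφc.continuous.continuousOn)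
  obtain ⟨⟨hx₂, -⟩, ht₂a, ht₂b⟩ := hmem₂
  dsimp only at hx₂ ht₂a ht₂b
  have h12 : u x₁ t₁ - φ (x₁, t₁) ≤ u x₂ t₂ - φ (x₂, t₂) := hmax hQmem
  have hM₁ := abs_le.1 (hM x₁ hx₁K t₁ ⟨ht₁.le, le_rfl⟩)
  have hM₂' := hM x₂ hx₂ t₂ ⟨by linarith, ht₂b⟩
  have hM₂ := abs_le.1 hM₂'
  have hloc : ‖x₂ - x₁‖ ^ 2 + (t₁ - t₂) < r ^ 2 := by
    simp only [hφ, hρ₁, sub_self, norm_zero] at h12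
    have := mul_nonneg hB0 (neg_nonneg.2 (hρK x₂ hx₂))
    by_contra! hcon
    have := mul_le_mul_of_nonneg_left hcon hA0
    nlinarith
  have hxr : dist x₂ x₁ < r := by
    rw [dist_eq_norm]
    exact lt_of_pow_lt_pow_left₀ 2 hr0.le (by linarith)
  have htr : t₁ - r < t₂ := by nlinarith [sq_nonneg ‖x₂ - x₁‖]
  have ht₂0 : 0 < t₂ := by linarith
  have hlmax : IsLocalMaxOn (fun p : Euc N × ℝ => u p.1 p.2 - φ p) (closure Ω ×ˢ Ioc 0 t₂)
      (x₂, t₂) := by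
    have hop : ball x₁ r ×ˢ Ioi (t₁ - r) ∈ 𝓝 (x₂, t₂) :=
      (isOpen_ball.prod isOpen_Ioi).mem_nhds ⟨hxr, htr⟩
    filter_upwards [mem_nhdsWithin_of_mem_nhds hop, self_mem_nhdsWithin] with p hp1 hp2
    exact hmax ⟨⟨hp2.1, ball_subset_closedBall hp1.1⟩, le_of_lt hp1.2, hp2.2.2.trans ht₂b⟩
  have hpar : parOp f lam m φ (u x₂ t₂) x₂ t₂ ≤ 0 := by
    have h := (hu.2 t₂ ht₂0).1.2.2 φ hφc x₂ t₂ ⟨hx₂, ht₂0, le_rfl⟩ hlmax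
    rcases mem_or_frontier_of_mem_closure hx₂ with h1 | h1
    · exact h.1 h1
    · rcases min_le_iff.1 (h.2 h1) with h2 | h2
      · exact h2
      · exfalso
        have hb : (x₂, t₂) ∈ ball (x₁, t₁) δ₂ := by
          rw [mem_ball, Prod.dist_eq, max_lt_iff, Real.dist_eq, abs_lt]
          dsimp only
          exact ⟨by linarith, by linarith, by linarith⟩
        have hm2 : (x₂, t₂) ∈ frontier Ω ×ˢ Ici (0 : ℝ) := ⟨h1, ht₂0.le⟩
        exact absurd h2 (not_le.2 (hug ⟨hb, hm2⟩))
  rw [hφ, parOp_boundaryTest hρ] at hpar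
  have hgx := hgrad x₂ (hxr.trans_le hrδ₁)
  have hn : B * (‖gradient ρ x₁‖ / 2) - 2 * A ≤
      ‖A • (2 : ℝ) • (x₂ - x₁) - B • gradient ρ x₂‖ := by
    have h1 := norm_sub_norm_le (B • gradient ρ x₂) (A • (2 : ℝ) • (x₂ - x₁))
    rw [norm_sub_rev, norm_smul, norm_smul, norm_smul, Real.norm_of_nonneg hB0,
      Real.norm_of_nonneg hA0, ← dist_eq_norm] at h1
    norm_num at h1
    have h2 := mul_le_mul_of_nonneg_left hgx.le hB0
    have h3 := mul_le_mul_of_nonneg_left (hxr.le.trans hr1) hA0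
    linarith
  have hpow := Real.rpow_le_rpow hBc hn (by linarith : 0 ≤ m)
  have hlu : -(|lam| * M) ≤ lam * u x₂ t₂ := by
    have : |lam * u x₂ t₂| ≤ |lam| * M := by
      rw [abs_mul]; exact mul_le_mul_of_nonneg_left hM₂' (abs_nonneg _)
    exact (abs_le.1 this).1
  have hfb := (abs_le.1 (hBf x₂ hx₂)).2
  have hlap := mul_le_mul_of_nonneg_left (abs_le.1 (hCρ x₂ hx₂)).1 hB0
  nlinarith

end Boundary

/-! ### Lipschitz regularity in time -/

section Time

variable {N : ℕ} {Ω : Set (Euc N)} {f g u₀ : Euc N → ℝ} {lam m : ℝ} {u w : Euc N → ℝ → ℝ}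

theorem norm_gradient_eq (φ : Euc N → ℝ) (x : Euc N) : ‖gradient φ x‖ = ‖fderiv ℝ φ x‖ := by
  simp [gradient]

theorem abs_lapl_le (φ : Euc N → ℝ) (x : Euc N) :
    |lapl φ x| ≤ N * ‖iteratedFDeriv ℝ 2 φ x‖ := by
  unfold lapl
  refine (Finset.abs_sum_le_sum_abs _ _).trans ?_
  calc _ ≤ ∑ _i : Fin N, ‖iteratedFDeriv ℝ 2 φ x‖ := by
        refine Finset.sum_le_sum fun i _ => ?_
        have := (iteratedFDeriv ℝ 2 φ x).le_opNorm
          ![EuclideanSpace.single i 1, EuclideanSpace.single i 1]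
        simpa [Fin.prod_univ_two] using this
    _ = _ := by simp

theorem exists_derivs_bound_near (hΩo : IsOpen Ω) {φ : Euc N → ℝ} {x : Euc N}
    (h : ContDiffWithinAt ℝ 2 φ (closure Ω) x) (hx : x ∈ closure Ω) :
    ∃ s ∈ 𝓝[closure Ω] x, ∃ D, ∀ y ∈ s, y ∈ Ω →
      ContDiffAt ℝ 2 φ y ∧ ‖gradient φ y‖ ≤ D ∧ |lapl φ y| ≤ D := by
  obtain ⟨v, hv, p, hp⟩ := (contDiffWithinAt_nat (n := 2)).1 h
  rw [insert_eq_of_mem hx] at hv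
  have hxv : x ∈ v := mem_of_mem_nhdsWithin hx hv
  obtain ⟨O, hO, hxO, hOv⟩ := mem_nhdsWithin.1 hv
  have hbd : ∀ k : ℕ, k ≤ 2 → ∀ᶠ y in 𝓝[closure Ω] x, ‖p y k‖ < ‖p x k‖ + 1 := by
    intro k hk
    have h1 := (hp.cont k (by exact_mod_cast hk)).norm x hxv
    exact (h1.mono_of_mem_nhdsWithin hv).eventually (gt_mem_nhds (by simp))
  refine ⟨_, inter_mem (inter_mem (hbd 1 one_le_two) (hbd 2 le_rfl))
    (mem_nhdsWithin_of_mem_nhds (hO.mem_nhds hxO)), (‖p x 1‖ + 1) + N * (‖p x 2‖ + 1), ?_⟩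
  rintro y ⟨⟨hy1, hy2⟩, hyO⟩ hyΩ
  have hop : IsOpen (O ∩ Ω) := hO.inter hΩo
  have hyo : y ∈ O ∩ Ω := ⟨hyO, hyΩ⟩
  have hp' := hp.mono (s := v) (t := O ∩ Ω) fun z hz => hOv ⟨hz.1, subset_closure hz.2⟩
  have heq : ∀ k : ℕ, k ≤ 2 → p y k = iteratedFDeriv ℝ k φ y := fun k hk => by
    rw [hp'.eq_iteratedFDerivWithin_of_uniqueDiffOn (by exact_mod_cast hk) hop.uniqueDiffOn hyo,
      iteratedFDerivWithin_of_isOpen k hop hyo]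
  change ‖p y 1‖ < _ at hy1
  change ‖p y 2‖ < _ at hy2
  rw [heq 1 one_le_two, norm_iteratedFDeriv_one] at hy1
  rw [heq 2 le_rfl] at hy2
  have hN : (0 : ℝ) ≤ N := Nat.cast_nonneg N
  refine ⟨hp'.contDiffOn.contDiffAt (hop.mem_nhds hyo), ?_, ?_⟩
  · rw [norm_gradient_eq]
    nlinarith [norm_nonneg (p x 2)]
  · refine (abs_lapl_le φ y).trans ?_
    nlinarith [norm_nonneg (p x 1)]

theorem exists_derivs_bound (hΩo : IsOpen Ω) (hΩb : Bornology.IsBounded Ω) {φ : Euc N → ℝ}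
    (h : ContDiffOn ℝ 2 φ (closure Ω)) :
    ∃ D, 0 ≤ D ∧ ∀ y ∈ Ω, ContDiffAt ℝ 2 φ y ∧ ‖gradient φ y‖ ≤ D ∧ |lapl φ y| ≤ D := by
  have key : ∃ D, ∀ y ∈ closure Ω, y ∈ Ω →
      ContDiffAt ℝ 2 φ y ∧ ‖gradient φ y‖ ≤ D ∧ |lapl φ y| ≤ D := by
    refine hΩb.isCompact_closure.induction_on
      (p := fun s => ∃ D, ∀ y ∈ s, y ∈ Ω →
        ContDiffAt ℝ 2 φ y ∧ ‖gradient φ y‖ ≤ D ∧ |lapl φ y| ≤ D) ⟨0, by simp⟩ ?_ ?_ ?_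
    · rintro s t hst ⟨D, hD⟩
      exact ⟨D, fun y hy => hD y (hst hy)⟩
    · rintro s t ⟨D, hD⟩ ⟨D', hD'⟩
      refine ⟨max D D', ?_⟩
      rintro y (hy | hy) hyΩ
      · obtain ⟨h1, h2, h3⟩ := hD y hy hyΩ
        exact ⟨h1, h2.trans (le_max_left _ _), h3.trans (le_max_left _ _)⟩
      · obtain ⟨h1, h2, h3⟩ := hD' y hy hyΩ
        exact ⟨h1, h2.trans (le_max_right _ _), h3.trans (le_max_right _ _)⟩
    · intro x hx
      exact exists_derivs_bound_near hΩo (h x hx) hx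
  obtain ⟨D, hD⟩ := key
  refine ⟨max D 0, le_max_right _ _, fun y hy => ?_⟩
  obtain ⟨h1, h2, h3⟩ := hD y (subset_closure hy) hy
  exact ⟨h1, h2.trans (le_max_left _ _), h3.trans (le_max_left _ _)⟩

theorem HasDerivAt.nonneg_of_isLocalMaxOn_Ioc {k : ℝ → ℝ} {d t : ℝ} (hk : HasDerivAt k d t)
    (ht : 0 < t) (hmax : IsLocalMaxOn k (Ioc 0 t) t) : 0 ≤ d := by
  have h1 := hk.tendsto_slope.mono_left
    (nhdsWithin_mono t (fun s (hs : s < t) => ne_of_lt hs) : 𝓝[<] t ≤ 𝓝[≠] t)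
  refine ge_of_tendsto h1 ?_
  have h2 : ∀ᶠ s in 𝓝[<] t, k s ≤ k t := by
    have : 𝓝[<] t ≤ 𝓝[Ioc 0 t] t := by
      rw [← nhdsWithin_Ioo_eq_nhdsLT ht]
      exact nhdsWithin_mono t Ioo_subset_Ioc_self
    exact this hmax
  filter_upwards [h2, self_mem_nhdsWithin] with s hs hst
  rw [slope_def_field]
  exact div_nonneg_of_nonpos (by linarith) (by linarith [mem_Iio.1 hst])

/-- Space and time conditions at a maximum of a separated function against a test function. -/
theorem jet_of_isLocalMaxOn_separated (hΩo : IsOpen Ω) {φ : Euc N × ℝ → ℝ}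
    (hφ : ContDiff ℝ 2 φ) {k : Euc N → ℝ} {C t : ℝ} {x : Euc N} (hx : x ∈ Ω) (ht : 0 < t)
    (hk : ContDiffAt ℝ 2 k x)
    (hmax : IsLocalMaxOn (fun p : Euc N × ℝ => k p.1 + C * p.2 - φ p)
      (closure Ω ×ˢ Ioc 0 t) (x, t)) :
    deriv (fun s => φ (x, s)) t ≤ C ∧ gradient (fun y => φ (y, t)) x = gradient k x ∧
      lapl k x ≤ lapl (fun y => φ (y, t)) x := by
  have hφt : HasDerivAt (fun s => φ (x, s)) (deriv (fun s => φ (x, s)) t) t :=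
    ((hφ.comp (contDiff_const.prodMk contDiff_id)).differentiable (by norm_num) t).hasDerivAt
  have hφj : Jet (fun y => φ (y, t)) x _ _ :=
    ContDiffAt.jet (hφ.comp (contDiff_id.prodMk contDiff_const)).contDiffAt
  constructor
  · have h1 : HasDerivAt (fun s => k x + C * s - φ (x, s))
        (C - deriv (fun s => φ (x, s)) t) t := by
      simpa using (((hasDerivAt_id t).const_mul C).const_add (k x)).fun_sub hφt
    have h2 : IsLocalMaxOn (fun s => k x + C * s - φ (x, s)) (Ioc 0 t) t := by
      have hT : Tendsto (fun s : ℝ => (x, s)) (𝓝[Ioc 0 t] t) (𝓝[closure Ω ×ˢ Ioc 0 t] (x, t)) := by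
        refine tendsto_nhdsWithin_iff.2 ⟨?_, ?_⟩
        · exact (Continuous.tendsto (by fun_prop) t).mono_left nhdsWithin_le_nhds
        · filter_upwards [self_mem_nhdsWithin] with s hs
          exact ⟨subset_closure hx, hs⟩
      exact hT.eventually hmax
    linarith [h1.nonneg_of_isLocalMaxOn_Ioc ht h2]
  · have h2 : IsLocalMax (fun y => k y - φ (y, t)) x := by
      have hT : Tendsto (fun y : Euc N => (y, t)) (𝓝 x) (𝓝[closure Ω ×ˢ Ioc 0 t] (x, t)) := by
        refine tendsto_nhdsWithin_iff.2 ⟨?_, ?_⟩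
        · exact Continuous.tendsto (by fun_prop) x
        · filter_upwards [hΩo.mem_nhds hx] with s hs
          exact ⟨subset_closure hs, ht, le_rfl⟩
      filter_upwards [hT.eventually hmax] with y hy
      linarith
    obtain ⟨h3, h4⟩ := hk.jet.eq_and_le_of_isLocalMax hφj h2
    exact ⟨h3.symm, h4⟩

theorem jet_of_isLocalMinOn_separated (hΩo : IsOpen Ω) {φ : Euc N × ℝ → ℝ}
    (hφ : ContDiff ℝ 2 φ) {k : Euc N → ℝ} {C t : ℝ} {x : Euc N} (hx : x ∈ Ω) (ht : 0 < t)
    (hk : ContDiffAt ℝ 2 k x)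
    (hmin : IsLocalMinOn (fun p : Euc N × ℝ => k p.1 + C * p.2 - φ p)
      (closure Ω ×ˢ Ioc 0 t) (x, t)) :
    C ≤ deriv (fun s => φ (x, s)) t ∧ gradient (fun y => φ (y, t)) x = gradient k x ∧
      lapl (fun y => φ (y, t)) x ≤ lapl k x := by
  have hφj : Jet (fun y => φ (y, t)) x _ _ :=
    ContDiffAt.jet (hφ.comp (contDiff_id.prodMk contDiff_const)).contDiffAt
  have h := jet_of_isLocalMaxOn_separated hΩo (φ := fun p => -φ p) hφ.neg (k := fun y => -k y)
    (C := -C) hx ht hk.neg (by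
      filter_upwards [hmin] with p hp
      linarith)
  rw [hφj.neg.grad, hφj.neg.lap, hk.jet.neg.grad, hk.jet.neg.lap, deriv.fun_neg] at h
  exact ⟨by linarith [h.1], neg_inj.1 h.2.1, by linarith [h.2.2]⟩

theorem isBackSub_sub_mul (hΩo : IsOpen Ω) (hlam : 0 ≤ lam) {k : Euc N → ℝ} {C : ℝ} (hC0 : 0 ≤ C)
    (hk : ∀ x ∈ Ω, ContDiffAt ℝ 2 k x)
    (hC : ∀ x ∈ Ω, -lapl k x + ‖gradient k x‖ ^ m + lam * k x - f x ≤ C) :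
    IsBackSub Ω f lam m (fun x t => k x - C * t) := by
  intro φ hφ x hx t ht hmax
  obtain ⟨h1, h2, h3⟩ := jet_of_isLocalMaxOn_separated hΩo hφ (C := -C) hx ht (hk x hx) (by
    filter_upwards [hmax] with p hp
    linarith)
  rw [parOp, h2]
  have := hC x hx
  have h4 : 0 ≤ lam * (C * t) := by positivity
  linarith

theorem isBackSuper_add_mul (hΩo : IsOpen Ω) (hlam : 0 ≤ lam) {k : Euc N → ℝ} {C : ℝ}
    (hC0 : 0 ≤ C) (hk : ∀ x ∈ Ω, ContDiffAt ℝ 2 k x) (hg : ∀ x ∈ frontier Ω, g x ≤ k x)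
    (hC : ∀ x ∈ Ω, -C ≤ -lapl k x + ‖gradient k x‖ ^ m + lam * k x - f x) :
    IsBackSuper Ω f g lam m (fun x t => k x + C * t) := by
  intro φ hφ x hx t ht hmin
  have h4 : 0 ≤ C * t := by positivity
  rcases mem_or_frontier_of_mem_closure hx with hx | hx
  · left
    obtain ⟨h1, h2, h3⟩ := jet_of_isLocalMinOn_separated hΩo hφ hx ht (hk x hx) hmin
    rw [parOp, h2]
    have := hC x hx
    have h5 := mul_nonneg hlam h4
    linarith
  · exact Or.inr ⟨hx, by linarith [hg x hx]⟩

theorem parOp_comp_sub (φ : Euc N × ℝ → ℝ) (r h : ℝ) (x : Euc N) (t : ℝ) :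
    parOp f lam m (fun p => φ (p.1, p.2 - h)) r x (t + h) = parOp f lam m φ r x t := by
  simp only [parOp, add_sub_cancel_right]
  rw [deriv_comp_sub_const (f := fun s => φ (x, s)), add_sub_cancel_right]

theorem tendsto_sub_nhdsWithin {x : Euc N} {t h : ℝ} (ht : 0 < t) :
    Tendsto (fun p : Euc N × ℝ => (p.1, p.2 - h)) (𝓝[closure Ω ×ˢ Ioc 0 (t + h)] (x, t + h))
      (𝓝[closure Ω ×ˢ Ioc 0 t] (x, t)) := by
  refine tendsto_nhdsWithin_iff.2 ⟨?_, ?_⟩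
  · have : Continuous fun p : Euc N × ℝ => (p.1, p.2 - h) := by fun_prop
    simpa using (this.tendsto (x, t + h)).mono_left nhdsWithin_le_nhds
  · have hop : (univ : Set (Euc N)) ×ˢ Ioi h ∈ 𝓝 (x, t + h) :=
      (isOpen_univ.prod isOpen_Ioi).mem_nhds ⟨mem_univ _, by simpa using ht⟩
    filter_upwards [mem_nhdsWithin_of_mem_nhds hop, self_mem_nhdsWithin] with p hp1 hp2
    have := mem_Ioi.1 hp1.2
    exact ⟨hp2.1, by dsimp only; linarith, by dsimp only; linarith [hp2.2.2]⟩

theorem IsBackSub.shift (hu : IsBackSub Ω f lam m u) (hlam : 0 ≤ lam) {h k : ℝ} (hh : 0 ≤ h)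
    (hk : 0 ≤ k) : IsBackSub Ω f lam m (fun x t => u x (t + h) - k) := by
  intro φ hφ x hx t ht hmax
  have h1 := hu (fun p => φ (p.1, p.2 - h))
    (hφ.comp (contDiff_fst.prodMk (contDiff_snd.sub contDiff_const))) x hx (t + h) (by linarith) (by
      filter_upwards [(tendsto_sub_nhdsWithin ht).eventually hmax] with p hp
      simp only [sub_add_cancel, add_sub_cancel_right] at hp ⊢
      linarith)
  rw [parOp_comp_sub] at h1
  unfold parOp at h1 ⊢
  nlinarith [mul_nonneg hlam hk]

theorem IsBackSuper.shift (hw : IsBackSuper Ω f g lam m w) (hlam : 0 ≤ lam) {h k : ℝ}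
    (hh : 0 ≤ h) (hk : 0 ≤ k) : IsBackSuper Ω f g lam m (fun x t => w x (t + h) + k) := by
  intro φ hφ x hx t ht hmin
  have h1 := hw (fun p => φ (p.1, p.2 - h))
    (hφ.comp (contDiff_fst.prodMk (contDiff_snd.sub contDiff_const))) x hx (t + h) (by linarith) (by
      filter_upwards [(tendsto_sub_nhdsWithin ht).eventually hmin] with p hp
      simp only [sub_add_cancel, add_sub_cancel_right] at hp ⊢
      linarith)
  rw [parOp_comp_sub] at h1
  rcases h1 with h1 | h1
  · left
    unfold parOp at h1 ⊢
    nlinarith [mul_nonneg hlam hk]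
  · exact Or.inr ⟨h1.1, by linarith [h1.2]⟩

theorem continuousOn_shift
    (hc : ContinuousOn (fun p : Euc N × ℝ => u p.1 p.2) (closure Ω ×ˢ Ici 0)) {h : ℝ}
    (hh : 0 ≤ h) :
    ContinuousOn (fun p : Euc N × ℝ => u p.1 (p.2 + h)) (closure Ω ×ˢ Ici 0) := by
  refine hc.comp (f := fun p : Euc N × ℝ => (p.1, p.2 + h)) (by fun_prop) fun p hp => ⟨hp.1, ?_⟩
  exact add_nonneg hp.2 hh

theorem IsGlobalParSol.exists_time_lipschitz (hu : IsGlobalParSol Ω f g u₀ lam m u)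
    (hΩo : IsOpen Ω) (hΩb : Bornology.IsBounded Ω) (hΩ2 : HasC2Boundary Ω) (hm : 2 < m)
    (hlam : 0 ≤ lam) (hf : ContinuousOn f (closure Ω)) (hu₀ : ContDiffOn ℝ 2 u₀ (closure Ω))
    (hg : ContinuousOn g (frontier Ω)) (hcomp : ∀ x ∈ frontier Ω, u₀ x = g x) :
    ∃ C > 0, ∀ x ∈ closure Ω, ∀ t, 0 ≤ t → ∀ h, 0 ≤ h → |u x (t + h) - u x t| ≤ C * h := by
  have hm1 : 1 < m := by linarith
  have hsub := hu.isBackSub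
  have hsup := hu.isBackSuper
  have hbd := hu.le_boundary hΩb hΩ2 hm hf hg
  obtain ⟨D, hD0, hD⟩ := exists_derivs_bound hΩo hΩb hu₀
  obtain ⟨B, hB⟩ := hΩb.isCompact_closure.exists_bound_of_continuousOn hf
  obtain ⟨E, hE⟩ := hΩb.isCompact_closure.exists_bound_of_continuousOn hu₀.continuousOn
  set C := 1 + D + D ^ m + lam * |E| + |B| with hC
  have hC0 : 0 < C := by positivity
  have hbound : ∀ x ∈ Ω, |lapl u₀ x| ≤ D ∧ ‖gradient u₀ x‖ ^ m ≤ D ^ m ∧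
      |lam * u₀ x| ≤ lam * |E| ∧ |f x| ≤ |B| := by
    intro x hx
    obtain ⟨-, h2, h3⟩ := hD x hx
    refine ⟨h3, Real.rpow_le_rpow (norm_nonneg _) h2 (by linarith), ?_, ?_⟩
    · rw [abs_mul, abs_of_nonneg hlam]
      exact mul_le_mul_of_nonneg_left ((hE x (subset_closure hx)).trans (le_abs_self E)) hlam
    · exact (hB x (subset_closure hx)).trans (le_abs_self B)
  have hlow := isBackSub_sub_mul (f := f) (m := m) hΩo hlam hC0.le (fun x hx => (hD x hx).1)
    (fun x hx => by
      obtain ⟨h1, h2, h3, h4⟩ := hbound x hx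
      linarith [(abs_le.1 h1).1, (abs_le.1 h3).2, (abs_le.1 h4).1])
  have hupp := isBackSuper_add_mul (f := f) (g := g) (m := m) hΩo hlam hC0.le
    (fun x hx => (hD x hx).1) (fun x hx => (hcomp x hx).ge) (fun x hx => by
      obtain ⟨h1, h2, h3, h4⟩ := hbound x hx
      have h5 : 0 ≤ ‖gradient u₀ x‖ ^ m := by positivity
      have h6 : 0 ≤ D ^ m := by positivity
      linarith [(abs_le.1 h1).2, (abs_le.1 h3).1, (abs_le.1 h4).2])
  have hu₀c : ContinuousOn (fun p : Euc N × ℝ => u₀ p.1) (closure Ω ×ˢ Ici 0) :=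
    hu₀.continuousOn.comp continuousOn_fst fun p hp => hp.1
  have hlin : ContinuousOn (fun p : Euc N × ℝ => C * p.2) (closure Ω ×ˢ Ici 0) := by fun_prop
  have h1 := hlow.le_of_isBackSuper hsup hΩo hΩb hΩ2 hm1 hlam hf (hu₀c.sub hlin) hu.1
    (fun x hx t ht => by rw [← hcomp x hx]; nlinarith)
    (fun x hx => by rw [hu.initial hx]; simp)
  have h2 := hsub.le_of_isBackSuper hupp hΩo hΩb hΩ2 hm1 hlam hf hu.1 (hu₀c.add hlin) hbd
    (fun x hx => by rw [hu.initial hx]; simp)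
  refine ⟨C, hC0, fun x hx t ht h hh => ?_⟩
  have hCh : 0 ≤ C * h := by positivity
  have hsh := continuousOn_shift hu.1 hh
  have h3 := (hsub.shift hlam hh hCh).le_of_isBackSuper hsup hΩo hΩb hΩ2 hm1 hlam hf
    (hsh.sub continuousOn_const) hu.1
    (fun y hy s hs => by linarith [hbd y hy (s + h) (by linarith)])
    (fun y hy => by rw [hu.initial hy, zero_add]; linarith [h2 y hy h hh]) x hx t ht
  have h4 := hsub.le_of_isBackSuper (hsup.shift hlam hh hCh) hΩo hΩb hΩ2 hm1 hlam hf hu.1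
    (hsh.add continuousOn_const) hbd
    (fun y hy => by rw [hu.initial hy, zero_add]; linarith [h1 y hy h hh]) x hx t ht
  rw [abs_le]
  constructor <;> linarith

end Time

/-! ### The stationary inequality at fixed time -/

section Elliptic

variable {N : ℕ} {Ω : Set (Euc N)} {f g u₀ : Euc N → ℝ} {u : Euc N → ℝ → ℝ} {lam m : ℝ}

/-- `v` is a viscosity subsolution of `-Δv + |Dv|^m ≤ C` in `Ω`. -/
def IsEllSub (Ω : Set (Euc N)) (m C : ℝ) (v : Euc N → ℝ) : Prop :=
  ∀ x ∈ Ω, ∀ w p L, Jet w x p L → IsLocalMax (fun y => v y - w y) x → -L + ‖p‖ ^ m ≤ C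

theorem IsGlobalParSol.exists_lower_bound (hu : IsGlobalParSol Ω f g u₀ lam m u)
    (hΩo : IsOpen Ω) (hΩb : Bornology.IsBounded Ω) (hΩ2 : HasC2Boundary Ω) (hm : 2 < m)
    (hlam : 0 ≤ lam) (hf : ContinuousOn f (closure Ω)) (hu₀ : ContinuousOn u₀ (closure Ω))
    (hcomp : ∀ x ∈ frontier Ω, u₀ x = g x) :
    ∃ A, 0 ≤ A ∧ ∀ x ∈ closure Ω, ∀ t, 0 ≤ t → -A ≤ lam * u x t := by
  rcases hlam.eq_or_lt with rfl | hlam'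
  · exact ⟨0, le_rfl, by simp⟩
  obtain ⟨B, hB⟩ := hΩb.isCompact_closure.exists_bound_of_continuousOn hf
  obtain ⟨E, hE⟩ := hΩb.isCompact_closure.exists_bound_of_continuousOn hu₀
  set A := |E| + |B| / lam with hA
  have hA0 : 0 ≤ A := by positivity
  have hEA : ∀ x ∈ closure Ω, -A ≤ u₀ x := fun x hx => by
    have h1 := (abs_le.1 (hE x hx)).1
    have h2 : 0 ≤ |B| / lam := by positivity
    linarith [le_abs_self E]
  have hsub := isBackSub_sub_mul (f := f) (m := m) (k := fun _ => -A) (C := 0) hΩo hlam le_rfl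
    (fun x _ => contDiffAt_const) (fun x hx => by
      rw [(Jet.const (-A) x).grad, (Jet.const (-A) x).lap, norm_zero,
        Real.zero_rpow (by linarith)]
      have h1 := (abs_le.1 (hB x (subset_closure hx))).1
      have h2 : lam * A = lam * |E| + |B| := by
        rw [hA]
        field_simp
      have h3 : 0 ≤ lam * |E| := by positivity
      linarith [le_abs_self B])
  have h := hsub.le_of_isBackSuper hu.isBackSuper hΩo hΩb hΩ2 (by linarith) hlam hf
    (by fun_prop) hu.1
    (fun x hx t _ => by
      rw [← hcomp x hx]
      simpa using hEA x (frontier_subset_closure hx))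
    (fun x hx => by
      rw [hu.initial hx]
      simpa using hEA x hx)
  refine ⟨lam * A, by positivity, fun x hx t ht => ?_⟩
  have := h x hx t ht
  nlinarith

theorem IsGlobalParSol.exists_isEllSub (hu : IsGlobalParSol Ω f g u₀ lam m u)
    (hΩo : IsOpen Ω) (hΩb : Bornology.IsBounded Ω) (hΩ2 : HasC2Boundary Ω) (hm : 2 < m)
    (hlam : 0 ≤ lam) (hf : ContinuousOn f (closure Ω)) (hu₀ : ContinuousOn u₀ (closure Ω))
    (hcomp : ∀ x ∈ frontier Ω, u₀ x = g x) {C : ℝ} (hC0 : 0 ≤ C)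
    (hC : ∀ x ∈ closure Ω, ∀ t, 0 ≤ t → ∀ h, 0 ≤ h → |u x (t + h) - u x t| ≤ C * h) :
    ∃ D, 0 ≤ D ∧ ∀ t, 0 < t → IsEllSub Ω m D (fun x => u x t) := by
  obtain ⟨B, hB⟩ := hΩb.isCompact_closure.exists_bound_of_continuousOn hf
  obtain ⟨A, hA0, hA⟩ := hu.exists_lower_bound hΩo hΩb hΩ2 hm hlam hf hu₀ hcomp
  refine ⟨C + |B| + A, by positivity, fun t ht x hx w p L hw hmax => ?_⟩
  obtain ⟨φ, hφ, hφw⟩ := hw.contDiffAt.exists_contDiff_eventuallyEq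
  have hφj := hw.congr hφw
  have hsub := hu.isBackSub (fun q => φ q.1 + C * (t - q.2))
    ((hφ.comp contDiff_fst).add (contDiff_const.mul (contDiff_const.sub contDiff_snd)))
    x hx t ht (by
      have h1 : ∀ᶠ y in 𝓝 x, u y t - φ y ≤ u x t - φ x := by
        filter_upwards [hmax, hφw] with y hy hy'
        rw [hy', hφw.self_of_nhds]
        exact hy
      have h2 : ∀ᶠ q : Euc N × ℝ in 𝓝 (x, t), u q.1 t - φ q.1 ≤ u x t - φ x :=
        (continuous_fst.tendsto (x, t)).eventually h1
      filter_upwards [mem_nhdsWithin_of_mem_nhds h2, self_mem_nhdsWithin] with q hq hq'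
      have h3 := hC q.1 hq'.1 q.2 hq'.2.1.le (t - q.2) (by linarith [hq'.2.2])
      rw [add_sub_cancel] at h3
      linarith [(abs_le.1 h3).1])
  rw [parOp_eq (τ := -C) (p := p) (L := L) (by
      simpa using (((hasDerivAt_id t).const_sub t).const_mul C).const_add (φ x))
    (by simpa using hφj)] at hsub
  linarith [hA x (subset_closure hx) t ht.le, (abs_le.1 (hB x (subset_closure hx))).2,
    le_abs_self B]

end Elliptic

/-! ### Interior barrier -/

section Barrier

/-- The radial profile `ρ ↦ K (ρ^α + r^(α+1) / (r - ρ) - r^α)` is a strict supersolution. -/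
theorem barrier_ineq {m α n C K r ρ : ℝ} (hm : 2 < m) (hα : α = (m - 2) / (m - 1)) (hn : 0 ≤ n)
    (hC : 0 ≤ C) (hK : K = 3 + n * α ^ (1 - m) + C) (hρ : 0 < ρ) (hρr : ρ < r) (hr : r ≤ 1) :
    K * (α * ((α - 1) * ρ ^ (α - 2)) + 2 * r ^ (α + 1) / (r - ρ) ^ 3) +
      n * (K * (α * ρ ^ (α - 1) + r ^ (α + 1) / (r - ρ) ^ 2)) / ρ + C <
      (K * (α * ρ ^ (α - 1) + r ^ (α + 1) / (r - ρ) ^ 2)) ^ m := by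
  have hm1 : 0 < m - 1 := by linarith
  have hα0 : 0 < α := by rw [hα]; exact div_pos (by linarith) hm1
  have hα1 : (α - 1) * (m - 1) = -1 := by
    rw [hα]
    field_simp
    ring
  have hα2 : α < 1 := by nlinarith
  have hd : 0 < r - ρ := by linarith
  have hr0 : 0 < r := by linarith
  set d := r - ρ with hdd
  set P := α * ρ ^ (α - 1) with hP
  set Q := r ^ (α + 1) / d ^ 2 with hQ
  have hP0 : 0 < P := by positivity
  have hQ0 : 0 < Q := by positivity
  have hK3 : 3 ≤ K := by
    rw [hK]
    have : 0 ≤ n * α ^ (1 - m) := by positivity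
    linarith
  have hQd : d ^ (α - 1) ≤ Q := by
    have h1 : d ^ (α - 1) = d ^ (α + 1) / d ^ 2 := by
      rw [← Real.rpow_natCast d 2, ← Real.rpow_sub hd]
      congr 1
      push_cast
      ring
    rw [h1, hQ]
    gcongr
    linarith
  have hpow : ∀ z : ℝ, 0 < z → (z ^ (α - 1)) ^ (m - 1) = z⁻¹ := fun z hz => by
    rw [← Real.rpow_mul hz.le, hα1, Real.rpow_neg_one]
  have hSm : (P + Q) ^ m = (P + Q) * (P + Q) ^ (m - 1) := by
    rw [← Real.rpow_one_add' (by positivity) (by linarith)]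
    congr 1
    ring
  have hS1 : 1 ≤ P + Q := by
    have : 1 ≤ d ^ (α - 1) :=
      Real.one_le_rpow_of_pos_of_le_one_of_nonpos hd (by linarith) (by linarith)
    linarith
  have hSm1 : 1 ≤ (P + Q) ^ m := Real.one_le_rpow hS1 (by linarith)
  have e1 : 2 * r ^ (α + 1) / d ^ 3 ≤ 2 * (P + Q) ^ m := by
    have h1 : d⁻¹ ≤ (P + Q) ^ (m - 1) := by
      rw [← hpow d hd]
      exact Real.rpow_le_rpow (by positivity) (by linarith) hm1.le
    have h2 : 2 * r ^ (α + 1) / d ^ 3 = 2 * (Q * d⁻¹) := by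
      rw [hQ]
      field_simp
    rw [h2, hSm]
    gcongr
    linarith
  have e2 : (P + Q) / ρ ≤ α ^ (1 - m) * (P + Q) ^ m := by
    have h1 : α ^ (m - 1) * ρ⁻¹ ≤ (P + Q) ^ (m - 1) := by
      rw [← hpow ρ hρ, ← Real.mul_rpow hα0.le (by positivity)]
      exact Real.rpow_le_rpow hP0.le (by linarith) hm1.le
    have h2 : α ^ (1 - m) * α ^ (m - 1) = 1 := by
      rw [← Real.rpow_add hα0]
      simp
    have h3 : 0 < α ^ (1 - m) := by positivity
    calc (P + Q) / ρ = α ^ (1 - m) * ((P + Q) * (α ^ (m - 1) * ρ⁻¹)) := by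
          rw [div_eq_mul_inv]
          linear_combination -(P + Q) * ρ⁻¹ * h2
      _ ≤ α ^ (1 - m) * ((P + Q) * (P + Q) ^ (m - 1)) := by gcongr
      _ = _ := by rw [hSm]
  have e3 : α * ((α - 1) * ρ ^ (α - 2)) ≤ 0 := by
    have : 0 < ρ ^ (α - 2) := by positivity
    have h1 : (α - 1) * ρ ^ (α - 2) ≤ 0 := mul_nonpos_of_nonpos_of_nonneg (by linarith) this.le
    exact mul_nonpos_of_nonneg_of_nonpos hα0.le h1
  have e4 : K * K ≤ K ^ m := by
    have := Real.rpow_le_rpow_of_exponent_le (show 1 ≤ K by linarith) hm.le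
    rwa [Real.rpow_two, sq] at this
  have hK0 : 0 ≤ K := by linarith
  rw [Real.mul_rpow hK0 (by positivity)]
  have hT0 : 0 < (P + Q) ^ m := by linarith
  set T := (P + Q) ^ m with hT
  have e5 : n * (K * (P + Q)) / ρ ≤ n * K * (α ^ (1 - m) * T) := by
    have : n * (K * (P + Q)) / ρ = n * K * ((P + Q) / ρ) := by ring
    rw [this]
    gcongr
  have e6 : K * (α * ((α - 1) * ρ ^ (α - 2)) + 2 * r ^ (α + 1) / d ^ 3) ≤ K * (2 * T) := by
    gcongr
    linarith
  have e7 : K * K * T ≤ K ^ m * T := by gcongr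
  have e8 : K * K * T = K * (2 * T) + n * K * (α ^ (1 - m) * T) + K * (1 + C) * T := by
    rw [hK]
    ring
  have e9 : C < K * (1 + C) * T := by
    have : K * (1 + C) ≤ K * (1 + C) * T := le_mul_of_one_le_right (by positivity) hSm1
    nlinarith
  linarith

variable {N : ℕ}

theorem Jet.norm_sub {x y : Euc N} (h : x ≠ y) :
    Jet (fun z => ‖z - y‖) x (‖x - y‖⁻¹ • (x - y)) ((N - 1) / ‖x - y‖) := by
  have hρ : 0 < ‖x - y‖ := norm_pos_iff.2 (sub_ne_zero.2 h)
  have hq : ‖x - y‖ ^ 2 ≠ 0 := by positivity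
  have hj := (Jet.norm_sub_sq y x).comp (θ := fun s => √s) (θ' := fun s => 1 / (2 * √s))
    (a := 1 / (2 * ‖x - y‖)) (b := -1 / (4 * ‖x - y‖ ^ 3)) (Real.contDiffAt_sqrt hq)
    (by
      filter_upwards [isOpen_ne.mem_nhds hq] with s hs
      exact Real.hasDerivAt_sqrt hs)
    (by rw [Real.sqrt_sq hρ.le])
    (by
      have h1 := (hasDerivAt_const (‖x - y‖ ^ 2) (1 : ℝ)).fun_div
        ((Real.hasDerivAt_sqrt hq).const_mul 2) (by positivity)
      refine h1.congr_deriv ?_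
      rw [Real.sqrt_sq hρ.le]
      field_simp
      ring)
  have e1 : (fun z => √(‖z - y‖ ^ 2)) = fun z => ‖z - y‖ := by
    ext z
    exact Real.sqrt_sq (norm_nonneg _)
  rw [e1] at hj
  convert hj using 1
  · rw [smul_smul]
    congr 1
    field_simp
  · rw [norm_smul]
    norm_num
    field_simp
    ring

/-- Local Hölder estimate at interior points for subsolutions of the stationary inequality. -/
theorem IsEllSub.sub_le {Ω : Set (Euc N)} {m α C K r : ℝ} {v : Euc N → ℝ}
    (hv : IsEllSub Ω m C v) (hN : 1 ≤ N) (hm : 2 < m) (hα : α = (m - 2) / (m - 1)) (hC : 0 ≤ C)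
    (hK : K = 3 + (N - 1) * α ^ (1 - m) + C) {y : Euc N} (hr0 : 0 < r) (hr : r ≤ 1)
    (hball : closedBall y r ⊆ Ω) (hvc : ContinuousOn v Ω) {x : Euc N} (hx : ‖x - y‖ ≤ r / 2) :
    v x - v y ≤ 3 * K * ‖x - y‖ ^ α := by
  have hm1 : 0 < m - 1 := by linarith
  have hα0 : 0 < α := by rw [hα]; exact div_pos (by linarith) hm1
  have hα1 : α < 1 := by rw [hα, div_lt_one hm1]; linarith
  have hn : (0 : ℝ) ≤ N - 1 := by
    have : (1 : ℝ) ≤ N := by exact_mod_cast hN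
    linarith
  have hK0 : 0 < K := by rw [hK]; positivity
  set R := r ^ (α + 1) with hR
  have hR0 : 0 < R := by positivity
  have hRr : R / r = r ^ α := by
    rw [hR, Real.rpow_add_one hr0.ne']
    field_simp
  set W : ℝ → ℝ := fun ρ => K * (ρ ^ α + R / (r - ρ)) with hW
  have hW0 : W 0 = K * (R / r) := by simp [hW, Real.zero_rpow hα0.ne']
  obtain ⟨M, hM⟩ := (isCompact_closedBall y r).exists_bound_of_continuousOn (hvc.mono hball)
  have hM0 : 0 ≤ M := (norm_nonneg _).trans (hM y (mem_closedBall_self hr0.le))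
  -- a radius near `r` where the barrier exceeds the oscillation of `v`
  obtain ⟨r', hr'1, hr'2, hr'3⟩ : ∃ r', r / 2 ≤ r' ∧ r' < r ∧ 2 * M + W 0 ≤ K * (R / (r - r')) := by
    have hden : 0 < 2 * M + W 0 := by rw [hW0]; positivity
    refine ⟨max (r / 2) (r - K * R / (2 * M + W 0)), le_max_left _ _, max_lt (by linarith) ?_, ?_⟩
    · have : 0 < K * R / (2 * M + W 0) := by positivity
      linarith
    · have h1 : r - max (r / 2) (r - K * R / (2 * M + W 0)) ≤ K * R / (2 * M + W 0) := by
        linarith [le_max_right (r / 2) (r - K * R / (2 * M + W 0))]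
      have h2 : 0 < r - max (r / 2) (r - K * R / (2 * M + W 0)) := by
        have : 0 < K * R / (2 * M + W 0) := by positivity
        have := max_lt (show r / 2 < r by linarith)
          (show r - K * R / (2 * M + W 0) < r by linarith)
        linarith
      rw [← mul_div_assoc, le_div_iff₀ h2]
      calc _ ≤ (2 * M + W 0) * (K * R / (2 * M + W 0)) := by gcongr
        _ = K * R := by field_simp
  have hsub : closedBall y r' ⊆ closedBall y r := closedBall_subset_closedBall hr'2.le
  have hWc : ContinuousOn (fun z => W ‖z - y‖) (closedBall y r') := by
    have h1 : ContinuousOn W (Icc 0 r') := by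
      refine continuousOn_const.mul ((continuousOn_id.rpow_const fun _ _ => Or.inr hα0.le).add
        (continuousOn_const.div (by fun_prop) fun s hs => ?_))
      have := hs.2
      exact ne_of_gt (by linarith)
    refine h1.comp (by fun_prop) fun z hz => ⟨norm_nonneg _, ?_⟩
    simpa [dist_eq_norm] using hz
  obtain ⟨x₀, hx₀, hmax⟩ := (isCompact_closedBall y r').exists_isMaxOn
    ⟨y, mem_closedBall_self (by linarith)⟩ ((hvc.mono (hsub.trans hball)).sub hWc)
  have hρ' : ‖x₀ - y‖ ≤ r' := by simpa [dist_eq_norm] using hx₀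
  have key : v x₀ - W ‖x₀ - y‖ ≤ v y - W 0 := by
    by_contra! hlt
    have hne : x₀ ≠ y := by
      rintro rfl
      simp at hlt
    have hρ0 : 0 < ‖x₀ - y‖ := norm_pos_iff.2 (sub_ne_zero.2 hne)
    have hρ1 : ‖x₀ - y‖ < r' := by
      refine lt_of_le_of_ne hρ' fun h => ?_
      rw [h] at hlt
      have h1 := (abs_le.1 (hM x₀ (hsub hx₀))).2
      have h2 := (abs_le.1 (hM y (mem_closedBall_self hr0.le))).1
      have h3 : K * (R / (r - r')) ≤ W r' := by
        have : 0 ≤ r' ^ α := by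
          have : 0 ≤ r' := by linarith
          positivity
        rw [hW]
        dsimp only
        gcongr
        linarith
      linarith
    have hd : 0 < r - ‖x₀ - y‖ := by linarith
    have hloc : IsLocalMax (fun z => v z - W ‖z - y‖) x₀ := by
      refine hmax.isLocalMax (mem_of_superset (isOpen_ball.mem_nhds ?_) ball_subset_closedBall)
      simpa [dist_eq_norm] using hρ1
    have hj := (Jet.norm_sub hne).comp (θ := W)
      (θ' := fun ρ => K * (α * ρ ^ (α - 1) + R / (r - ρ) ^ 2)) (a := _)
      (b := K * (α * ((α - 1) * ‖x₀ - y‖ ^ (α - 2)) + 2 * R / (r - ‖x₀ - y‖) ^ 3))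
      (by
        refine contDiffAt_const.mul ((Real.contDiffAt_rpow_const (n := 2) (Or.inl hρ0.ne')).add
          (contDiffAt_const.div (contDiffAt_const.sub contDiffAt_id) hd.ne'))) (by
        filter_upwards [isOpen_Ioo.mem_nhds (show ‖x₀ - y‖ ∈ Ioo 0 r from ⟨hρ0, by linarith⟩)]
          with s hs
        have hs1 : r - s ≠ 0 := by linarith [hs.2]
        have h1 : HasDerivAt (fun s : ℝ => R / (r - s)) (R / (r - s) ^ 2) s := by
          have := (hasDerivAt_const s R).fun_div ((hasDerivAt_id s).const_sub r) hs1
          simpa using this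
        exact ((Real.hasDerivAt_rpow_const (Or.inl hs.1.ne')).fun_add h1).const_mul K) rfl (by
        have h1 : HasDerivAt (fun s : ℝ => R / (r - s) ^ 2) (2 * R / (r - ‖x₀ - y‖) ^ 3)
            ‖x₀ - y‖ := by
          have := (hasDerivAt_const ‖x₀ - y‖ R).fun_div
            (((hasDerivAt_id ‖x₀ - y‖).const_sub r).fun_pow 2) (by positivity)
          refine this.congr_deriv ?_
          simp only [id]
          field_simp
          ring
        have h2 := (Real.hasDerivAt_rpow_const (p := α - 1) (Or.inl hρ0.ne')).const_mul α
        rw [show α - 1 - 1 = α - 2 by ring] at h2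
        exact (h2.fun_add h1).const_mul K)
    have h1 := hv x₀ (hball (hsub hx₀)) _ _ _ hj hloc
    have h2 := barrier_ineq hm hα hn hC hK hρ0 (show ‖x₀ - y‖ < r by linarith) hr
    have h3 : ‖‖x₀ - y‖⁻¹ • (x₀ - y)‖ = 1 := by
      rw [norm_smul, norm_inv, norm_norm, inv_mul_cancel₀ hρ0.ne']
    rw [norm_smul (K * _), h3, Real.norm_of_nonneg (by positivity)] at h1
    simp only [mul_one, one_pow] at h1
    rw [← hR] at h2
    have h4 : (K * (α * ‖x₀ - y‖ ^ (α - 1) + R / (r - ‖x₀ - y‖) ^ 2)) *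
        ((N - 1) / ‖x₀ - y‖) = (N - 1) *
        (K * (α * ‖x₀ - y‖ ^ (α - 1) + R / (r - ‖x₀ - y‖) ^ 2)) / ‖x₀ - y‖ := by ring
    linarith
  have hxb : x ∈ closedBall y r' := by
    rw [mem_closedBall, dist_eq_norm]
    linarith
  have hfin : v x - W ‖x - y‖ ≤ v x₀ - W ‖x₀ - y‖ := hmax hxb
  set ρ := ‖x - y‖ with hρ
  have hρ0 : 0 ≤ ρ := norm_nonneg _
  have hd : r / 2 ≤ r - ρ := by linarith
  have h1 : R / (r - ρ) - R / r ≤ 2 * ρ ^ α := by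
    have e1 : R / (r - ρ) - R / r = r ^ α * (ρ / (r - ρ)) := by
      rw [← hRr]
      have : r - ρ ≠ 0 := by linarith
      field_simp
      ring
    have e2 : ρ / (r - ρ) ≤ 2 * (ρ / r) := by
      rw [div_le_iff₀ (by linarith)]
      have : 2 * (ρ / r) * (r - ρ) ≥ 2 * (ρ / r) * (r / 2) := by gcongr
      have e : 2 * (ρ / r) * (r / 2) = ρ := by field_simp
      linarith
    have e3 : ρ / r ≤ (ρ / r) ^ α :=
      Real.self_le_rpow_of_le_one (by positivity) ((div_le_one hr0).2 (by linarith)) hα1.le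
    rw [Real.div_rpow hρ0 hr0.le] at e3
    rw [e1]
    calc r ^ α * (ρ / (r - ρ)) ≤ r ^ α * (2 * (ρ ^ α / r ^ α)) := by
          gcongr
          linarith
      _ = 2 * ρ ^ α := by
          have : r ^ α ≠ 0 := by positivity
          field_simp
  have h2 : W ρ - W 0 = K * (ρ ^ α + (R / (r - ρ) - R / r)) := by
    rw [hW0, hW]
    ring
  have h3 : K * (ρ ^ α + (R / (r - ρ) - R / r)) ≤ K * (ρ ^ α + 2 * ρ ^ α) := by gcongr
  linarith

end Barrier

/-! ### Hölder estimates up to the boundary -/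

section Hoelder

variable {N : ℕ} {Ω : Set (Euc N)} {m α C K : ℝ} {v : Euc N → ℝ}

theorem IsEllSub.abs_sub_le (hv : IsEllSub Ω m C v) (hN : 1 ≤ N) (hm : 2 < m)
    (hα : α = (m - 2) / (m - 1)) (hC : 0 ≤ C) (hK : K = 3 + (N - 1) * α ^ (1 - m) + C)
    {y : Euc N} {r : ℝ} (hr0 : 0 < r) (hr : r ≤ 1) (hball : closedBall y r ⊆ Ω)
    (hvc : ContinuousOn v Ω) {x : Euc N} (hx : ‖x - y‖ ≤ r / 4) :
    |v x - v y| ≤ 3 * K * ‖x - y‖ ^ α := by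
  have h1 := hv.sub_le hN hm hα hC hK hr0 hr hball hvc (x := x) (by linarith)
  have h2 := hv.sub_le hN hm hα hC hK (y := x) (r := r / 2) (x := y) (by linarith) (by linarith)
    ((closedBall_subset_closedBall' (by rw [dist_eq_norm]; linarith)).trans hball) hvc
    (by rw [norm_sub_rev]; linarith)
  rw [norm_sub_rev] at h2
  exact abs_le.2 ⟨by linarith, h1⟩

/-- Summation of a geometric sequence of increments. -/
theorem abs_sub_le_of_geometric {F : ℝ → ℝ} {θ B s : ℝ} (hθ0 : 0 < θ) (hθ1 : θ < 1)
    (hα : 0 < α) (hs : 0 < s) (hF : ContinuousWithinAt F (Ioi 0) 0)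
    (h : ∀ σ, 0 < σ → σ ≤ s → |F σ - F (θ * σ)| ≤ B * (1 - θ ^ α) * σ ^ α) :
    |F s - F 0| ≤ B * s ^ α := by
  have hθα : θ ^ α < 1 := Real.rpow_lt_one hθ0.le hθ1 hα
  have hsα : 0 < s ^ α := by positivity
  have hB : 0 ≤ B := by
    have h1 := (abs_nonneg _).trans (h s hs le_rfl)
    by_contra! hlt
    have : B * (1 - θ ^ α) * s ^ α < 0 :=
      mul_neg_of_neg_of_pos (mul_neg_of_neg_of_pos hlt (by linarith)) hsα
    linarith
  have hn : ∀ n : ℕ, |F s - F (θ ^ n * s)| ≤ B * (1 - (θ ^ α) ^ n) * s ^ α := by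
    intro n
    induction n with
    | zero => simp
    | succ k ih =>
      have h1 := h (θ ^ k * s) (by positivity)
        (mul_le_of_le_one_left hs.le (pow_le_one₀ hθ0.le hθ1.le))
      have e : (θ ^ k * s) ^ α = (θ ^ α) ^ k * s ^ α := by
        rw [Real.mul_rpow (by positivity) hs.le, ← Real.rpow_natCast, ← Real.rpow_natCast,
          ← Real.rpow_mul hθ0.le, ← Real.rpow_mul hθ0.le, mul_comm (k : ℝ)]
      rw [e, ← mul_assoc, ← pow_succ'] at h1
      have h2 := abs_sub_le (F s) (F (θ ^ k * s)) (F (θ ^ (k + 1) * s))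
      have e2 : B * (1 - (θ ^ α) ^ k) * s ^ α + B * (1 - θ ^ α) * ((θ ^ α) ^ k * s ^ α) =
          B * (1 - (θ ^ α) ^ (k + 1)) * s ^ α := by ring
      linarith
  have hlim : Tendsto (fun n : ℕ => θ ^ n * s) atTop (𝓝[>] 0) := by
    refine tendsto_nhdsWithin_iff.2 ⟨?_, Eventually.of_forall fun n => ?_⟩
    · simpa using (tendsto_pow_atTop_nhds_zero_of_lt_one hθ0.le hθ1).mul_const s
    · exact mem_Ioi.2 (by positivity)
  have hlim2 : Tendsto (fun n : ℕ => |F s - F (θ ^ n * s)|) atTop (𝓝 |F s - F 0|) :=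
    (tendsto_const_nhds.sub (hF.tendsto.comp hlim)).abs
  refine le_of_tendsto' hlim2 fun n => (hn n).trans ?_
  gcongr
  have : 0 ≤ (θ ^ α) ^ n := by positivity
  nlinarith

/-- Hölder estimate near a point of the closure, uniform over all subsolutions. -/
theorem IsInnerDirection.exists_hoelder {x₁ ν : Euc N} {r c : ℝ}
    (h : IsInnerDirection Ω x₁ ν r c) (hN : 1 ≤ N) (hm : 2 < m) (hα : α = (m - 2) / (m - 1))
    (hC : 0 ≤ C) : ∃ δ > 0, ∃ M, 0 ≤ M ∧ ∀ v, IsEllSub Ω m C v → ContinuousOn v (closure Ω) →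
      ∀ x ∈ closure Ω ∩ ball x₁ δ, ∀ y ∈ closure Ω ∩ ball x₁ δ,
        |v x - v y| ≤ M * ‖x - y‖ ^ α := by
  obtain ⟨hr, hc, hin⟩ := h
  have hm1 : 0 < m - 1 := by linarith
  have hα0 : 0 < α := by rw [hα]; exact div_pos (by linarith) hm1
  have hn : (0 : ℝ) ≤ N - 1 := by
    have : (1 : ℝ) ≤ N := by exact_mod_cast hN
    linarith
  set K := 3 + (N - 1) * α ^ (1 - m) + C with hK
  have hK0 : 0 < K := by positivity
  set s₀ := min r (2 / c) with hs₀
  have hs₀0 : 0 < s₀ := by positivity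
  have hsr : ∀ s, s ≤ s₀ → s ≤ r := fun s hs => hs.trans (min_le_left _ _)
  have hsc : ∀ s, s ≤ s₀ → c * s / 2 ≤ 1 := fun s hs => by
    have := (le_div_iff₀ hc).1 (hs.trans (min_le_right _ _))
    linarith
  have hball : ∀ x ∈ closure Ω, dist x x₁ < r → ∀ s, 0 < s → s ≤ s₀ →
      closedBall (x + s • ν) (c * s / 2) ⊆ Ω := fun x hx hxr s hs hs' =>
    (closedBall_subset_ball (by nlinarith [mul_pos hc hs])).trans
      (hin x hx hxr s hs (hsr s hs'))
  obtain ⟨η, hη0, hη1, hη2⟩ : ∃ η, 0 < η ∧ η < 1 ∧ η * ‖ν‖ ≤ c / 8 := by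
    refine ⟨min (1 / 2) (c / 8 / (‖ν‖ + 1)), by positivity,
      (min_le_left _ _).trans_lt (by norm_num), ?_⟩
    have h1 : min (1 / 2) (c / 8 / (‖ν‖ + 1)) ≤ c / 8 / (‖ν‖ + 1) := min_le_right _ _
    have h2 := (le_div_iff₀ (show 0 < ‖ν‖ + 1 by positivity)).1 h1
    have h3 : 0 < min (1 / 2) (c / 8 / (‖ν‖ + 1)) := by positivity
    nlinarith
  have hθα : (1 - η) ^ α < 1 := Real.rpow_lt_one (by linarith) (by linarith) hα0
  set B := 3 * K * (c / 8) ^ α / (1 - (1 - η) ^ α) with hB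
  have hB1 : B * (1 - (1 - η) ^ α) = 3 * K * (c / 8) ^ α :=
    div_mul_cancel₀ _ (by linarith)
  have hB0 : 0 ≤ B := div_nonneg (by positivity) (by linarith)
  refine ⟨min r (c * s₀ / 16), by positivity, 2 * (B * (8 / c) ^ α) + 3 * K, by positivity, ?_⟩
  intro v hv hvc
  have hvΩ := hvc.mono subset_closure
  have hvert : ∀ x ∈ closure Ω, dist x x₁ < r → ∀ s, 0 < s → s ≤ s₀ →
      |v (x + s • ν) - v x| ≤ B * s ^ α := by
    intro x hx hxr s hs hs'
    have key := abs_sub_le_of_geometric (F := fun σ => v (x + σ • ν)) (θ := 1 - η) (B := B)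
      (s := s) (by linarith) (by linarith) hα0 hs ?_ ?_
    · simpa using key
    · have hT : Tendsto (fun σ : ℝ => x + σ • ν) (𝓝[>] 0) (𝓝[closure Ω] (x + (0 : ℝ) • ν)) := by
        refine tendsto_nhdsWithin_iff.2 ⟨?_, ?_⟩
        · exact (Continuous.tendsto (by fun_prop) 0).mono_left nhdsWithin_le_nhds
        · filter_upwards [Ioo_mem_nhdsGT hs₀0] with σ hσ
          exact subset_closure (hball x hx hxr σ hσ.1 hσ.2.le (mem_closedBall_self
            (by nlinarith [mul_pos hc hσ.1])))
      exact (hvc (x + (0 : ℝ) • ν) (by simpa using hx)).tendsto.comp hT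
    · intro σ hσ hσs
      have hσ' := hσs.trans hs'
      have e : x + ((1 - η) * σ) • ν - (x + σ • ν) = (-(η * σ)) • ν := by
        rw [add_sub_add_left_eq_sub, ← sub_smul]
        congr 1
        ring
      have e2 : ‖x + ((1 - η) * σ) • ν - (x + σ • ν)‖ = η * ‖ν‖ * σ := by
        rw [e, norm_smul, norm_neg, Real.norm_of_nonneg (by positivity)]
        ring
      have h3 : η * ‖ν‖ * σ ≤ c / 8 * σ := by gcongr
      have h1 := hv.abs_sub_le hN hm hα hC hK (by positivity) (hsc σ hσ')
        (hball x hx hxr σ hσ hσ') hvΩ (x := x + ((1 - η) * σ) • ν) (by rw [e2]; linarith)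
      rw [e2] at h1
      rw [abs_sub_comm, hB1]
      calc _ ≤ 3 * K * (η * ‖ν‖ * σ) ^ α := h1
        _ ≤ 3 * K * (c / 8 * σ) ^ α := by gcongr
        _ = _ := by rw [Real.mul_rpow (by positivity) hσ.le]; ring
  rintro x ⟨hx, hxb⟩ y ⟨hy, hyb⟩
  rcases eq_or_ne x y with rfl | hne
  · simp [Real.zero_rpow hα0.ne']
  have hd : 0 < ‖x - y‖ := norm_pos_iff.2 (sub_ne_zero.2 hne)
  have hxr : dist x x₁ < r := (mem_ball.1 hxb).trans_le (min_le_left _ _)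
  have hyr : dist y x₁ < r := (mem_ball.1 hyb).trans_le (min_le_left _ _)
  have hdle : ‖x - y‖ ≤ c * s₀ / 8 := by
    have h1 := (mem_ball.1 hxb).trans_le (min_le_right _ _)
    have h2 := (mem_ball.1 hyb).trans_le (min_le_right _ _)
    have h3 := dist_triangle_right x y x₁
    rw [← dist_eq_norm]
    linarith
  set s := 8 / c * ‖x - y‖ with hs
  have hs0 : 0 < s := by positivity
  have hcs : c * s = 8 * ‖x - y‖ := by
    rw [hs]
    field_simp
  have hss : s ≤ s₀ := by
    have : c * s ≤ c * s₀ := by linarith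
    exact le_of_mul_le_mul_left this hc
  have e : x + s • ν - (y + s • ν) = x - y := add_sub_add_right_eq_sub _ _ _
  have h1 := hv.abs_sub_le hN hm hα hC hK (by positivity) (hsc s hss)
    (hball y hy hyr s hs0 hss) hvΩ (x := x + s • ν) (by rw [e]; linarith)
  rw [e] at h1
  have h2 := hvert x hx hxr s hs0 hss
  have h3 := hvert y hy hyr s hs0 hss
  have h4 : B * s ^ α = B * (8 / c) ^ α * ‖x - y‖ ^ α := by
    rw [hs, Real.mul_rpow (by positivity) hd.le]
    ring
  rw [h4] at h2 h3
  rw [abs_le] at h1 h2 h3 ⊢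
  constructor <;> linarith [h1.1, h1.2, h2.1, h2.2, h3.1, h3.2]

/-- A locally uniform Hölder estimate for a family of functions on a compact connected set
holds globally. -/
theorem exists_hoelder_of_local {S : Set (Euc N)} (hS : IsCompact S) (hconn : IsPreconnected S)
    (hα : 0 < α) (𝓕 : Set (Euc N → ℝ))
    (hloc : ∀ x₁ ∈ S, ∃ δ > 0, ∃ M, 0 ≤ M ∧ ∀ v ∈ 𝓕, ∀ x ∈ S ∩ ball x₁ δ, ∀ y ∈ S ∩ ball x₁ δ,
      |v x - v y| ≤ M * ‖x - y‖ ^ α) :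
    ∃ M > 0, ∀ v ∈ 𝓕, ∀ x ∈ S, ∀ y ∈ S, |v x - v y| ≤ M * ‖x - y‖ ^ α := by
  obtain ⟨δ, hδ, M, hM0, hM⟩ : ∃ δ > 0, ∃ M, 0 ≤ M ∧ ∀ v ∈ 𝓕, ∀ x ∈ S, x ∈ S → ∀ y ∈ S,
      ‖x - y‖ < δ → |v x - v y| ≤ M * ‖x - y‖ ^ α := by
    refine hS.induction_on (p := fun s => ∃ δ > 0, ∃ M, 0 ≤ M ∧ ∀ v ∈ 𝓕, ∀ x ∈ s, x ∈ S →
      ∀ y ∈ S, ‖x - y‖ < δ → |v x - v y| ≤ M * ‖x - y‖ ^ α) ⟨1, one_pos, 0, le_rfl, by simp⟩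
      ?_ ?_ ?_
    · rintro s t hst ⟨δ, hδ, M, hM0, hM⟩
      exact ⟨δ, hδ, M, hM0, fun v hv x hx => hM v hv x (hst hx)⟩
    · rintro s t ⟨δ, hδ, M, hM0, hM⟩ ⟨δ', hδ', M', hM0', hM'⟩
      refine ⟨min δ δ', lt_min hδ hδ', max M M', hM0.trans (le_max_left _ _), ?_⟩
      rintro v hv x (hx | hx) hxS y hy hxy
      · exact (hM v hv x hx hxS y hy (hxy.trans_le (min_le_left _ _))).trans
          (by gcongr; exact le_max_left _ _)
      · exact (hM' v hv x hx hxS y hy (hxy.trans_le (min_le_right _ _))).trans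
          (by gcongr; exact le_max_right _ _)
    · intro x₁ hx₁
      obtain ⟨δ, hδ, M, hM0, hM⟩ := hloc x₁ hx₁
      refine ⟨ball x₁ (δ / 2), mem_nhdsWithin_of_mem_nhds (ball_mem_nhds _ (by linarith)), δ / 2,
        by linarith, M, hM0, fun v hv x hx hxS y hy hxy => hM v hv x ⟨hxS, ?_⟩ y ⟨hy, ?_⟩⟩
      · exact ball_subset_ball (by linarith) hx
      · rw [← dist_eq_norm, dist_comm] at hxy
        have h1 := dist_triangle y x x₁
        have h2 := mem_ball.1 hx
        exact mem_ball.2 (by linarith)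
  have hnear : ∀ x ∈ S, ∀ y ∈ S, ‖x - y‖ < δ → ∀ v ∈ 𝓕, |v x - v y| ≤ M * δ ^ α :=
    fun x hx y hy hxy v hv => (hM v hv x hx hx y hy hxy).trans (by gcongr)
  have hpt : ∀ x ∈ S, ∀ y ∈ S, ∃ B, ∀ v ∈ 𝓕, |v x - v y| ≤ B := by
    intro x hx y hy
    refine hconn.induction₂ (fun x y => ∃ B, ∀ v ∈ 𝓕, |v x - v y| ≤ B) ?_ ?_ ?_ hx hy
    · intro z hz
      filter_upwards [mem_nhdsWithin_of_mem_nhds (ball_mem_nhds z hδ), self_mem_nhdsWithin]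
        with w hw hwS
      rw [mem_ball, dist_comm, dist_eq_norm] at hw
      exact ⟨_, hnear z hz w hwS hw⟩
    · rintro a b c - - - ⟨B, hB⟩ ⟨B', hB'⟩
      exact ⟨B + B', fun v hv => (abs_sub_le _ (v b) _).trans (add_le_add (hB v hv) (hB' v hv))⟩
    · rintro a b - - ⟨B, hB⟩
      exact ⟨B, fun v hv => by rw [abs_sub_comm]; exact hB v hv⟩
  rcases S.eq_empty_or_nonempty with rfl | ⟨z, hz⟩
  · exact ⟨1, one_pos, by simp⟩
  obtain ⟨B, hB⟩ : ∃ B, ∀ x ∈ S, x ∈ S → ∀ v ∈ 𝓕, |v x - v z| ≤ B := by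
    refine hS.induction_on (p := fun s => ∃ B, ∀ x ∈ s, x ∈ S → ∀ v ∈ 𝓕, |v x - v z| ≤ B)
      ⟨0, by simp⟩ ?_ ?_ ?_
    · rintro s t hst ⟨B, hB⟩
      exact ⟨B, fun x hx => hB x (hst hx)⟩
    · rintro s t ⟨B, hB⟩ ⟨B', hB'⟩
      refine ⟨max B B', ?_⟩
      rintro x (hx | hx) hxS v hv
      · exact (hB x hx hxS v hv).trans (le_max_left _ _)
      · exact (hB' x hx hxS v hv).trans (le_max_right _ _)
    · intro x hx
      obtain ⟨B, hB⟩ := hpt x hx z hz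
      refine ⟨ball x δ, mem_nhdsWithin_of_mem_nhds (ball_mem_nhds _ hδ), M * δ ^ α + B,
        fun y hy hyS v hv => ?_⟩
      rw [mem_ball, dist_eq_norm] at hy
      exact (abs_sub_le _ (v x) _).trans (add_le_add (hnear y hyS x hx hy v hv) (hB v hv))
  have hδα : 0 < δ ^ α := by positivity
  refine ⟨1 + M + 2 * |B| / δ ^ α, by positivity, fun v hv x hx y hy => ?_⟩
  have hpos : 0 ≤ ‖x - y‖ ^ α := by positivity
  rcases lt_or_ge ‖x - y‖ δ with hlt | hge
  · refine (hM v hv x hx hx y hy hlt).trans (mul_le_mul_of_nonneg_right ?_ hpos)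
    have : 0 ≤ 2 * |B| / δ ^ α := by positivity
    linarith
  · have h1 := hB x hx hx v hv
    have h2 := hB y hy hy v hv
    rw [abs_sub_comm] at h2
    have h3 := abs_sub_le (v x) (v z) (v y)
    have h4 : δ ^ α ≤ ‖x - y‖ ^ α := by gcongr
    have h5 : 2 * |B| = 2 * |B| / δ ^ α * δ ^ α := by field_simp
    calc |v x - v y| ≤ 2 * |B| := by linarith [le_abs_self B]
      _ = 2 * |B| / δ ^ α * δ ^ α := h5
      _ ≤ (1 + M + 2 * |B| / δ ^ α) * ‖x - y‖ ^ α := by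
        gcongr
        linarith

end Hoelder

/-- Global Hölder estimates in space, uniform in time, for
smooth initial data, Proposition 4.2 of the paper. -/
theorem stmt15 {N : ℕ} (hN : 1 ≤ N) (Ω : Set (Euc N))
    (hΩo : IsOpen Ω) (hΩb : Bornology.IsBounded Ω) (hΩc : IsConnected Ω)
    (hΩ2 : HasC2Boundary Ω)
    (m lam : ℝ) (hm : 2 < m) (hlam : 0 ≤ lam)
    (f u₀ g : Euc N → ℝ)
    (hf : ContinuousOn f (closure Ω)) (hu₀ : ContDiffOn ℝ 2 u₀ (closure Ω))
    (hg : ContinuousOn g (frontier Ω))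
    (hcomp : ∀ x ∈ frontier Ω, u₀ x = g x)
    (u : Euc N → ℝ → ℝ) (hu : IsGlobalParSol Ω f g u₀ lam m u) :
    (∃ Cstar > (0 : ℝ), ∀ x ∈ closure Ω, ∀ t : ℝ, 0 ≤ t → ∀ h : ℝ, 0 ≤ h →
      |u x (t + h) - u x t| ≤ Cstar * h) ∧
    (∃ M > (0 : ℝ), ∀ t : ℝ, 0 ≤ t → ∀ x ∈ closure Ω, ∀ y ∈ closure Ω,
      |u x t - u y t| ≤ M * ‖x - y‖ ^ ((m - 2) / (m - 1))) := by
  have hα0 : 0 < (m - 2) / (m - 1) := div_pos (by linarith) (by linarith)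
  obtain ⟨C, hC0, hC⟩ := hu.exists_time_lipschitz hΩo hΩb hΩ2 hm hlam hf hu₀ hg hcomp
  refine ⟨⟨C, hC0, hC⟩, ?_⟩
  obtain ⟨D, hD0, hD⟩ := hu.exists_isEllSub hΩo hΩb hΩ2 hm hlam hf hu₀.continuousOn hcomp hC0.le hC
  obtain ⟨M, hM0, hM⟩ := exists_hoelder_of_local hΩb.isCompact_closure hΩc.isPreconnected.closure
    hα0 {v | IsEllSub Ω m D v ∧ ContinuousOn v (closure Ω)} (fun x₁ hx₁ => by
      obtain ⟨ν, r, c, hν⟩ := hΩ2.exists_isInnerDirection hΩo hx₁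
      obtain ⟨δ, hδ, M, hM0, hM⟩ := hν.exists_hoelder hN hm rfl hD0
      exact ⟨δ, hδ, M, hM0, fun v hv => hM v hv.1 hv.2⟩)
  have hpos : ∀ t : ℝ, 0 < t → ∀ x ∈ closure Ω, ∀ y ∈ closure Ω,
      |u x t - u y t| ≤ M * ‖x - y‖ ^ ((m - 2) / (m - 1)) := fun t ht =>
    hM (fun x => u x t) ⟨hD t ht, hu.1.comp (f := fun x : Euc N => (x, t)) (by fun_prop)
      fun x hx => ⟨hx, ht.le⟩⟩
  refine ⟨M, hM0, fun t ht x hx y hy => ?_⟩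
  refine le_of_forall_pos_le_add fun ε hε => ?_
  have hs : 0 < ε / (2 * C) := by positivity
  have hs2 : C * (ε / (2 * C)) = ε / 2 := by field_simp
  have h1 := hpos (t + ε / (2 * C)) (by linarith) x hx y hy
  have h2 := hC x hx t ht _ hs.le
  have h3 := hC y hy t ht _ hs.le
  rw [hs2] at h2 h3
  rw [abs_le] at h1 h2 h3 ⊢
  constructor <;> linarith [h1.1, h1.2, h2.1, h2.2, h3.1, h3.2]
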